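/- Let 𝒜 ⊆ ℝ be a countable subring containing an element that is algebraic over ℚ and does not belong to ℤ, let n ≥ 3, and let G be any subgroup of SL(n,ℝ) with E(n,𝒜) ⊆ G ⊆ SL(n,𝒜). Then the linear action of G on ℝⁿ with Lebesgue measure is essentially free, ergodic, not induced, and cocycle superrigid with countable targets: for every countable group Λ, every measurable 1-cocycle Ω : G × ℝⁿ → Λ is cohomologous to a group homomorphism. -/

import Mathlib

open MeasureTheory
open scoped symmDiff

namespace OESuperrigidity

/-- A map into a (typically countable) discrete space is measurable iff all fibers are
measurable sets. -/
def MeasurableDiscrete {X Λ : Type*} [MeasurableSpace X] (f : X → Λ) : Prop :=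
  ∀ l : Λ, MeasurableSet {x | f x = l}

/-- `a` defines an action of the group `G`. -/
def IsAction {G X : Type*} [Group G] (a : G → X → X) : Prop :=
  (∀ x, a 1 x = x) ∧ ∀ g h x, a (g * h) x = a g (a h x)

/-- `f` defines an action of the additive group `ℝ` (a flow). -/
def IsFlow {Y : Type*} (f : ℝ → Y → Y) : Prop :=
  (∀ y, f 0 y = y) ∧ ∀ s t y, f (s + t) y = f s (f t y)

/-- Each map `a g` is measurable and the pushforward of `μ` under it is equivalent to `μ`. -/
def Nonsingular {ι X : Type*} [MeasurableSpace X] (μ : Measure X) (a : ι → X → X) : Prop :=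
  ∀ g, Measurable (a g) ∧ μ.map (a g) ≪ μ ∧ μ ≪ μ.map (a g)

/-- Every a.e. invariant measurable set is null or conull. -/
def ErgodicAction {ι X : Type*} [MeasurableSpace X] (μ : Measure X) (a : ι → X → X) : Prop :=
  ∀ S : Set X, MeasurableSet S → (∀ g, μ ((a g '' S) ∆ S) = 0) → μ S = 0 ∨ μ Sᶜ = 0

/-- The action is essentially free. -/
def EssentiallyFree {G X : Type*} [Group G] [MeasurableSpace X]
    (μ : Measure X) (a : G → X → X) : Prop :=
  ∀ g : G, g ≠ 1 → μ {x | a g x = x} = 0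

/-- The action is induced from a proper subgroup `G₀` acting on a positive-measure
`G₀`-invariant set `X₀` such that the translates of `X₀` over a set `R` of representatives of
the left cosets of `G₀` are pairwise disjoint up to null sets and cover `X` up to a null set. -/
def IsInduced {G X : Type*} [Group G] [MeasurableSpace X]
    (μ : Measure X) (a : G → X → X) : Prop :=
  ∃ G₀ : Subgroup G, G₀ ≠ ⊤ ∧ ∃ X₀ : Set X, MeasurableSet X₀ ∧ 0 < μ X₀ ∧
    (∀ g ∈ G₀, μ ((a g '' X₀) ∆ X₀) = 0) ∧
    ∃ R : Set G, (∀ g : G, ∃! r, r ∈ R ∧ g⁻¹ * r ∈ G₀) ∧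
      (R.Pairwise fun r s => μ (a r '' X₀ ∩ a s '' X₀) = 0) ∧
      μ (⋃ r ∈ R, a r '' X₀)ᶜ = 0

/-- The subgroup `H` admits a measurable fundamental domain for its action. -/
def HasFundamentalDomain {G X : Type*} [Group G] [MeasurableSpace X]
    (μ : Measure X) (a : G → X → X) (H : Subgroup G) : Prop :=
  ∃ U : Set X, MeasurableSet U ∧
    ((H : Set G).Pairwise fun g h => μ (a g '' U ∩ a h '' U) = 0) ∧
    μ (⋃ g ∈ H, a g '' U)ᶜ = 0

/-- A measurable `1`-cocycle for the action `a` with values in the group `Λ`. -/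
def IsCocycle {G X Λ : Type*} [Group G] [Group Λ] [MeasurableSpace X]
    (μ : Measure X) (a : G → X → X) (Ω : G → X → Λ) : Prop :=
  (∀ g, MeasurableDiscrete (Ω g)) ∧
    ∀ g h : G, ∀ᵐ x ∂μ, Ω (g * h) x = Ω g (a h x) * Ω h x

/-- The cocycle `Ω` is cohomologous to a group homomorphism. -/
def CohomologousToHom {G X Λ : Type*} [Group G] [Group Λ] [MeasurableSpace X]
    (μ : Measure X) (a : G → X → X) (Ω : G → X → Λ) : Prop :=
  ∃ δ : G →* Λ, ∃ φ : X → Λ, MeasurableDiscrete φ ∧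
    ∀ g : G, ∀ᵐ x ∂μ, Ω g x = (φ (a g x))⁻¹ * δ g * φ x

/-- The action is cocycle superrigid with countable targets. -/
def CocycleSuperrigid {G X : Type*} [Group G] [MeasurableSpace X]
    (μ : Measure X) (a : G → X → X) : Prop :=
  ∀ (Λ : Type) [Group Λ] [Countable Λ], ∀ Ω : G → X → Λ,
    IsCocycle μ a Ω → CohomologousToHom μ a Ω

/-- `ω` is (a strict version of) the logarithm of the Radon–Nikodym cocycle of the action. -/
def IsLogRNCocycle {G X : Type*} [Group G] [MeasurableSpace X]
    (μ : Measure X) (a : G → X → X) (ω : G → X → ℝ) : Prop :=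
  (∀ g, Measurable (ω g)) ∧
    (∀ g h : G, ∀ᵐ x ∂μ, ω (g * h) x = ω g (a h x) + ω h x) ∧
    ∀ g : G, (fun x => ENNReal.ofReal (Real.exp (ω g x))) =ᵐ[μ] (μ.map (a g⁻¹)).rnDeriv μ

/-- The `G`-invariant σ-finite measure `dμ(x) e^{-s} ds` on `X × ℝ` used for the
Maharam extension. -/
noncomputable def maharamMeasure {X : Type*} [MeasurableSpace X] (μ : Measure X) :
    Measure (X × ℝ) :=
  μ.prod (volume.withDensity fun s => ENNReal.ofReal (Real.exp (-s)))

/-- The Maharam extension `g · (x, s) = (g · x, ω(g, x) + s)`. -/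
def maharamAct {G X : Type*} (a : G → X → X) (ω : G → X → ℝ) : G → X × ℝ → X × ℝ :=
  fun g p => (a g p.1, ω g p.1 + p.2)

end OESuperrigidity

namespace OESuperrigidity

/-- The elementary matrices `e_{ij}(a)`, `i ≠ j`, `a ∈ 𝒜`, viewed inside `SL(n,ℝ)`. -/
def elementarySet (n : ℕ) (A : Subring ℝ) : Set (Matrix.SpecialLinearGroup (Fin n) ℝ) :=
  {g | ∃ i j : Fin n, i ≠ j ∧ ∃ a : ℝ, a ∈ A ∧
    (g : Matrix (Fin n) (Fin n) ℝ) = Matrix.transvection i j a}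

/-- `E(n,𝒜)`: the subgroup of `SL(n,ℝ)` generated by the elementary matrices with
off-diagonal entry in the subring `𝒜 ⊆ ℝ`. -/
def En (n : ℕ) (A : Subring ℝ) : Subgroup (Matrix.SpecialLinearGroup (Fin n) ℝ) :=
  Subgroup.closure (elementarySet n A)

open MeasureTheory

end OESuperrigidity

set_option linter.all false

namespace OESuperrigidity

/-- contraction for the recurrence -/
lemma contr_rec (c : ℕ → ℤ) (d : ℕ) (hc1 : c 1 ≠ 0) (hd : 1 ≤ d)
    (hc : 2 * ∑ l ∈ (Finset.range (d+1)).erase 1, |c l| ≤ |c 1|)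
    (α : ℕ → ℝ) (e : ℕ) (κ : ℝ) (hκ : 0 ≤ κ)
    (hrec : ∀ i, i + d < e → ∑ l ∈ Finset.range (d+1), (c l : ℝ) * α (i + l) = 0)
    (hb : ∀ i < e, |α i| ≤ κ) (t j : ℕ) (hj : t ≤ j ∨ α 0 = 0) (hje : j + t * d < e) :
    |α j| ≤ κ / 2 ^ t := by
  induction t generalizing j with
  | zero => simpa using hb j (by omega)
  | succ t ih =>
    rcases j with _ | j
    · rcases hj with h | h
      · omega
      · rw [h]; simp; positivity
    · have e1 : (t + 1) * d = t * d + d := by ring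
      have h1 := hrec j (by omega)
      rw [← Finset.add_sum_erase _ _ (show 1 ∈ Finset.range (d+1) by simp; omega)] at h1
      have h2 : |(c 1 : ℝ) * α (j+1)| ≤ ∑ l ∈ (Finset.range (d+1)).erase 1, |(c l : ℝ)| * (κ / 2 ^ t) := by
        rw [show (c 1 : ℝ) * α (j+1) = - ∑ l ∈ (Finset.range (d+1)).erase 1, (c l : ℝ) * α (j + l) by linarith,
          abs_neg]
        refine (Finset.abs_sum_le_sum_abs _ _).trans (Finset.sum_le_sum fun l hl => ?_)
        rw [abs_mul]
        refine mul_le_mul_of_nonneg_left (ih _ ?_ ?_) (abs_nonneg _)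
        · rcases hj with h | h
          · left; omega
          · right; exact h
        · simp at hl; omega
      rw [← Finset.sum_mul, abs_mul] at h2
      have h3 : (2:ℝ) * ∑ l ∈ (Finset.range (d+1)).erase 1, |(c l : ℝ)| ≤ |(c 1 : ℝ)| := by
        exact_mod_cast hc
      have h4 : 0 < |(c 1 : ℝ)| := by positivity
      have h5 : 0 ≤ κ / 2 ^ t := by positivity
      rw [pow_succ, ← div_div]
      refine le_of_mul_le_mul_left ?_ h4
      nlinarith

lemma circle_arg_bound (z : Circle) (κ : ℝ) (h0 : 0 ≤ κ) (h1 : κ ≤ Real.pi) :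
    |Complex.arg z| ≤ κ ↔ Real.cos κ ≤ (z : ℂ).re := by
  have h : (z : ℂ).re = Real.cos |Complex.arg z| := by
    rw [Real.cos_abs, Complex.cos_arg (Circle.coe_ne_zero z), Circle.norm_coe, div_one]
  rw [h]
  exact (Real.strictAntiOn_cos.le_iff_ge ⟨h0, h1⟩ ⟨abs_nonneg _, Complex.abs_arg_le_pi _⟩).symm

lemma circle_arg_bound' (z : Circle) (κ : ℝ) (h0 : 0 ≤ κ) (h1 : κ ≤ Real.pi) :
    κ ≤ |Complex.arg z| ↔ (z : ℂ).re ≤ Real.cos κ := by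
  have h : (z : ℂ).re = Real.cos |Complex.arg z| := by
    rw [Real.cos_abs, Complex.cos_arg (Circle.coe_ne_zero z), Circle.norm_coe, div_one]
  rw [h]
  exact (Real.strictAntiOn_cos.le_iff_ge ⟨abs_nonneg _, Complex.abs_arg_le_pi _⟩ ⟨h0, h1⟩).symm

/-- if a product of circle elements is one and angles are small, the angle sum vanishes -/
lemma circle_exp_sum {ι : Type*} (s : Finset ι) (c : ι → ℤ) (z : ι → Circle) :
    ∏ l ∈ s, z l ^ (c l) = Circle.exp (∑ l ∈ s, (c l : ℝ) * Complex.arg (z l)) := by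
  classical
  induction s using Finset.induction_on with
  | empty => simp
  | insert a s ha ih =>
    rw [Finset.prod_insert ha, Finset.sum_insert ha, Circle.exp_add, ih]
    congr 1
    rw [← zsmul_eq_mul, Circle.exp_zsmul, Circle.exp_arg]

lemma circle_exp_eq_one_small (x : ℝ) (h : Circle.exp x = 1) (hx : |x| < 2 * Real.pi) : x = 0 := by
  rw [Circle.exp_eq_one] at h
  obtain ⟨m, hm⟩ := h
  have hp := Real.pi_pos
  rw [hm, abs_mul, abs_of_pos (by positivity : (0:ℝ) < 2 * Real.pi)] at hx
  have : |(m:ℝ)| < 1 := by nlinarith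
  have : m = 0 := by
    have h' : |m| < 1 := by exact_mod_cast this
    exact Int.abs_lt_one_iff.mp h'
  simp [hm, this]

lemma circle_rec (c : ℕ → ℤ) (d : ℕ) (κ : ℝ) (hk : κ * ∑ l ∈ Finset.range (d+1), |(c l : ℝ)| < 2 * Real.pi)
    (z : ℕ → Circle) (e : ℕ) (hz : ∀ i, ∏ l ∈ Finset.range (d+1), z (i+l) ^ (c l) = 1)
    (hb : ∀ i < e, |Complex.arg (z i)| ≤ κ) (i : ℕ) (hi : i + d < e) :
    ∑ l ∈ Finset.range (d+1), (c l : ℝ) * Complex.arg (z (i + l)) = 0 := by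
  apply circle_exp_eq_one_small
  · rw [← circle_exp_sum, hz]
  · refine lt_of_le_of_lt (Finset.abs_sum_le_sum_abs _ _) (lt_of_le_of_lt ?_ hk)
    rw [Finset.mul_sum]
    refine Finset.sum_le_sum fun l hl => ?_
    rw [abs_mul, mul_comm]
    refine mul_le_mul_of_nonneg_right (hb _ ?_) (abs_nonneg _)
    simp at hl; omega

lemma circle_arg_mul (z w : Circle) (h : |Complex.arg z + Complex.arg w| < Real.pi) :
    Complex.arg (z * w : Circle) = Complex.arg z + Complex.arg w := by
  rw [Circle.coe_mul, Complex.arg_mul (by simp) (by simp)]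
  rw [abs_lt] at h
  exact ⟨h.1, h.2.le⟩

lemma circle_arg_inv_abs (z : Circle) : |Complex.arg (z⁻¹ : Circle)| = |Complex.arg z| := by
  rw [Circle.coe_inv, Complex.abs_arg_inv]

lemma circle_arg_mul_le (z w : Circle) (a b : ℝ) (hz : |Complex.arg z| ≤ a) (hw : |Complex.arg w| ≤ b)
    (h : a + b < Real.pi) : |Complex.arg (z * w : Circle)| ≤ a + b := by
  have h1 := (abs_add_le (Complex.arg z) (Complex.arg w)).trans (add_le_add hz hw)
  rwa [circle_arg_mul z w (lt_of_le_of_lt h1 h)]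

lemma exit_disjoint (c : ℕ → ℤ) (d : ℕ) (hc1 : c 1 ≠ 0) (hd : 1 ≤ d)
    (hc : 2 * ∑ l ∈ (Finset.range (d+1)).erase 1, |c l| ≤ |c 1|)
    (κ : ℝ) (hκ : 0 < κ) (hκ1 : κ < Real.pi)
    (hk : κ * ∑ l ∈ Finset.range (d+1), |(c l : ℝ)| < 2 * Real.pi)
    (α β α' β' : ℕ → Circle) (k k' e e' : ℕ)
    (hα : ∀ i, ∏ l ∈ Finset.range (d+1), α (i+l) ^ (c l) = 1)
    (hβ : ∀ i, ∏ l ∈ Finset.range (d+1), β (i+l) ^ (c l) = 1)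
    (hβ' : ∀ i, ∏ l ∈ Finset.range (d+1), β' (i+l) ^ (c l) = 1)
    (hαα : ∀ i, α i = α' i) (hββ : ∀ i, β i * α (i + k) = β' i * α' (i + k'))
    (hkk : k + 3 * d < k') (he : 2 ≤ e) (he' : k' + 2 ≤ e')
    (h1 : ∀ i < e, |Complex.arg (α i)| ≤ κ) (h2 : ∀ i < e, |Complex.arg (β i)| ≤ κ)
    (h3 : κ ≤ |Complex.arg (α e)|)
    (h1' : ∀ i < e', |Complex.arg (α' i)| ≤ κ) (h2' : ∀ i < e', |Complex.arg (β' i)| ≤ κ)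
    (h3' : κ ≤ |Complex.arg (α' e')|) : False := by
  have hα' : ∀ i, ∏ l ∈ Finset.range (d+1), α' (i+l) ^ (c l) = 1 := by
    intro i; rw [← hα i]; exact Finset.prod_congr rfl fun l _ => by rw [hαα]
  have E : e' ≤ e + d := by
    by_contra hcon
    have := contr_rec c d hc1 hd hc (fun i => Complex.arg (α' i)) e' κ hκ.le
      (circle_rec c d κ hk α' e' hα' h1') h1' 1 e (by left; omega) (by omega)
    rw [hαα e] at h3
    simp at this; linarith
  obtain ⟨i, rfl⟩ : ∃ i, e' = i + k' := ⟨e' - k', by omega⟩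
  have b1 := contr_rec c d hc1 hd hc (fun i => Complex.arg (α i)) e κ hκ.le
      (circle_rec c d κ hk α e hα h1) h1 2 (i+k) (by left; omega) (by omega)
  have b2 := contr_rec c d hc1 hd hc (fun i => Complex.arg (β i)) e κ hκ.le
      (circle_rec c d κ hk β e hβ h2) h2 2 i (by left; omega) (by omega)
  have b3 := contr_rec c d hc1 hd hc (fun i => Complex.arg (β' i)) (i+k') κ hκ.le
      (circle_rec c d κ hk β' _ hβ' h2') h2' 2 i (by left; omega) (by omega)
  have e1 : α' (i+k') = (β i * α (i+k)) * (β' i)⁻¹ := by rw [hββ, mul_comm (β' i), mul_inv_cancel_right]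
  have b4 := circle_arg_mul_le _ _ _ _ b2 b1 (by linarith)
  have b5 := circle_arg_mul_le (β i * α (i+k)) (β' i)⁻¹ _ _ b4 ((circle_arg_inv_abs _).le.trans b3) (by linarith)
  rw [← e1] at b5
  linarith

end OESuperrigidity

namespace OESuperrigidity

def exitSet {X : Type*} (κ : ℝ) (C M : ℕ) (α β : ℕ → X → Circle) : Set X :=
  {x | ∃ e ∈ Finset.Icc C M, (∀ i < e, |Complex.arg (α i x)| ≤ κ) ∧ (∀ i < e, |Complex.arg (β i x)| ≤ κ) ∧
    κ ≤ |Complex.arg (α e x)|}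

lemma exitSet_closed {X : Type*} [TopologicalSpace X] (κ : ℝ) (C M : ℕ) (α β : ℕ → X → Circle)
    (h0 : 0 ≤ κ) (h1 : κ ≤ Real.pi) (hα : ∀ i, Continuous (α i)) (hβ : ∀ i, Continuous (β i)) :
    IsClosed (exitSet κ C M α β) := by
  have : exitSet κ C M α β = ⋃ e ∈ Finset.Icc C M, ((⋂ i, ⋂ (_ : i < e), {x | Real.cos κ ≤ (α i x : ℂ).re}) ∩
      (⋂ i, ⋂ (_ : i < e), {x | Real.cos κ ≤ (β i x : ℂ).re}) ∩ {x | (α e x : ℂ).re ≤ Real.cos κ}) := by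
    ext x
    simp only [exitSet, circle_arg_bound _ κ h0 h1, circle_arg_bound' _ κ h0 h1, Set.mem_iUnion, Set.mem_iInter,
      Set.mem_inter_iff, Set.mem_ofPred_eq, exists_prop, and_assoc]
  rw [this]
  have hre : ∀ f : X → Circle, Continuous f → Continuous fun x => (f x : ℂ).re := fun f hf =>
    Complex.continuous_re.comp (continuous_subtype_val.comp hf)
  refine isClosed_biUnion_finset fun e _ => ?_
  refine ((isClosed_iInter fun i => isClosed_iInter fun _ => ?_).inter
    (isClosed_iInter fun i => isClosed_iInter fun _ => ?_)).inter ?_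
  · exact isClosed_le continuous_const (hre _ (hα i))
  · exact isClosed_le continuous_const (hre _ (hβ i))
  · exact isClosed_le (hre _ (hα e)) continuous_const

lemma disjoint_small {X : Type*} [TopologicalSpace X] [CompactSpace X] [T2Space X]
    (I : C(X, ℝ) →ₗ[ℝ] ℝ) (hI : ∀ f : C(X, ℝ), 0 ≤ f → 0 ≤ I f) (B : ℝ) (hB : I 1 ≤ B)
    (K : ℕ) (hK : 0 < K) (F : Fin K → Set X) (hF : ∀ k, IsClosed (F k))
    (hd : Pairwise fun k l => Disjoint (F k) (F l)) :
    ∃ k, ∃ f : C(X, ℝ), 0 ≤ f ∧ f ≤ 1 ∧ (∀ x ∈ F k, f x = 1) ∧ I f ≤ B / K := by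
  have h1 : ∀ k, ∃ f : C(X, ℝ), Set.EqOn f 0 (⋃ l ∈ (Finset.univ.erase k), F l) ∧ Set.EqOn f 1 (F k) ∧
      ∀ x, f x ∈ Set.Icc (0:ℝ) 1 := by
    intro k
    refine exists_continuous_zero_one_of_isClosed (isClosed_biUnion_finset fun l _ => hF l) (hF k) ?_
    simp only [Set.disjoint_iUnion_left]
    intro l hl
    exact hd (by simpa using hl)
  choose f hf0 hf1 hf using h1
  let S : C(X, ℝ) := ⟨fun x => max 1 (∑ k, f k x), by fun_prop⟩
  have hS : ∀ x, 1 ≤ S x := fun x => le_max_left _ _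
  let g : Fin K → C(X, ℝ) := fun k => ⟨fun x => f k x / S x,
    (f k).continuous.div S.continuous fun x => by linarith [hS x]⟩
  have hg0 : ∀ k, 0 ≤ g k := fun k x => div_nonneg (hf k x).1 (by linarith [hS x])
  have hg1 : ∀ k, g k ≤ 1 := fun k x => (div_le_one (by linarith [hS x])).2 ((hf k x).2.trans (hS x))
  have hgF : ∀ k, ∀ x ∈ F k, g k x = 1 := by
    intro k x hx
    have a1 : f k x = 1 := hf1 k hx
    have a2 : ∑ l, f l x = 1 := by
      rw [Finset.sum_eq_single k, a1]
      · intro l _ hl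
        refine hf0 l ?_
        simp only [Set.mem_iUnion]
        exact ⟨k, by simpa using hl.symm, hx⟩
      · simp
    show f k x / max 1 (∑ k, f k x) = 1
    rw [a1, a2]; simp
  have hsum : ∑ k, I (g k) ≤ B := by
    refine le_trans ?_ hB
    rw [← map_sum, ← sub_nonneg, ← map_sub]
    refine hI _ (ContinuousMap.le_def.2 fun x => ?_)
    simp only [ContinuousMap.zero_apply, ContinuousMap.sub_apply, ContinuousMap.one_apply,
      ContinuousMap.sum_apply]
    show 0 ≤ 1 - ∑ i, f i x / S x
    rw [← Finset.sum_div, sub_nonneg, div_le_one (by linarith [hS x])]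
    exact le_max_right _ _
  have : ∃ k, I (g k) ≤ B / K := by
    by_contra hcon
    push Not at hcon
    haveI : Nonempty (Fin K) := ⟨⟨0, hK⟩⟩
    have := Finset.sum_lt_sum_of_nonempty (s := Finset.univ) Finset.univ_nonempty (fun k (_ : k ∈ Finset.univ) => hcon k)
    simp at this
    rw [mul_div_cancel₀ _ (by positivity)] at this
    linarith
  obtain ⟨k, hk⟩ := this
  exact ⟨k, g k, hg0 k, hg1 k, hgF k, hk⟩

lemma exit_fn {X : Type*} [TopologicalSpace X] [CompactSpace X] [T2Space X]
    (c : ℕ → ℤ) (d : ℕ) (hc1 : c 1 ≠ 0) (hd : 1 ≤ d)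
    (hc : 2 * ∑ l ∈ (Finset.range (d+1)).erase 1, |c l| ≤ |c 1|)
    (κ : ℝ) (hκ : 0 < κ) (hκ1 : κ < Real.pi)
    (hk : κ * ∑ l ∈ Finset.range (d+1), |(c l : ℝ)| < 2 * Real.pi)
    (α β : ℕ → X → Circle) (hα : ∀ i, Continuous (α i)) (hβ : ∀ i, Continuous (β i))
    (hαr : ∀ x i, ∏ l ∈ Finset.range (d+1), α (i+l) x ^ (c l) = 1)
    (hβr : ∀ x i, ∏ l ∈ Finset.range (d+1), β (i+l) x ^ (c l) = 1)
    (T : ℕ → C(X, X)) (hTα : ∀ k i x, α i (T k x) = α i x) (hTβ : ∀ k i x, β i (T k x) = β i x * α (i+k) x)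
    (I : C(X, ℝ) →ₗ[ℝ] ℝ) (hI : ∀ f : C(X, ℝ), 0 ≤ f → 0 ≤ I f) (B : ℝ) (hB : I 1 ≤ B)
    (K : ℕ) (hK : 0 < K) (j0 : ℕ) (hj : 3 * d < j0) (C M : ℕ) (hC : K * j0 + 2 ≤ C) (η : ℝ)
    (hη : ∀ k ∈ Finset.Icc 1 K, ∀ f : C(X, ℝ), 0 ≤ f → f ≤ 1 → I (f.comp (T (k * j0))) ≤ I f + η) :
    ∃ h : C(X, ℝ), 0 ≤ h ∧ (∀ x ∈ exitSet κ C M α β, 1 ≤ h x) ∧ I h ≤ B / K + η := by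
  have hcl := (exitSet_closed κ C M α β hκ.le hκ1.le hα hβ).isCompact
  have key : ∀ k k' : Fin K, k < k' → Disjoint (T ((k+1) * j0) '' exitSet κ C M α β) (T ((k'+1) * j0) '' exitSet κ C M α β) := by
    intro k k' hkk
    rw [Set.disjoint_left]
    rintro y ⟨x, ⟨e, he, h1, h2, h3⟩, rfl⟩ ⟨x', ⟨e', he', h1', h2', h3'⟩, hx⟩
    simp only [Finset.mem_Icc] at he he'
    have q1 : ((k:ℕ)+1) * j0 + j0 ≤ ((k':ℕ)+1) * j0 := by
      have : (k:ℕ) + 1 + 1 ≤ k' + 1 := by have : (k:ℕ) < k' := hkk; omega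
      calc ((k:ℕ)+1) * j0 + j0 = (k + 1 + 1) * j0 := by ring
        _ ≤ _ := Nat.mul_le_mul_right _ this
    have q2 : ((k':ℕ)+1) * j0 ≤ K * j0 := Nat.mul_le_mul_right _ k'.2
    refine exit_disjoint c d hc1 hd hc κ hκ hκ1 hk (fun i => α i x) (fun i => β i x) (fun i => α i x')
      (fun i => β i x') ((k+1)*j0) ((k'+1)*j0) e e' (hαr x) (hβr x) (hβr x') ?_ ?_ (by omega) (by omega)
      (by omega) h1 h2 h3 h1' h2' h3'
    · intro i
      show α i x = α i x'
      rw [← hTα _ i x, ← hx, hTα]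
    · intro i
      show β i x * α (i+_) x = β i x' * α (i+_) x'
      rw [← hTβ, ← hx, hTβ]
  obtain ⟨k, f, f0, f1, fF, hf⟩ := disjoint_small I hI B hB K hK (fun k : Fin K => T ((k+1) * j0) '' exitSet κ C M α β)
    (fun k => (hcl.image (T _).continuous).isClosed) (by
      intro k k' hkk
      rcases lt_or_gt_of_ne hkk with h | h
      · exact key _ _ h
      · exact (key _ _ h).symm)
  refine ⟨f.comp (T ((k+1) * j0)), ContinuousMap.le_def.2 fun x => by simpa using ContinuousMap.le_def.1 f0 (T ((k+1)*j0) x), fun x hx => (fF _ ⟨x, hx, rfl⟩).ge, ?_⟩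
  have := hη (k+1) (by simp) f f0 f1
  linarith

end OESuperrigidity

namespace OESuperrigidity

/-- characters of an additive group as a compact space -/
def Chars (B : Type*) [AddCommGroup B] : Set (B → Circle) := {χ | ∀ a b, χ (a + b) = χ a * χ b}

lemma chars_closed (B : Type*) [AddCommGroup B] : IsClosed (Chars B) := by
  have : Chars B = ⋂ a, ⋂ b, {χ | χ (a + b) = χ a * χ b} := by
    ext; simp [Chars]
  rw [this]
  exact isClosed_iInter fun a => isClosed_iInter fun b => isClosed_eq (continuous_apply _)
    ((continuous_apply a).mul (continuous_apply b))

instance (B : Type*) [AddCommGroup B] : CompactSpace (Chars B) :=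
  isCompact_iff_compactSpace.1 (chars_closed B).isCompact

lemma Chars.zero {B : Type*} [AddCommGroup B] (χ : Chars B) : χ.1 0 = 1 := by
  have := χ.2 0 0
  simpa using this

lemma Chars.neg {B : Type*} [AddCommGroup B] (χ : Chars B) (a : B) : χ.1 (-a) = (χ.1 a)⁻¹ := by
  have := χ.2 (-a) a
  rw [neg_add_cancel, Chars.zero χ] at this
  exact eq_inv_of_mul_eq_one_left this.symm

def Chars.hom {B : Type*} [AddCommGroup B] (χ : Chars B) : B →+ Additive Circle where
  toFun b := Additive.ofMul (χ.1 b)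
  map_zero' := by rw [Chars.zero χ]; rfl
  map_add' a b := by rw [χ.2]; rfl

def evC {B : Type*} [AddCommGroup B] (b : B) : C(Chars B, ℂ) :=
  ⟨fun χ => (χ.1 b : ℂ), continuous_subtype_val.comp ((continuous_apply b).comp continuous_subtype_val)⟩

lemma exists_spectral {B : Type*} [AddCommGroup B] {E : Type*} [CStarAlgebra E] (U : B → E)
    (hadd : ∀ a b, U (a + b) = U a * U b) (h0 : U 0 = 1) (hstar : ∀ a, star (U a) = U (-a)) :
    ∃ Φ : C(Chars B, ℂ) →⋆ₐ[ℂ] E, ∀ b, Φ (evC b) = U b := by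
  let S := StarAlgebra.adjoin ℂ (Set.range U)
  have hcomm : ∀ x y : S, x * y = y * x := by
    have := StarAlgebra.isMulCommutative_adjoin ℂ (s := Set.range U)
      (by rintro _ ⟨a, rfl⟩ _ ⟨b, rfl⟩; rw [← hadd, ← hadd, add_comm])
      (by rintro _ ⟨a, rfl⟩ _ ⟨b, rfl⟩; rw [hstar, ← hadd, ← hadd, add_comm])
    exact fun x y => this.is_comm.comm x y
  let 𝒮 := S.topologicalClosure
  haveI : IsClosed (𝒮 : Set E) := S.isClosed_topologicalClosure
  letI i0 : CStarAlgebra 𝒮 := StarSubalgebra.cstarAlgebra 𝒮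
  letI i1 : CommCStarAlgebra 𝒮 :=
    { i0 with mul_comm := (StarSubalgebra.commRingTopologicalClosure S hcomm).mul_comm }
  have hmem : ∀ b, U b ∈ 𝒮 := fun b => S.le_topologicalClosure (StarAlgebra.subset_adjoin ℂ _ ⟨b, rfl⟩)
  let V : B → 𝒮 := fun b => ⟨U b, hmem b⟩
  have hVadd : ∀ a b, V (a + b) = V a * V b := fun a b => Subtype.ext (hadd a b)
  have hV0 : V 0 = 1 := Subtype.ext h0
  have hVs : ∀ a, star (V a) = V (-a) := fun a => Subtype.ext (hstar a)
  have hnorm : ∀ (χ : WeakDual.characterSpace ℂ 𝒮) b, χ (V b) ∈ Submonoid.unitSphere ℂ := by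
    intro χ b
    have : star (χ (V b)) * χ (V b) = 1 := by
      rw [← map_star, ← map_mul, hVs, ← hVadd]; simp [hV0]
    have h2 : ‖χ (V b)‖ * ‖χ (V b)‖ = 1 := by
      have h3 := congrArg norm this
      rwa [norm_mul, norm_star, norm_one] at h3
    have : ‖χ (V b)‖ = 1 := by nlinarith [norm_nonneg (χ (V b))]
    simpa [Submonoid.unitSphere] using this
  let Θ : C(WeakDual.characterSpace ℂ 𝒮, Chars B) :=
    ⟨fun χ => ⟨fun b => ⟨χ (V b), hnorm χ b⟩, fun a b => Subtype.ext (by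
        show χ (V (a+b)) = χ (V a) * χ (V b)
        rw [hVadd, map_mul])⟩, by
      refine Continuous.subtype_mk (continuous_pi fun b => Continuous.subtype_mk ?_ _) _
      exact (gelfandStarTransform 𝒮 (V b)).continuous⟩
  let Ψ : C(Chars B, ℂ) →⋆ₐ[ℂ] 𝒮 :=
    ((gelfandStarTransform 𝒮).symm : C(WeakDual.characterSpace ℂ 𝒮, ℂ) →⋆ₐ[ℂ] 𝒮).comp
      (ContinuousMap.compStarAlgHom' ℂ ℂ Θ)
  refine ⟨𝒮.subtype.comp Ψ, fun b => ?_⟩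
  have : ContinuousMap.compStarAlgHom' ℂ ℂ Θ (evC b) = gelfandStarTransform 𝒮 (V b) := by
    ext χ; rfl
  show ((Ψ (evC b) : 𝒮) : E) = U b
  have h2 : Ψ (evC b) = (gelfandStarTransform 𝒮).symm (ContinuousMap.compStarAlgHom' ℂ ℂ Θ (evC b)) := rfl
  rw [h2, this, StarAlgEquiv.symm_apply_apply]

lemma spectral_unique {B : Type*} [AddCommGroup B] {E : Type*} [CStarAlgebra E]
    (Φ Ψ : C(Chars B, ℂ) →⋆ₐ[ℂ] E) (h : ∀ b, Φ (evC b) = Ψ (evC b)) (f : C(Chars B, ℂ)) : Φ f = Ψ f := by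
  have hΦ : Continuous Φ := AddMonoidHomClass.continuous_of_bound Φ 1 (fun x => by simpa using NonUnitalStarAlgHom.norm_apply_le Φ x)
  have hΨ : Continuous Ψ := AddMonoidHomClass.continuous_of_bound Ψ 1 (fun x => by simpa using NonUnitalStarAlgHom.norm_apply_le Ψ x)
  let S : StarSubalgebra ℂ C(Chars B, ℂ) := StarAlgHom.equalizer Φ Ψ
  have hS : IsClosed (S : Set C(Chars B, ℂ)) := isClosed_eq hΦ hΨ
  have hev : ∀ b, evC b ∈ S := h
  have := ContinuousMap.starSubalgebra_topologicalClosure_eq_top_of_separatesPoints S (by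
    intro χ ψ hne
    have : ∃ b, χ.1 b ≠ ψ.1 b := by
      by_contra hcon
      push Not at hcon
      exact hne (Subtype.ext (funext hcon))
    obtain ⟨b, hb⟩ := this
    exact ⟨_, ⟨evC b, hev b, rfl⟩, fun hh => hb (Subtype.ext hh)⟩)
  have h2 : S.topologicalClosure ≤ S := StarSubalgebra.topologicalClosure_minimal le_rfl hS
  rw [this] at h2
  exact h2 (StarSubalgebra.mem_top (x := f))

end OESuperrigidity

namespace OESuperrigidity

def toC {X : Type*} [TopologicalSpace X] (f : C(X, ℝ)) : C(X, ℂ) := ⟨fun x => (f x : ℂ), by fun_prop⟩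

noncomputable def specI {B H : Type*} [AddCommGroup B] [NormedAddCommGroup H] [InnerProductSpace ℂ H] [CompleteSpace H]
    (Φ : C(Chars B, ℂ) →⋆ₐ[ℂ] (H →L[ℂ] H)) (ξ : H) : C(Chars B, ℝ) →ₗ[ℝ] ℝ where
  toFun f := (inner ℂ ξ (Φ (toC f) ξ)).re
  map_add' f g := by
    rw [show toC (f + g) = toC f + toC g by ext; simp [toC], map_add]
    simp [inner_add_right]
  map_smul' r f := by
    rw [show toC (r • f) = (r : ℂ) • toC f by ext; simp [toC], map_smul]
    simp [inner_smul_right]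

variable {B H : Type*} [AddCommGroup B] [NormedAddCommGroup H] [InnerProductSpace ℂ H] [CompleteSpace H]

lemma specI_nonneg (Φ : C(Chars B, ℂ) →⋆ₐ[ℂ] (H →L[ℂ] H)) (ξ : H) (f : C(Chars B, ℝ)) (hf : 0 ≤ f) :
    0 ≤ specI Φ ξ f := by
  let g : C(Chars B, ℝ) := ⟨fun x => Real.sqrt (f x), by fun_prop⟩
  have h : toC f = star (toC g) * toC g := by
    ext x
    have hx : 0 ≤ f x := by simpa using ContinuousMap.le_def.1 hf x
    show (f x : ℂ) = star ((Real.sqrt (f x) : ℝ) : ℂ) * ((Real.sqrt (f x) : ℝ) : ℂ)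
    rw [Complex.star_def, Complex.conj_ofReal, ← Complex.ofReal_mul, Real.mul_self_sqrt hx]
  show 0 ≤ (inner ℂ ξ (Φ (toC f) ξ)).re
  rw [h, map_mul, map_star, ContinuousLinearMap.star_eq_adjoint]
  show 0 ≤ (inner ℂ ξ (ContinuousLinearMap.adjoint (Φ (toC g)) (Φ (toC g) ξ))).re
  rw [ContinuousLinearMap.adjoint_inner_right]
  have := inner_self_nonneg (𝕜 := ℂ) (x := Φ (toC g) ξ)
  simpa using this

lemma specI_one (Φ : C(Chars B, ℂ) →⋆ₐ[ℂ] (H →L[ℂ] H)) (ξ : H) : specI Φ ξ 1 = ‖ξ‖ ^ 2 := by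
  show (inner ℂ ξ (Φ (toC 1) ξ)).re = _
  rw [show toC (1 : C(Chars B, ℝ)) = 1 by ext; simp [toC], map_one]
  show (inner ℂ ξ ξ).re = _
  rw [inner_self_eq_norm_sq_to_K]
  norm_cast

def oneSubRe (b : B) : C(Chars B, ℝ) := ⟨fun χ => 1 - (χ.1 b : ℂ).re,
  continuous_const.sub (Complex.continuous_re.comp (evC b).continuous)⟩

lemma specI_ev (Φ : C(Chars B, ℂ) →⋆ₐ[ℂ] (H →L[ℂ] H)) (U : B → (H ≃ₗᵢ[ℂ] H))
    (hU : ∀ b x, Φ (evC b) x = U b x) (ξ : H) (b : B) :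
    specI Φ ξ (oneSubRe b) = ‖U b ξ - ξ‖ ^ 2 / 2 := by
  show (inner ℂ ξ (Φ (toC (oneSubRe b)) ξ)).re = _
  have h : toC (oneSubRe b) = (1 : ℂ) • (1 : C(Chars B, ℂ)) - (1/2 : ℂ) • (evC b + star (evC b)) := by
    ext χ
    simp only [toC, oneSubRe, ContinuousMap.coe_mk, one_smul, ContinuousMap.sub_apply, ContinuousMap.one_apply,
      ContinuousMap.smul_apply, ContinuousMap.add_apply, ContinuousMap.star_apply]
    show ((1 - (χ.1 b : ℂ).re : ℝ) : ℂ) = 1 - (1/2 : ℂ) • ((χ.1 b : ℂ) + star (χ.1 b : ℂ))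
    rw [Complex.star_def, Complex.add_conj]; simp
  rw [h, map_sub, map_smul, map_smul, map_add, map_star, map_one]
  simp only [ContinuousLinearMap.sub_apply, ContinuousLinearMap.smul_apply, ContinuousLinearMap.add_apply,
    inner_sub_right, inner_smul_right, inner_add_right, ContinuousLinearMap.star_eq_adjoint,
    ContinuousLinearMap.adjoint_inner_right, hU, ContinuousLinearMap.one_apply]
  have h1 : (inner ℂ ξ ξ).re = ‖ξ‖ ^ 2 := by
    rw [inner_self_eq_norm_sq_to_K]; norm_cast
  have h2 : (inner ℂ (U b ξ) ξ).re = (inner ℂ ξ (U b ξ)).re := by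
    exact inner_re_symm (𝕜 := ℂ) _ _
  have h3 := @norm_sub_sq ℂ H _ _ _ (U b ξ) ξ
  have h3' : ‖U b ξ - ξ‖ ^ 2 = ‖U b ξ‖ ^ 2 - 2 * (inner ℂ (U b ξ) ξ).re + ‖ξ‖ ^ 2 := h3
  rw [h3', (U b).norm_map]
  have h4 : ((1/2 : ℂ) * (inner ℂ ξ (U b ξ) + inner ℂ (U b ξ) ξ)).re = (inner ℂ ξ (U b ξ)).re := by
    rw [Complex.mul_re]; simp [h2]; ring
  simp only [Complex.sub_re, h4, one_mul, h1, h2]; ring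

lemma specI_shear (Φ : C(Chars B, ℂ) →⋆ₐ[ℂ] (H →L[ℂ] H)) (U : B → (H ≃ₗᵢ[ℂ] H))
    (hU : ∀ b x, Φ (evC b) x = U b x) (ξ : H) (W : H ≃ₗᵢ[ℂ] H) (s : B → B) (T : C(Chars B, Chars B))
    (hT : ∀ χ b, (T χ).1 b = χ.1 (s b)) (hW : ∀ b x, U b (W x) = W (U (s b) x)) (f : C(Chars B, ℝ))
    (h0 : 0 ≤ f) (h1 : f ≤ 1) : specI Φ ξ (f.comp T) ≤ specI Φ ξ f + 2 * ‖W ξ - ξ‖ * ‖ξ‖ := by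
  let w : unitary (H →L[ℂ] H) := star (Unitary.linearIsometryEquiv.symm W)
  have hw : ∀ x, (w : H →L[ℂ] H) (W x) = x := by
    intro x
    have : (w : H →L[ℂ] H) * ((Unitary.linearIsometryEquiv.symm W : unitary (H →L[ℂ] H)) : H →L[ℂ] H) = 1 :=
      Unitary.coe_star_mul_self (Unitary.linearIsometryEquiv.symm W)
    exact DFunLike.congr_fun this x
  have hcov := spectral_unique (Φ.comp (ContinuousMap.compStarAlgHom' ℂ ℂ T))
    ((Unitary.conjStarAlgAut ℂ (H →L[ℂ] H) w : (H →L[ℂ] H) →⋆ₐ[ℂ] (H →L[ℂ] H)).comp Φ) (by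
      intro b
      ext x
      show Φ (ContinuousMap.compStarAlgHom' ℂ ℂ T (evC b)) x = (w : H →L[ℂ] H) (Φ (evC b) ((star w : H →L[ℂ] H) x))
      have e1 : ContinuousMap.compStarAlgHom' ℂ ℂ T (evC b) = evC (s b) := by
        ext χ
        show (((T χ).1 b : Circle) : ℂ) = (χ.1 (s b) : ℂ)
        rw [hT]
      have e2 : (star w : H →L[ℂ] H) x = W x := by
        simp only [w, Unitary.coe_star, star_star]; rfl
      rw [e1, hU, hU, e2, hW, hw]) (toC f)
  have e3 : toC (f.comp T) = ContinuousMap.compStarAlgHom' ℂ ℂ T (toC f) := by ext; rfl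
  set Q := Φ (toC f) with hQ
  have e4 : Φ (toC (f.comp T)) ξ = (w : H →L[ℂ] H) (Q (W ξ)) := by
    rw [e3]
    have := DFunLike.congr_fun hcov ξ
    refine this.trans ?_
    show (w : H →L[ℂ] H) (Q ((star w : H →L[ℂ] H) ξ)) = _
    have e2 : (star w : H →L[ℂ] H) ξ = W ξ := by
        simp only [w, Unitary.coe_star, star_star]; rfl
    rw [e2]
  have e5 : ∀ y, inner ℂ ξ ((w : H →L[ℂ] H) y) = inner ℂ (W ξ) y := by
    intro y
    rw [← W.inner_map_map, ← hw y]
    have : (w : H →L[ℂ] H) ((w : H →L[ℂ] H) (W y)) = (w : H →L[ℂ] H) y := by rw [hw]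
    rw [this]
    congr 1
    have h := hw (W.symm y)
    rw [W.apply_symm_apply] at h
    rw [h, W.apply_symm_apply, hw]
  have hQn : ‖Q‖ ≤ 1 := by
    refine (NonUnitalStarAlgHom.norm_apply_le Φ (toC f)).trans ?_
    refine (ContinuousMap.norm_le _ zero_le_one).2 fun x => ?_
    show ‖(f x : ℂ)‖ ≤ 1
    have a1 : 0 ≤ f x := by simpa using ContinuousMap.le_def.1 h0 x
    have a2 : f x ≤ 1 := by simpa using ContinuousMap.le_def.1 h1 x
    rw [Complex.norm_real, Real.norm_of_nonneg a1]; exact a2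
  show (inner ℂ ξ (Φ (toC (f.comp T)) ξ)).re ≤ (inner ℂ ξ (Q ξ)).re + _
  rw [e4, e5]
  have e6 : inner ℂ (W ξ) (Q (W ξ)) = inner ℂ ξ (Q ξ) + (inner ℂ (W ξ - ξ) (Q (W ξ)) + inner ℂ ξ (Q (W ξ - ξ))) := by
    rw [map_sub, inner_sub_left, inner_sub_right]; ring
  rw [e6, Complex.add_re]
  have e7 : ∀ a b : H, ‖inner ℂ a (Q b)‖ ≤ ‖a‖ * ‖b‖ := fun a b =>
    (norm_inner_le_norm a (Q b)).trans (mul_le_mul_of_nonneg_left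
      ((Q.le_opNorm b).trans (by nlinarith [norm_nonneg b])) (norm_nonneg a))
  have e8 := (Complex.re_le_norm _).trans ((norm_add_le (inner ℂ (W ξ - ξ) (Q (W ξ))) (inner ℂ ξ (Q (W ξ - ξ)))).trans
    (add_le_add (e7 _ _) (e7 _ _)))
  rw [W.norm_map] at e8
  linarith

end OESuperrigidity

namespace OESuperrigidity

/-- arithmetic data: `u` in the ring `A0 = ℤ[u]` with a dominated linear coefficient -/
structure UData (u : ℝ) (A0 : Subring ℝ) (c : ℕ → ℤ) (d : ℕ) : Prop where
  mem : u ∈ A0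
  gen : ∀ b ∈ A0, ∃ D, ∃ n : ℕ → ℤ, b = ∑ i ∈ Finset.range D, (n i : ℝ) * u ^ i
  c1 : c 1 ≠ 0
  d1 : 1 ≤ d
  dom : 2 * ∑ l ∈ (Finset.range (d+1)).erase 1, |c l| ≤ |c 1|
  root : ∑ l ∈ Finset.range (d+1), (c l : ℝ) * u ^ l = 0
  lt : |u| < 1
  ne : u ≠ 0

lemma final_est {u : ℝ} {A0 : Subring ℝ} {c : ℕ → ℤ} {d : ℕ} (hu : UData u A0 c d)
    (κ : ℝ) (hκ : 0 < κ) (hκ1 : κ < 1)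
    (hk : κ * ∑ l ∈ Finset.range (d+1), |(c l : ℝ)| < 2 * Real.pi)
    (D : ℕ) (n : ℕ → ℤ) (hb : |∑ i ∈ Finset.range D, (n i : ℝ) * u ^ i| ≤ 1) :
    ∃ M : ℕ, ∀ z : ℕ → Circle, (∀ i, ∏ l ∈ Finset.range (d+1), z (i+l) ^ (c l) = 1) →
      (∀ i ≤ M, |Complex.arg (z i)| ≤ κ) →
      1 - ((∏ i ∈ Finset.range D, z i ^ n i : Circle) : ℂ).re ≤ 2 * κ ^ 2 := by
  obtain ⟨t, ht⟩ : ∃ t : ℕ, (2 * ∑ i ∈ Finset.range D, |(n i : ℝ)|) < 2 ^ t := pow_unbounded_of_one_lt _ one_lt_two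
  refine ⟨D + t * d, fun z hz hM => ?_⟩
  set δ : ℕ → ℝ := fun i => Complex.arg (z i) - Complex.arg (z 0) * u ^ i with hδ
  have hz0 := hM 0 (by omega)
  have hM' : ∀ i < D + t * d + 1, |Complex.arg (z i)| ≤ κ := fun i hi => hM i (by omega)
  have hδ2 : ∀ i < D + t * d + 1, |δ i| ≤ 2 * κ := by
    intro i hi
    have h1 : |u ^ i| ≤ 1 := by rw [abs_pow]; exact pow_le_one₀ (abs_nonneg _) hu.lt.le
    have h2 : |Complex.arg (z 0) * u ^ i| ≤ κ := by
      rw [abs_mul]; nlinarith [abs_nonneg (Complex.arg (z 0)), abs_nonneg (u ^ i)]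
    have := abs_sub (Complex.arg (z i)) (Complex.arg (z 0) * u ^ i)
    have := hM' i hi
    simp only [hδ]; linarith
  have hδr : ∀ i, i + d < D + t * d + 1 → ∑ l ∈ Finset.range (d+1), (c l : ℝ) * δ (i + l) = 0 := by
    intro i hi
    have h1 := circle_rec c d κ hk z _ hz hM' i hi
    have h2 : ∑ l ∈ Finset.range (d+1), (c l : ℝ) * δ (i + l) =
      ∑ l ∈ Finset.range (d+1), (c l : ℝ) * Complex.arg (z (i + l)) -
        Complex.arg (z 0) * u ^ i * ∑ l ∈ Finset.range (d+1), (c l : ℝ) * u ^ l := by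
      rw [Finset.mul_sum, ← Finset.sum_sub_distrib]
      exact Finset.sum_congr rfl fun l _ => by simp only [hδ]; ring
    rw [h2, h1, hu.root]; ring
  have hs : ∀ i < D, |δ i| ≤ 2 * κ / 2 ^ t := fun i hi =>
    contr_rec c d hu.c1 hu.d1 hu.dom δ _ (2 * κ) (by positivity) hδr hδ2 t i (Or.inr (by simp [hδ])) (by omega)
  set θ := ∑ i ∈ Finset.range D, (n i : ℝ) * Complex.arg (z i) with hθ
  have hθ2 : |θ| ≤ 2 * κ := by
    have : θ = Complex.arg (z 0) * (∑ i ∈ Finset.range D, (n i : ℝ) * u ^ i) + ∑ i ∈ Finset.range D, (n i : ℝ) * δ i := by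
      rw [Finset.mul_sum, ← Finset.sum_add_distrib]
      exact Finset.sum_congr rfl fun l _ => by simp only [hδ]; ring
    rw [this]
    refine (abs_add_le _ _).trans ?_
    have h1 : |Complex.arg (z 0) * (∑ i ∈ Finset.range D, (n i : ℝ) * u ^ i)| ≤ κ := by
      rw [abs_mul]; nlinarith [abs_nonneg (Complex.arg (z 0)), abs_nonneg (∑ i ∈ Finset.range D, (n i : ℝ) * u ^ i)]
    have h2 : |∑ i ∈ Finset.range D, (n i : ℝ) * δ i| ≤ κ := by
      calc _ ≤ ∑ i ∈ Finset.range D, |(n i : ℝ)| * (2 * κ / 2 ^ t) := by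
            refine (Finset.abs_sum_le_sum_abs _ _).trans (Finset.sum_le_sum fun i hi => ?_)
            rw [abs_mul]
            exact mul_le_mul_of_nonneg_left (hs i (Finset.mem_range.1 hi)) (abs_nonneg _)
        _ = (2 * ∑ i ∈ Finset.range D, |(n i : ℝ)|) * κ / 2 ^ t := by rw [← Finset.sum_mul]; ring
        _ ≤ κ := by
            rw [div_le_iff₀ (by positivity)]
            nlinarith
    linarith
  have h3 : ((∏ i ∈ Finset.range D, z i ^ n i : Circle) : ℂ).re = Real.cos θ := by
    rw [circle_exp_sum, Circle.coe_exp, Complex.exp_ofReal_mul_I_re]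
  rw [h3]
  have := Real.one_sub_sq_div_two_le_cos (x := θ)
  have h5 : θ ^ 2 ≤ (2 * κ) ^ 2 := sq_le_sq' (by linarith [(abs_le.1 hθ2).1]) (abs_le.1 hθ2).2
  nlinarith

set_option maxHeartbeats 1000000 in
lemma lemmaS {u : ℝ} {A0 : Subring ℝ} {c : ℕ → ℤ} {d : ℕ} (hu : UData u A0 c d) (ε : ℝ) (hε : 0 < ε) :
    ∃ K : ℕ, 0 < K ∧ ∃ ε1 > 0, ∀ j0 > 3 * d, ∃ C : ℕ, ∃ ε2 > 0,
      ∀ (H : Type) [NormedAddCommGroup H] [InnerProductSpace ℂ H] [CompleteSpace H]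
        (U : A0 × A0 → (H ≃ₗᵢ[ℂ] H)) (W W' : ℕ → (H ≃ₗᵢ[ℂ] H)) (ξ : H),
        (∀ a b x, U (a + b) x = U a (U b x)) →
        (∀ k b x, U b (W k x) = W k (U (b.1 + ⟨u, hu.mem⟩ ^ k * b.2, b.2) x)) →
        (∀ k b x, U b (W' k x) = W' k (U (b.1, b.2 + ⟨u, hu.mem⟩ ^ k * b.1) x)) →
        (∀ i < C, ‖U (⟨u, hu.mem⟩ ^ i, 0) ξ - ξ‖ ≤ ε2 * ‖ξ‖) →
        (∀ i < C, ‖U (0, ⟨u, hu.mem⟩ ^ i) ξ - ξ‖ ≤ ε2 * ‖ξ‖) →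
        (∀ k ∈ Finset.Icc 1 K, ‖W (k * j0) ξ - ξ‖ ≤ ε1 * ‖ξ‖) →
        (∀ k ∈ Finset.Icc 1 K, ‖W' (k * j0) ξ - ξ‖ ≤ ε1 * ‖ξ‖) →
        ∀ b : A0, |(b : ℝ)| ≤ 1 → ‖U (b, 0) ξ - ξ‖ ≤ ε * ‖ξ‖ := by
  set Sc := ∑ l ∈ Finset.range (d+1), |(c l : ℝ)| with hSc
  have hSc0 : 0 ≤ Sc := Finset.sum_nonneg fun _ _ => abs_nonneg _
  have hpi := Real.pi_gt_three
  obtain ⟨κ, hκ, hκ1, hκε, hk⟩ : ∃ κ : ℝ, 0 < κ ∧ κ < 1 ∧ κ ≤ ε / 4 ∧ κ * Sc < 2 * Real.pi := by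
    refine ⟨min (1/2) (min (ε/4) (1 / (Sc + 1))), by positivity, ?_, ?_, ?_⟩
    · exact (min_le_left _ _).trans_lt (by norm_num)
    · exact (min_le_right _ _).trans (min_le_left _ _)
    · have : min (1/2) (min (ε/4) (1 / (Sc + 1))) ≤ 1 / (Sc + 1) := (min_le_right _ _).trans (min_le_right _ _)
      have h2 : 1 / (Sc + 1) * Sc ≤ 1 := by
        rw [div_mul_eq_mul_div, div_le_one (by positivity)]; linarith
      nlinarith
  have hcos : 0 < 1 - Real.cos κ := by
    have : Real.cos κ < Real.cos 0 := Real.cos_lt_cos_of_nonneg_of_le_pi le_rfl (by linarith) hκ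
    rw [Real.cos_zero] at this; linarith
  obtain ⟨K, hK⟩ := exists_nat_gt (64 / ε ^ 2)
  have hK0 : (0:ℝ) < K := lt_trans (by positivity) hK
  have hKε : 1 / (K:ℝ) ≤ ε ^ 2 / 64 := by
    rw [div_le_div_iff₀ hK0 (by norm_num)]
    rw [div_lt_iff₀ (by positivity)] at hK
    nlinarith
  refine ⟨K, by exact_mod_cast hK0, ε ^ 2 / 128, by positivity, fun j0 hj0 => ?_⟩
  set C := K * j0 + 2 with hC
  obtain ⟨ε2, hε2, hε21, hε2C⟩ : ∃ ε2 : ℝ, 0 < ε2 ∧ ε2 ≤ 1 ∧ (2 / (1 - Real.cos κ)) * (C * ε2) ≤ ε ^ 2 / 16 := by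
    have hC0 : (0:ℝ) < C := by rw [hC]; positivity
    refine ⟨min 1 ((1 - Real.cos κ) * ε ^ 2 / (32 * C)), by positivity, min_le_left _ _, ?_⟩
    have := min_le_right 1 ((1 - Real.cos κ) * ε ^ 2 / (32 * C))
    calc _ ≤ 2 / (1 - Real.cos κ) * (C * ((1 - Real.cos κ) * ε ^ 2 / (32 * C))) := by gcongr
      _ = ε ^ 2 / 16 := by field_simp; norm_num
  refine ⟨C, ε2, hε2, ?_⟩
  intro H _ _ _ U W W' ξ hadd hW hW' h1 h2 h3 h4 b hb
  set v : A0 := ⟨u, hu.mem⟩ with hv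
  have hU0 : ∀ x, U 0 x = x := by
    intro x
    have := hadd 0 0 x
    rw [add_zero] at this
    exact (U 0).injective this.symm
  obtain ⟨Φ, hΦ⟩ := exists_spectral (fun b => (((U b : H ≃L[ℂ] H)) : H →L[ℂ] H)) (by
      intro a b; ext x; exact hadd a b x) (by ext x; exact hU0 x) (by
      intro a
      rw [ContinuousLinearMap.star_eq_adjoint]
      symm
      rw [ContinuousLinearMap.eq_adjoint_iff]
      intro x y
      show inner ℂ (U (-a) x) y = inner ℂ x (U a y)
      rw [← (U a).inner_map_map, ← hadd, add_neg_cancel, hU0])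
  have hΦU : ∀ b x, Φ (evC b) x = U b x := fun b x => by rw [hΦ]; rfl
  let α : ℕ → Chars (A0 × A0) → Circle := fun i χ => χ.1 (v ^ i, 0)
  let β : ℕ → Chars (A0 × A0) → Circle := fun i χ => χ.1 (0, v ^ i)
  have hα : ∀ i, Continuous (α i) := fun i => (continuous_apply _).comp continuous_subtype_val
  have hβ : ∀ i, Continuous (β i) := fun i => (continuous_apply _).comp continuous_subtype_val
  have hsum : ∀ (χ : Chars (A0 × A0)) (s : Finset ℕ) (n : ℕ → ℤ) (w : ℕ → A0 × A0),
      ∏ l ∈ s, χ.1 (w l) ^ (n l) = χ.1 (∑ l ∈ s, n l • w l) := by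
    intro χ s n w
    have := map_sum (Chars.hom χ) (fun l => n l • w l) s
    simp only [map_zsmul] at this
    exact this.symm
  have hvr : ∀ i, ∑ l ∈ Finset.range (d+1), c l • v ^ (i + l) = 0 := by
    intro i
    apply Subtype.ext
    push_cast
    have : ∑ l ∈ Finset.range (d+1), c l • u ^ (i + l) = u ^ i * ∑ l ∈ Finset.range (d+1), (c l : ℝ) * u ^ l := by
      rw [Finset.mul_sum]
      exact Finset.sum_congr rfl fun l _ => by rw [zsmul_eq_mul, pow_add]; ring
    rw [hu.root, mul_zero] at this
    simpa [hv] using this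
  have hαr : ∀ χ i, ∏ l ∈ Finset.range (d+1), α (i+l) χ ^ (c l) = 1 := by
    intro χ i
    have := hsum χ (Finset.range (d+1)) c (fun l => (v ^ (i+l), 0))
    have e : (∑ l ∈ Finset.range (d+1), c l • ((v ^ (i+l), 0) : A0 × A0)) = 0 :=
      Prod.ext (by rw [Prod.fst_sum]; exact hvr i) (by simp [Prod.snd_sum])
    exact this.trans ((congrArg χ.1 e).trans (Chars.zero χ))
  have hβr : ∀ χ i, ∏ l ∈ Finset.range (d+1), β (i+l) χ ^ (c l) = 1 := by
    intro χ i
    have := hsum χ (Finset.range (d+1)) c (fun l => (0, v ^ (i+l)))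
    have e : (∑ l ∈ Finset.range (d+1), c l • ((0, v ^ (i+l)) : A0 × A0)) = 0 :=
      Prod.ext (by simp [Prod.fst_sum]) (by rw [Prod.snd_sum]; exact hvr i)
    exact this.trans ((congrArg χ.1 e).trans (Chars.zero χ))
  let T : ℕ → C(Chars (A0 × A0), Chars (A0 × A0)) := fun k =>
    ⟨fun χ => ⟨fun b => χ.1 (b.1 + v ^ k * b.2, b.2), fun a b => by
        refine Eq.trans ?_ (χ.2 _ _)
        exact congrArg χ.1 (Prod.ext (by simp only [Prod.fst_add, Prod.snd_add]; ring) rfl)⟩,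
      Continuous.subtype_mk (continuous_pi fun b => (continuous_apply (b.1 + v ^ k * b.2, b.2)).comp continuous_subtype_val) _⟩
  let T' : ℕ → C(Chars (A0 × A0), Chars (A0 × A0)) := fun k =>
    ⟨fun χ => ⟨fun b => χ.1 (b.1, b.2 + v ^ k * b.1), fun a b => by
        refine Eq.trans ?_ (χ.2 _ _)
        exact congrArg χ.1 (Prod.ext rfl (by simp only [Prod.fst_add, Prod.snd_add]; ring))⟩,
      Continuous.subtype_mk (continuous_pi fun b => (continuous_apply (b.1, b.2 + v ^ k * b.1)).comp continuous_subtype_val) _⟩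
  set I := specI Φ ξ with hI
  have hI1 : I 1 ≤ ‖ξ‖ ^ 2 := (specI_one Φ ξ).le
  have hInn := specI_nonneg Φ ξ
  obtain ⟨D, n, hbn⟩ := hu.gen b b.2
  obtain ⟨M, hM⟩ := final_est hu κ hκ hκ1 hk D n (by rw [← hbn]; exact hb)
  have hη : ∀ (V : H ≃ₗᵢ[ℂ] H), ‖V ξ - ξ‖ ≤ ε ^ 2 / 128 * ‖ξ‖ → 2 * ‖V ξ - ξ‖ * ‖ξ‖ ≤ ε ^ 2 / 64 * ‖ξ‖ ^ 2 := by
    intro V hV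
    nlinarith [norm_nonneg ξ]
  obtain ⟨f1, f10, f11, f12⟩ := exit_fn c d hu.c1 hu.d1 hu.dom κ hκ (by linarith) hk α β hα hβ hαr hβr T
    (fun k i χ => by show χ.1 (v ^ i + v ^ k * 0, 0) = χ.1 (v ^ i, 0); simp)
    (fun k i χ => by
      show χ.1 (0 + v ^ k * v ^ i, v ^ i) = χ.1 (0, v ^ i) * χ.1 (v ^ (i + k), 0)
      rw [← χ.2]
      exact congrArg χ.1 (Prod.ext (by simp only [Prod.fst_add]; ring) (by simp)))
    I hInn _ hI1 K (by exact_mod_cast hK0) j0 hj0 C M le_rfl (ε ^ 2 / 64 * ‖ξ‖ ^ 2)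
    (fun k hk f hf0 hf1 => (specI_shear Φ U hΦU ξ (W (k * j0)) (fun b => (b.1 + v ^ (k*j0) * b.2, b.2)) (T (k * j0))
      (fun _ _ => rfl) (hW _) f hf0 hf1).trans (by linarith [hη _ (h3 k hk)]))
  obtain ⟨f2, f20, f21, f22⟩ := exit_fn c d hu.c1 hu.d1 hu.dom κ hκ (by linarith) hk β α hβ hα hβr hαr T'
    (fun k i χ => by show χ.1 (0, v ^ i + v ^ k * 0) = χ.1 (0, v ^ i); simp)
    (fun k i χ => by
      show χ.1 (v ^ i, 0 + v ^ k * v ^ i) = χ.1 (v ^ i, 0) * χ.1 (0, v ^ (i + k))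
      rw [← χ.2]
      exact congrArg χ.1 (Prod.ext (by simp) (by simp only [Prod.snd_add]; ring)))
    I hInn _ hI1 K (by exact_mod_cast hK0) j0 hj0 C M le_rfl (ε ^ 2 / 64 * ‖ξ‖ ^ 2)
    (fun k hk f hf0 hf1 => (specI_shear Φ U hΦU ξ (W' (k * j0)) (fun b => (b.1, b.2 + v ^ (k*j0) * b.1)) (T' (k * j0))
      (fun _ _ => rfl) (hW' _) f hf0 hf1).trans (by linarith [hη _ (h4 k hk)]))
  let big : C(Chars (A0 × A0), ℝ) := (2 * κ ^ 2) • 1 + (2:ℝ) • f1 + (2:ℝ) • f2 +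
    (2 / (1 - Real.cos κ)) • ∑ i ∈ Finset.range C, (oneSubRe (v ^ i, 0) + oneSubRe (0, v ^ i))
  have hre : ∀ z : Circle, 1 - (z : ℂ).re ≤ 2 := fun z => by
    have := (abs_le.1 (Complex.abs_re_le_norm (z : ℂ))).1
    rw [Circle.norm_coe] at this; linarith
  have hre0 : ∀ z : Circle, 0 ≤ 1 - (z : ℂ).re := fun z => by
    have := (abs_le.1 (Complex.abs_re_le_norm (z : ℂ))).2
    rw [Circle.norm_coe] at this; linarith
  have hpt : oneSubRe (b, 0) ≤ big := by
    refine ContinuousMap.le_def.2 fun χ => ?_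
    have g1 : 0 ≤ f1 χ := by simpa using ContinuousMap.le_def.1 f10 χ
    have g2 : 0 ≤ f2 χ := by simpa using ContinuousMap.le_def.1 f20 χ
    have hbig : big χ = 2 * κ ^ 2 + 2 * f1 χ + 2 * f2 χ + 2 / (1 - Real.cos κ) *
        ∑ i ∈ Finset.range C, ((1 - (α i χ : ℂ).re) + (1 - (β i χ : ℂ).re)) := by
      simp only [big, ContinuousMap.add_apply, ContinuousMap.smul_apply, ContinuousMap.one_apply,
        ContinuousMap.sum_apply, smul_eq_mul, mul_one]
      rfl
    have hterm : ∀ i ∈ Finset.range C, 0 ≤ (1 - (α i χ : ℂ).re) + (1 - (β i χ : ℂ).re) := fun i _ =>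
      add_nonneg (hre0 _) (hre0 _)
    have g3 : 0 ≤ 2 / (1 - Real.cos κ) * ∑ i ∈ Finset.range C, ((1 - (α i χ : ℂ).re) + (1 - (β i χ : ℂ).re)) :=
      mul_nonneg (by positivity) (Finset.sum_nonneg hterm)
    rw [hbig]
    show 1 - (χ.1 (b, 0) : ℂ).re ≤ _
    by_cases hex : ∃ e, e ≤ M + C ∧ (κ ≤ |Complex.arg (α e χ)| ∨ κ ≤ |Complex.arg (β e χ)|)
    · classical
      have hmin := fun i hi => Nat.find_min hex (m := i) hi
      obtain ⟨he1, he2⟩ := Nat.find_spec hex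
      set e := Nat.find hex
      by_cases heC : e < C
      · have q : 1 - Real.cos κ ≤ (1 - (α e χ : ℂ).re) + (1 - (β e χ : ℂ).re) := by
          rcases he2 with h | h <;> rw [circle_arg_bound' _ κ hκ.le (by linarith)] at h <;>
            linarith [hre0 (α e χ), hre0 (β e χ)]
        have q2 := q.trans (Finset.single_le_sum hterm (Finset.mem_range.2 heC))
        have q3 : 2 ≤ 2 / (1 - Real.cos κ) * ∑ i ∈ Finset.range C, ((1 - (α i χ : ℂ).re) + (1 - (β i χ : ℂ).re)) := by
          rw [div_mul_eq_mul_div, le_div_iff₀ hcos]; linarith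
        have := hre (χ.1 (b, 0))
        linarith [sq_nonneg κ]
      · have hlt : ∀ i < e, |Complex.arg (α i χ)| ≤ κ ∧ |Complex.arg (β i χ)| ≤ κ := by
          intro i hi
          have := hmin i hi
          push Not at this
          have := this (by omega)
          exact ⟨this.1.le, this.2.le⟩
        by_cases heM : e ≤ M
        · have hb2 := hre (χ.1 (b, 0))
          rcases he2 with h | h
          · have := f11 χ ⟨e, Finset.mem_Icc.2 ⟨by omega, heM⟩, fun i hi => (hlt i hi).1, fun i hi => (hlt i hi).2, h⟩
            linarith [sq_nonneg κ]
          · have := f21 χ ⟨e, Finset.mem_Icc.2 ⟨by omega, heM⟩, fun i hi => (hlt i hi).2, fun i hi => (hlt i hi).1, h⟩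
            linarith [sq_nonneg κ]
        · have h := hM (fun i => α i χ) (hαr χ) (fun i hi => (hlt i (by omega)).1)
          have hp := hsum χ (Finset.range D) n (fun l => (v ^ l, 0))
          have hbe : ∑ l ∈ Finset.range D, n l • ((v ^ l, 0) : A0 × A0) = (b, 0) := by
            ext
            · simp [Prod.fst_sum, hbn, hv]
            · simp [Prod.snd_sum]
          rw [hbe] at hp
          rw [← hp]
          linarith
    · push Not at hex
      have h := hM (fun i => α i χ) (hαr χ) (fun i hi => (hex i (by omega)).1.le)
      have hp := hsum χ (Finset.range D) n (fun l => (v ^ l, 0))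
      have hbe : ∑ l ∈ Finset.range D, n l • ((v ^ l, 0) : A0 × A0) = (b, 0) := by
        ext
        · simp [Prod.fst_sum, hbn, hv]
        · simp [Prod.snd_sum]
      rw [hbe] at hp
      rw [← hp]
      linarith
  have hfin : I (oneSubRe (b, 0)) ≤ I big := by
    rw [← sub_nonneg, ← map_sub]; exact hInn _ (sub_nonneg.2 hpt)
  have hIev := specI_ev Φ U hΦU ξ
  have hIbig : I big = 2 * κ ^ 2 * I 1 + 2 * I f1 + 2 * I f2 + 2 / (1 - Real.cos κ) *
      ∑ i ∈ Finset.range C, (‖U (v ^ i, 0) ξ - ξ‖ ^ 2 / 2 + ‖U (0, v ^ i) ξ - ξ‖ ^ 2 / 2) := by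
    simp only [big, map_add, map_smul, map_sum, smul_eq_mul, hI, hIev]
  have hsm : ∑ i ∈ Finset.range C, (‖U (v ^ i, 0) ξ - ξ‖ ^ 2 / 2 + ‖U (0, v ^ i) ξ - ξ‖ ^ 2 / 2) ≤ C * (ε2 * ‖ξ‖ ^ 2) := by
    calc _ ≤ ∑ i ∈ Finset.range C, ε2 * ‖ξ‖ ^ 2 := by
          refine Finset.sum_le_sum fun i hi => ?_
          have a1 := pow_le_pow_left₀ (norm_nonneg _) (h1 i (Finset.mem_range.1 hi)) 2
          have a2 := pow_le_pow_left₀ (norm_nonneg _) (h2 i (Finset.mem_range.1 hi)) 2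
          have a3 : (ε2 * ‖ξ‖) ^ 2 ≤ ε2 * ‖ξ‖ ^ 2 := by
            rw [mul_pow]; exact mul_le_mul_of_nonneg_right (by nlinarith) (sq_nonneg _)
          linarith
      _ = _ := by simp
  have hsm2 := mul_le_mul_of_nonneg_left hsm (show 0 ≤ 2 / (1 - Real.cos κ) by positivity)
  have hsm3 := mul_le_mul_of_nonneg_right hε2C (sq_nonneg ‖ξ‖)
  rw [hIev, hIbig] at hfin
  have hKε' : ‖ξ‖ ^ 2 / K ≤ ε ^ 2 / 64 * ‖ξ‖ ^ 2 := by
    have := mul_le_mul_of_nonneg_right hKε (sq_nonneg ‖ξ‖)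
    calc _ = 1 / (K:ℝ) * ‖ξ‖ ^ 2 := by ring
      _ ≤ _ := this
  have hκ3 : 2 * κ ^ 2 * I 1 ≤ ε ^ 2 / 8 * ‖ξ‖ ^ 2 := by
    have : 2 * κ ^ 2 ≤ ε ^ 2 / 8 := by nlinarith
    calc _ ≤ 2 * κ ^ 2 * ‖ξ‖ ^ 2 := mul_le_mul_of_nonneg_left hI1 (by positivity)
      _ ≤ _ := mul_le_mul_of_nonneg_right this (sq_nonneg _)
  refine le_of_sq_le_sq ?_ (by positivity)
  rw [mul_pow]
  have : 0 ≤ ε ^ 2 * ‖ξ‖ ^ 2 := by positivity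
  linarith

end OESuperrigidity

namespace OESuperrigidity
open Filter Topology

lemma null_of_inter {X : Type*} [MeasurableSpace X] {μ : Measure X} [SigmaFinite μ] {S : Set X}
    (h : ∀ B, MeasurableSet B → μ B < ⊤ → μ (B ∩ S) = 0) : μ S = 0 := by
  have : S ⊆ ⋃ n, spanningSets μ n ∩ S := by
    intro x hx
    have : x ∈ ⋃ n, spanningSets μ n := by rw [iUnion_spanningSets]; trivial
    rw [← Set.iUnion_inter]; exact ⟨this, hx⟩
  refine measure_mono_null this (measure_iUnion_null fun n => h _ (measurableSet_spanningSets μ n) (measure_spanningSets_lt_top μ n))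

section CM
variable {X Λ : Type*} [TopologicalSpace X] [MeasurableSpace X] [BorelSpace X] [R1Space X]
  [MeasurableSpace Λ] [DiscreteMeasurableSpace Λ] [Countable Λ]
  {μ : Measure X} [μ.InnerRegularCompactLTTop] [IsLocallyFiniteMeasure μ]

lemma cm {P : Type*} [TopologicalSpace P] (T : P → X → X) (hT : Continuous (Function.uncurry T))
    (hmp : ∀ p, MeasurePreserving (T p) μ μ) (p0 : P) (h0 : ∀ x, T p0 x = x) {f : X → Λ} (hf : Measurable f)
    {B : Set X} (hB : MeasurableSet B) (hB' : μ B < ⊤) :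
    Tendsto (fun p => μ (B ∩ {x | f (T p x) ≠ f x})) (𝓝 p0) (𝓝 0) := by
  have key : ∀ S, MeasurableSet S → μ S < ⊤ → Tendsto (fun p => μ (S \ T p ⁻¹' S)) (𝓝 p0) (𝓝 0) := by
    intro S hS hS'
    let F : C(P × X, X) := ⟨_, hT⟩
    have h := tendsto_measure_symmDiff_preimage_nhds_zero (μ := μ) (ν := μ) (l := 𝓝 p0) (f := F.curry) (g := F.curry p0) (s := S)
      (F.curry.continuous.tendsto p0) (Eventually.of_forall hmp) (hmp p0) hS.nullMeasurableSet hS'.ne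
    have e : (F.curry p0) ⁻¹' S = S := by ext x; simp [F, Function.uncurry, h0]
    rw [e] at h
    refine tendsto_of_tendsto_of_tendsto_of_le_of_le tendsto_const_nhds h (fun _ => zero_le) fun p => measure_mono ?_
    intro x hx; exact Or.inr hx
  let Bl : Λ → Set X := fun l => B ∩ f ⁻¹' {l}
  have hBl : ∀ l, MeasurableSet (Bl l) := fun l => hB.inter (hf (measurableSet_singleton l))
  have hsum : ∑' l, μ (Bl l) ≠ ⊤ := by
    rw [← measure_iUnion _ hBl]
    · exact ((measure_mono (Set.iUnion_subset fun l => Set.inter_subset_left)).trans_lt hB').ne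
    · intro l l' hl
      refine Set.disjoint_left.2 fun x hx hx' => hl ?_
      rw [← hx.2, ← hx'.2]
  rw [ENNReal.tendsto_nhds_zero]
  intro ε hε
  have htail := ENNReal.tendsto_tsum_compl_atTop_zero hsum
  rw [ENNReal.tendsto_nhds_zero] at htail
  obtain ⟨s, hs⟩ := (htail (ε/2) (ENNReal.half_pos hε.ne')).exists
  have hfin : Tendsto (fun p => ∑ l ∈ s, μ (Bl l \ T p ⁻¹' Bl l)) (𝓝 p0) (𝓝 0) := by
    have := tendsto_finsetSum s (fun l _ => key (Bl l) (hBl l) ((measure_mono Set.inter_subset_left).trans_lt hB'))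
    simpa using this
  rw [ENNReal.tendsto_nhds_zero] at hfin
  filter_upwards [hfin (ε/2) (ENNReal.half_pos hε.ne')] with p hp
  have hsub : B ∩ {x | f (T p x) ≠ f x} ⊆ (⋃ l ∈ s, (Bl l \ T p ⁻¹' Bl l)) ∪ ⋃ l : {l // l ∉ s}, Bl l := by
    rintro x ⟨hxB, hx⟩
    by_cases h : f x ∈ s
    · left
      refine Set.mem_biUnion h ⟨⟨hxB, rfl⟩, fun h' => hx h'.2⟩
    · right
      exact Set.mem_iUnion.2 ⟨⟨f x, h⟩, hxB, rfl⟩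
  calc _ ≤ μ (⋃ l ∈ s, (Bl l \ T p ⁻¹' Bl l)) + μ (⋃ l : {l // l ∉ s}, Bl l) :=
        (measure_mono hsub).trans (measure_union_le _ _)
    _ ≤ ε/2 + ε/2 := add_le_add ((measure_biUnion_finset_le _ _).trans hp) ((measure_iUnion_le _).trans hs)
    _ = ε := ENNReal.add_halves ε

variable [Group Λ] [SigmaFinite μ]

lemma trick (T : ℝ → X → X) (hT : Continuous (Function.uncurry T)) (hmp : ∀ p, MeasurePreserving (T p) μ μ)
    (h0 : ∀ x, T 0 x = x) (hadd : ∀ s t x, T (s + t) x = T s (T t x)) (A : AddSubgroup ℝ) (hA : Dense (A : Set ℝ))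
    {f : X → Λ} (hf : Measurable f)
    (hα : ∀ b ∈ A, ∃ α β : X → Λ, (∀ a ∈ A, ∀ᵐ x ∂μ, α (T a x) = α x) ∧ (∀ a ∈ A, ∀ᵐ x ∂μ, β (T a x) = β x) ∧
      ∀ᵐ x ∂μ, f (T b x) = β x * f x * (α x)⁻¹) (t : ℝ) : ∀ᵐ x ∂μ, f (T t x) = f x := by
  have hinv : ∀ a ∈ A, ∀ b ∈ A, ∀ᵐ x ∂μ, (f (T a (T b x)) = f (T b x) ↔ f (T a x) = f x) := by
    intro a ha b hb
    obtain ⟨α, β, h1, h2, h3⟩ := hα b hb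
    filter_upwards [h1 a ha, h2 a ha, h3, (hmp a).quasiMeasurePreserving.ae h3] with x q1 q2 q3 q4
    rw [← hadd, add_comm, hadd, q4, q1, q2, q3]
    simp
  have hmul : ∀ s ∈ A, ∀ᵐ x ∂μ, f (T s x) = f x → ∀ k : ℕ, f (T (k * s) x) = f x := by
    intro s hs
    have : ∀ᵐ x ∂μ, ∀ k : ℕ, (f (T s (T (k * s) x)) = f (T (k * s) x) ↔ f (T s x) = f x) := by
      rw [ae_all_iff]; intro k
      exact hinv s hs _ (by rw [← nsmul_eq_mul]; exact A.nsmul_mem hs k)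
    filter_upwards [this] with x hx h k
    induction k with
    | zero => simp [h0]
    | succ k ih =>
      have := (hx k).2 h
      rw [← hadd] at this
      rw [← ih, ← this]; congr 2; push_cast; ring
  have hz : ∀ a ∈ A, 0 ≤ a → ∀ᵐ x ∂μ, f (T a x) = f x := by
    intro a ha ha0
    rw [ae_iff]
    refine null_of_inter fun B hB hB' => ?_
    refine le_antisymm (ENNReal.le_of_forall_pos_le_add fun ε hε _ => ?_) (zero_le)
    have hc := cm (μ := μ) T hT hmp 0 h0 hf hB hB'
    rw [ENNReal.tendsto_nhds_zero] at hc
    have hc' := hc (ε / 2 : ENNReal) (ENNReal.half_pos (by simpa using hε.ne'))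
    obtain ⟨η, hη, hη'⟩ := Metric.eventually_nhds_iff.1 hc'
    obtain ⟨s, hsA, hs⟩ := hA.exists_mem_open isOpen_Ioo (Set.nonempty_Ioo.2 hη)
    have hs0 : 0 < s := hs.1
    set k := ⌊a / s⌋₊
    set r := a - k * s
    have hr0 : 0 ≤ r := by
      have := Nat.floor_le (div_nonneg ha0 hs0.le)
      rw [le_div_iff₀ hs0] at this; linarith
    have hrs : r < s := by
      have := Nat.lt_floor_add_one (a / s)
      rw [div_lt_iff₀ hs0] at this; simp only [r]; linarith
    have hrA : r ∈ A := A.sub_mem ha (by rw [← nsmul_eq_mul]; exact A.nsmul_mem hsA k)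
    have e1 := hη' (y := s) (by rw [Real.dist_eq, sub_zero, abs_of_pos hs0]; exact hs.2)
    have e2 := hη' (y := r) (by rw [Real.dist_eq, sub_zero, abs_of_nonneg hr0]; linarith [hs.2])
    have e3 : ∀ᵐ x ∂μ, f (T s x) = f x → f (T r x) = f x → f (T a x) = f x := by
      filter_upwards [hinv s hsA r hrA, (hmp r).quasiMeasurePreserving.ae (hmul s hsA)] with x q1 q2 q3 q4
      have := q2 (q1.2 q3) k
      rw [← hadd, q4] at this
      rw [← this]; congr 2; simp [r]
    calc _ ≤ μ ((B ∩ {x | f (T s x) ≠ f x}) ∪ (B ∩ {x | f (T r x) ≠ f x})) := by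
          refine measure_mono_ae ?_
          filter_upwards [e3] with x hx
          intro h
          have h1 : x ∈ B := h.1
          have h2 : ¬ f (T a x) = f x := h.2
          by_cases h3 : f (T s x) = f x
          · exact Or.inr ⟨h1, fun h4 => h2 (hx h3 h4)⟩
          · exact Or.inl ⟨h1, h3⟩
      _ ≤ _ := measure_union_le _ _
      _ ≤ ε / 2 + ε / 2 := add_le_add e1 e2
      _ = 0 + ε := by rw [ENNReal.add_halves, zero_add]
  have hz' : ∀ a ∈ A, ∀ᵐ x ∂μ, f (T a x) = f x := by
    intro a ha
    rcases le_total 0 a with h | h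
    · exact hz a ha h
    · have := (hmp a).quasiMeasurePreserving.ae (hz (-a) (A.neg_mem ha) (by linarith))
      filter_upwards [this] with x hx
      rw [← hadd, neg_add_cancel, h0] at hx
      exact hx.symm
  rw [ae_iff]
  refine null_of_inter fun B hB hB' => ?_
  refine le_antisymm (ENNReal.le_of_forall_pos_le_add fun ε hε _ => ?_) (zero_le)
  have hc := cm (μ := μ) T hT hmp 0 h0 hf (B := T (-t) ⁻¹' B) ((hmp (-t)).measurable hB)
    (by rw [(hmp (-t)).measure_preimage hB.nullMeasurableSet]; exact hB')
  rw [ENNReal.tendsto_nhds_zero] at hc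
  obtain ⟨η, hη, hη'⟩ := Metric.eventually_nhds_iff.1 (hc ε (by simpa using hε))
  obtain ⟨a, haA, ha⟩ := hA.exists_mem_open isOpen_Ioo (show (Set.Ioo t (t + η)).Nonempty from Set.nonempty_Ioo.2 (by linarith))
  have e1 := hη' (y := a - t) (by rw [Real.dist_eq, sub_zero, abs_of_pos (by linarith [ha.1])]; linarith [ha.2])
  rw [zero_add]
  calc _ ≤ μ (T t ⁻¹' (T (-t) ⁻¹' B ∩ {x | f (T (a - t) x) ≠ f x})) := by
        refine measure_mono_ae ?_
        filter_upwards [hz' a haA] with x hx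
        intro h
        refine ⟨?_, ?_⟩
        · show T (-t) (T t x) ∈ B
          rw [← hadd, neg_add_cancel, h0]; exact h.1
        · show f (T (a - t) (T t x)) ≠ f (T t x)
          rw [← hadd, sub_add_cancel, hx]; exact fun h' => h.2 h'.symm
    _ = _ := (hmp t).measure_preimage (((hmp (-t)).measurable hB).inter
        ((measurableSet_eq_fun (hf.comp (hmp _).measurable) hf).compl)).nullMeasurableSet
    _ ≤ ε := e1
end CM

end OESuperrigidity

namespace OESuperrigidity
open Filter Topology

section Indep
variable {ι Λ : Type*} [Fintype ι] [DecidableEq ι]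

lemma meas_single (i : ι) : Measurable (fun t : ℝ => (Pi.single i t : ι → ℝ)) :=
  (continuous_single i).measurable

lemma mp_det (M : Matrix ι ι ℝ) (hM : M.det = 1) : MeasurePreserving (fun x : ι → ℝ => M.mulVec x) volume volume := by
  have h := Real.map_matrix_volume_pi_eq_smul_volume_pi (M := M) (by rw [hM]; exact one_ne_zero)
  refine ⟨(LinearMap.continuous_of_finiteDimensional (Matrix.toLin' M)).measurable, ?_⟩
  rw [hM] at h
  have h2 : Measure.map (⇑(Matrix.toLin' M)) volume = volume := by simpa using h
  exact h2

lemma mp_shear (i j : ι) (hij : i ≠ j) (t : ℝ) :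
    MeasurePreserving (fun x : ι → ℝ => x + Pi.single i (t * x j)) volume volume := by
  have := mp_det (Matrix.transvection i j t) (Matrix.det_transvection_of_ne i j hij t)
  convert this using 2 with x
  ext l
  simp only [Matrix.transvection, Matrix.add_mulVec, Matrix.one_mulVec, Pi.add_apply, Matrix.single_mulVec]
  congr 1

variable [MeasurableSpace Λ] [DiscreteMeasurableSpace Λ] [Countable Λ]

/-- `f` does not depend on the coordinate `i`, up to null sets. -/
def Indep (i : ι) (f : (ι → ℝ) → Λ) : Prop := ∀ t : ℝ, ∀ᵐ x, f (x + Pi.single i t) = f x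

lemma Indep.congr {i : ι} {f g : (ι → ℝ) → Λ} (h : Indep i f) (hfg : ∀ᵐ x, g x = f x) : Indep i g := by
  intro t
  filter_upwards [h t, hfg, (measurePreserving_add_right volume (Pi.single i t)).quasiMeasurePreserving.ae hfg] with x h1 h2 h3
  rw [h2, h3, h1]

lemma Indep.mul [Group Λ] {i : ι} {f g : (ι → ℝ) → Λ} (h : Indep i f) (h' : Indep i g) :
    Indep i (fun x => f x * g x) := by
  intro t
  filter_upwards [h t, h' t] with x h1 h2
  rw [h1, h2]

lemma Indep.inv [Group Λ] {i : ι} {f : (ι → ℝ) → Λ} (h : Indep i f) : Indep i (fun x => (f x)⁻¹) := by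
  intro t
  filter_upwards [h t] with x h1
  rw [h1]

lemma indep_ae_ae {i : ι} {f : (ι → ℝ) → Λ} (hf : Measurable f) (h : Indep i f) :
    ∀ᵐ x, ∀ᵐ t : ℝ, f (x + Pi.single i t) = f x := by
  have hm : MeasurableSet {p : (ι → ℝ) × ℝ | f (p.1 + Pi.single i p.2) = f p.1} :=
    measurableSet_eq_fun (hf.comp (measurable_fst.add ((meas_single i).comp measurable_snd))) (hf.comp measurable_fst)
  refine (Measure.ae_ae_comm (μ := volume) (ν := volume) (p := fun (x : ι → ℝ) (t : ℝ) => f (x + Pi.single i t) = f x) hm).2 ?_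
  exact Eventually.of_forall h

lemma all_of_ae_add {P : ℝ → Prop} (h : ∀ᵐ t, P t) (hadd : ∀ s t, P s → P t → P (s + t)) (t : ℝ) : P t := by
  have h2 : ∀ᵐ s, P (t - s) := (Measure.measurePreserving_sub_left volume t).quasiMeasurePreserving.ae h
  obtain ⟨s, h1, h2⟩ := (h.and h2).exists
  simpa using hadd _ _ h1 h2

lemma indep_of_ae_ae {i : ι} {f : (ι → ℝ) → Λ} (hf : Measurable f)
    (h : ∀ᵐ x, ∀ᵐ t : ℝ, f (x + Pi.single i t) = f x) : Indep i f := by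
  have hm : MeasurableSet {p : (ι → ℝ) × ℝ | f (p.1 + Pi.single i p.2) = f p.1} :=
    measurableSet_eq_fun (hf.comp (measurable_fst.add ((meas_single i).comp measurable_snd))) (hf.comp measurable_fst)
  have := (Measure.ae_ae_comm (p := fun x t => f (x + Pi.single i t) = f x) hm).1 h
  refine all_of_ae_add this fun s t hs ht => ?_
  filter_upwards [hs, (measurePreserving_add_right volume (Pi.single i s)).quasiMeasurePreserving.ae ht] with x h1 h2
  rw [Pi.single_add, ← add_assoc, h2, h1]

lemma indep_vec {f : (ι → ℝ) → Λ} (v : ι → ℝ) (h : ∀ i, v i ≠ 0 → Indep i f) : ∀ᵐ x, f (x + v) = f x := by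
  have : ∀ s : Finset ι, ∀ᵐ x, f (x + ∑ i ∈ s, Pi.single i (v i)) = f x := by
    intro s
    induction s using Finset.induction_on with
    | empty => simp
    | insert a s ha ih =>
      have h3 : ∀ᵐ x, f (x + Pi.single a (v a)) = f x := by
        by_cases h0 : v a = 0
        · simp [h0]
        · exact h a h0 (v a)
      filter_upwards [ih, (measurePreserving_add_right volume (∑ i ∈ s, Pi.single i (v i))).quasiMeasurePreserving.ae h3] with x h1 h2
      rw [Finset.sum_insert ha, add_comm (Pi.single _ _), ← add_assoc, h2, h1]
  have h2 := this Finset.univ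
  rwa [Finset.univ_sum_single] at h2

lemma indep_comp (p : ι → Prop) [DecidablePred p] {f : (ι → ℝ) → Λ} (hf : Measurable f) (h : ∀ i, p i → Indep i f)
    (T : (ι → ℝ) → ι → ℝ) (hT : Measure.QuasiMeasurePreserving T volume volume) (hTp : ∀ x i, ¬ p i → T x i = x i) :
    ∀ᵐ x, f (T x) = f x := by
  let r : (ι → ℝ) → ι → ℝ := fun w i => if p i then w i else 0
  have hr : Measurable r := measurable_pi_lambda _ fun i => by
    by_cases hi : p i
    · simpa [r, hi] using measurable_pi_apply i
    · simp [r, hi]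
  have hm : MeasurableSet {q : (ι → ℝ) × (ι → ℝ) | f (q.2 + r q.1) = f q.2} :=
    measurableSet_eq_fun (hf.comp (measurable_snd.add (hr.comp measurable_fst))) (hf.comp measurable_snd)
  have h1 := (Measure.ae_ae_comm (μ := volume) (ν := volume) (p := fun w x => f (x + r w) = f x) hm).1
    (Eventually.of_forall fun w => indep_vec (r w) fun i hi => h i (by by_contra hp; simp [r, hp] at hi))
  filter_upwards [h1, hT.ae h1] with x h1 h2
  have h3 := (measurePreserving_sub_right volume (T x - x)).quasiMeasurePreserving.ae h2
  obtain ⟨t, h1, h3⟩ := (h1.and h3).exists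
  rw [← h3, ← h1]
  congr 1
  ext i
  by_cases hi : p i
  · simp [r, hi]; ring
  · simp [r, hi, hTp x i hi]

lemma ae_ne_zero (j : ι) : ∀ᵐ x : ι → ℝ, x j ≠ 0 := by
  have h := Measure.addHaar_submodule (volume : Measure (ι → ℝ)) (LinearMap.ker (LinearMap.proj (R := ℝ) (φ := fun _ : ι => ℝ) j)) (by
    intro h
    have : (Pi.single j 1 : ι → ℝ) ∈ LinearMap.ker (LinearMap.proj (R := ℝ) (φ := fun _ : ι => ℝ) j) := by rw [h]; trivial
    simp at this)
  rw [ae_iff]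
  convert h using 2
  ext x; simp

lemma indep_of_shear {i j : ι} (hij : i ≠ j) {f : (ι → ℝ) → Λ} (hf : Measurable f)
    (h : ∀ t : ℝ, ∀ᵐ x : ι → ℝ, f (x + Pi.single i (t * x j)) = f x) : Indep i f := by
  refine indep_of_ae_ae hf ?_
  have hm : MeasurableSet {p : ℝ × (ι → ℝ) | f (p.2 + Pi.single i (p.1 * p.2 j)) = f p.2} :=
    measurableSet_eq_fun (hf.comp (measurable_snd.add ((meas_single i).comp
      (measurable_fst.mul ((measurable_pi_apply j).comp measurable_snd))))) (hf.comp measurable_snd)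
  have h1 := (Measure.ae_ae_comm (μ := volume) (ν := volume) (p := fun t x => f (x + Pi.single i (t * x j)) = f x) hm).1
    (Eventually.of_forall h)
  filter_upwards [h1, ae_ne_zero j] with x h1 h0
  have h2 := (Measure.quasiMeasurePreserving_smul (μ := (volume : Measure ℝ)) (inv_ne_zero h0)).ae h1
  filter_upwards [h2] with t ht
  rw [← ht]; congr 3
  simp only [smul_eq_mul]; field_simp

lemma indep_const {f : (ι → ℝ) → Λ} (hf : Measurable f) (h : ∀ i, Indep i f) : ∃ c, ∀ᵐ x, f x = c := by
  have hm : MeasurableSet {p : (ι → ℝ) × (ι → ℝ) | f (p.2 + p.1) = f p.2} :=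
    measurableSet_eq_fun (hf.comp (measurable_snd.add measurable_fst)) (hf.comp measurable_snd)
  obtain ⟨x, hx⟩ := ((Measure.ae_ae_comm (μ := volume) (ν := volume) (p := fun v x => f (x + v) = f x) hm).1
    (Eventually.of_forall fun v => indep_vec v fun i _ => h i)).exists
  refine ⟨f x, ?_⟩
  have := (measurePreserving_sub_right volume x).quasiMeasurePreserving.ae hx
  filter_upwards [this] with y hy
  simpa using hy
end Indep
end OESuperrigidity

namespace OESuperrigidity
open Filter Topology Polynomial

lemma udata_mk (A : Subring ℝ) (u : ℝ) (huA : u ∈ A) (c : ℕ → ℤ) (d : ℕ) (h1 : c 1 ≠ 0) (hd : 1 ≤ d)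
    (hdom : 2 * ∑ l ∈ (Finset.range (d+1)).erase 1, |c l| ≤ |c 1|)
    (hroot : ∑ l ∈ Finset.range (d+1), (c l : ℝ) * u ^ l = 0) (hlt : |u| < 1) (hne : u ≠ 0) :
    ∃ A0 : Subring ℝ, A0 ≤ A ∧ UData u A0 c d := by
  refine ⟨((Polynomial.aeval u : ℤ[X] →ₐ[ℤ] ℝ) : ℤ[X] →+* ℝ).range, ?_, ?_⟩
  · rintro _ ⟨p, rfl⟩
    show Polynomial.aeval u p ∈ A
    rw [Polynomial.aeval_eq_sum_range]
    exact A.sum_mem fun i _ => A.zsmul_mem (A.pow_mem huA _) _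
  · refine ⟨⟨X, by simp⟩, ?_, h1, hd, hdom, hroot, hlt, hne⟩
    rintro _ ⟨p, rfl⟩
    refine ⟨p.natDegree + 1, p.coeff, ?_⟩
    show Polynomial.aeval u p = _
    rw [Polynomial.aeval_eq_sum_range]
    simp [zsmul_eq_mul]

lemma udata_rat (A : Subring ℝ) (q : ℚ) (hq : (q : ℝ) ∈ A) (hZ : (q : ℝ) ∉ Set.range (Int.cast : ℤ → ℝ)) :
    ∃ (u : ℝ) (A0 : Subring ℝ) (c : ℕ → ℤ) (d : ℕ), A0 ≤ A ∧ UData u A0 c d := by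
  set w := Int.fract q with hw
  have hw0 : 0 < w := by
    refine lt_of_le_of_ne (Int.fract_nonneg q) fun h => hZ ⟨⌊q⌋, ?_⟩
    have : q = ⌊q⌋ := by have := Int.floor_add_fract q; rw [← hw, ← h, add_zero] at this; exact this.symm
    conv_rhs => rw [this]
    simp
  have hw1 : w < 1 := Int.fract_lt_one q
  have hwA : (w : ℝ) ∈ A := by
    have : (w : ℝ) = (q : ℝ) - (⌊q⌋ : ℤ) := by rw [hw, Int.fract]; push_cast; rfl
    rw [this]
    exact A.sub_mem hq (intCast_mem A _)
  obtain ⟨N, hN⟩ := exists_pow_lt_of_lt_one (show (0:ℚ) < 1/2 by norm_num) hw1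
  have hN0 : N ≠ 0 := by rintro rfl; norm_num at hN
  have hwe : w * w.den = w.num := Rat.mul_den_eq_num w
  have hden : (0:ℚ) < w.den := by exact_mod_cast w.pos
  have hnum : 0 < w.num := Rat.num_pos.2 hw0
  let c : ℕ → ℤ := fun l => if l = 0 then - w.num ^ N else if l = 1 then (w.den : ℤ) ^ N else 0
  obtain ⟨A0, h⟩ := udata_mk A ((w:ℝ) ^ N) (A.pow_mem hwA N) c 1 (by simp [c]) le_rfl (by
      have : (Finset.range (1+1)).erase 1 = {0} := by decide
      rw [this]
      simp only [c, Finset.sum_singleton, if_true, abs_neg, one_ne_zero, if_false]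
      rw [abs_of_pos (by positivity), abs_of_pos (by have := w.pos; positivity)]
      have : w.num ^ N * (2:ℚ) ≤ w.den ^ N := by
        rw [← hwe, mul_pow]
        have : (0:ℚ) < w.den ^ N := by positivity
        nlinarith
      have : (2 * w.num ^ N : ℚ) ≤ w.den ^ N := by linarith
      exact_mod_cast this) (by
      simp only [c, Finset.sum_range_succ, Finset.range_zero, Finset.sum_empty]
      have : (w:ℝ) * w.den = w.num := by exact_mod_cast hwe
      simp [← this]; ring) (by
      have : (0:ℝ) < w := by exact_mod_cast hw0
      have h1 : (w:ℝ) < 1 := by exact_mod_cast hw1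
      rw [abs_of_pos (by positivity)]; exact pow_lt_one₀ this.le h1 hN0) (by
      have : (0:ℝ) < w := by exact_mod_cast hw0
      positivity)
  exact ⟨_, A0, c, 1, h⟩

lemma dirichlet_large {a : ℝ} (ha : Irrational a) (N : ℕ) : ∃ q : ℕ, N < q ∧ ∃ p : ℤ, |q * a - p| ≤ 1 / q := by
  obtain ⟨δ, hδ, h⟩ : ∃ δ > 0, ∀ k ∈ Finset.Icc 1 N, ∀ p : ℤ, δ ≤ |(k:ℝ) * a - p| := by
    rcases (Finset.Icc 1 N).eq_empty_or_nonempty with h | h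
    · exact ⟨1, one_pos, by simp [h]⟩
    · obtain ⟨k, hk, hk'⟩ := Finset.exists_min_image (Finset.Icc 1 N) (fun k => |(k:ℝ) * a - round ((k:ℝ) * a)|) h
      refine ⟨_, ?_, fun k' h' p => (hk' k' h').trans (round_le _ _)⟩
      have : Irrational ((k:ℝ) * a) := ha.natCast_mul (by have := (Finset.mem_Icc.1 hk).1; omega)
      exact abs_pos.2 (sub_ne_zero.2 (this.ne_int _))
  obtain ⟨n, hn⟩ := exists_nat_gt (1/δ)
  have hn0 : 0 < n := by
    have : (0:ℝ) < n := lt_trans (by positivity) hn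
    exact_mod_cast this
  obtain ⟨j, k, hk0, hkn, hjk⟩ := Real.exists_int_int_abs_mul_sub_le a hn0
  lift k to ℕ using hk0.le
  push_cast at hjk
  have hk0' : 0 < k := by exact_mod_cast hk0
  have hkn' : k ≤ n := by exact_mod_cast hkn
  refine ⟨k, ?_, j, hjk.trans ?_⟩
  · by_contra hlt
    have := h k (Finset.mem_Icc.2 ⟨hk0', by omega⟩) j
    have h2 : 1 / ((n:ℝ) + 1) < δ := by
      rw [div_lt_iff₀ hδ] at hn
      rw [div_lt_iff₀ (by positivity)]; nlinarith
    linarith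
  · apply one_div_le_one_div_of_le (by exact_mod_cast hk0')
    have : (k:ℝ) ≤ n := by exact_mod_cast hkn'
    linarith

lemma udata_irr (A : Subring ℝ) (a : ℝ) (haA : a ∈ A) (halg : IsAlgebraic ℤ a) (ha : Irrational a) :
    ∃ (u : ℝ) (A0 : Subring ℝ) (c : ℕ → ℤ) (d : ℕ), A0 ≤ A ∧ UData u A0 c d := by
  classical
  have hex : ∃ n, ∃ P : ℤ[X], P ≠ 0 ∧ aeval a P = 0 ∧ P.natDegree = n := by
    obtain ⟨P, h1, h2⟩ := halg; exact ⟨_, P, h1, h2, rfl⟩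
  obtain ⟨P, hP0, hPa, hPd⟩ := Nat.find_spec hex
  have hmin := fun m hm => Nat.find_min hex (m := m) hm
  set D := Nat.find hex
  have hD1 : 1 ≤ D := by
    by_contra h
    have h0 : P.natDegree = 0 := by omega
    rw [Polynomial.natDegree_eq_zero] at h0
    obtain ⟨x, rfl⟩ := h0
    simp at hPa hP0
    exact hP0 hPa
  have hder : aeval a (derivative P) ≠ 0 := by
    intro h
    refine hmin (derivative P).natDegree ?_ ⟨_, ?_, h, rfl⟩
    · rw [← hPd]; exact natDegree_derivative_lt (by omega)
    · intro h0
      have := Polynomial.natDegree_eq_zero_of_derivative_eq_zero h0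
      omega
  choose q hq p hp using dirichlet_large ha
  have hq0 : ∀ N, (0:ℝ) < q N := fun N => by exact_mod_cast (by have := hq N; omega)
  let Hl : ℕ → ℝ → ℝ := fun l x => ∑ k ∈ Finset.range (D+1), (P.coeff k : ℝ) * (k.choose l) * x ^ (k - l)
  let c : ℕ → ℕ → ℤ := fun N l => ∑ k ∈ Finset.range (D+1), P.coeff k * (q N : ℤ) ^ (D - k) * (k.choose l) * p N ^ (k - l)
  let x : ℕ → ℝ := fun N => p N / q N
  have hqt : Tendsto (fun N => 1 / (q N : ℝ)) atTop (𝓝 0) := by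
    refine tendsto_of_tendsto_of_tendsto_of_le_of_le tendsto_const_nhds tendsto_one_div_add_atTop_nhds_zero_nat (fun N => by positivity) fun N => ?_
    apply one_div_le_one_div_of_le (by positivity)
    exact_mod_cast hq N
  have hqu : Tendsto (fun N => (q N : ℝ) * a - p N) atTop (𝓝 0) :=
    squeeze_zero_norm (fun N => hp N) hqt
  have hx : Tendsto x atTop (𝓝 a) := by
    have : ∀ N, x N = a - 1 / (q N:ℝ) * ((q N : ℝ) * a - p N) := fun N => by
      have := (hq0 N).ne'
      simp only [x]; field_simp; ring
    have h2 := (tendsto_const_nhds (x := a)).sub (hqt.mul hqu)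
    simp only [mul_zero, sub_zero] at h2
    exact h2.congr fun N => (this N).symm
  have hHc : ∀ l, Continuous (Hl l) := fun l => by fun_prop
  have hc : ∀ N l, l ≤ D → (c N l : ℝ) / (q N) ^ D = (1 / (q N : ℝ)) ^ l * Hl l (x N) := by
    intro N l hl
    simp only [c, Hl, x]
    push_cast
    rw [Finset.sum_div, Finset.mul_sum]
    refine Finset.sum_congr rfl fun k hk => ?_
    rw [Finset.mem_range] at hk
    have h0 := (hq0 N).ne'
    by_cases hkl : k < l
    · simp [Nat.choose_eq_zero_of_lt hkl]
    · push Not at hkl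
      obtain ⟨e, rfl⟩ := Nat.exists_eq_add_of_le hkl
      obtain ⟨g, hg⟩ := Nat.exists_eq_add_of_le (show l + e ≤ D by omega)
      rw [hg]
      simp only [Nat.add_sub_cancel_left]
      rw [div_pow, div_pow, one_pow, pow_add, pow_add]
      field_simp
  have hH0 : ∀ y, Hl 0 y = aeval y P := by
    intro y
    rw [Polynomial.aeval_eq_sum_range, hPd]
    simp [Hl, zsmul_eq_mul]
  have hH1 : ∀ y, Hl 1 y = aeval y (derivative P) := by
    intro y
    rw [Polynomial.derivative_apply, Polynomial.sum_over_range _ (by simp), hPd, map_sum]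
    refine Finset.sum_congr rfl fun k _ => ?_
    simp [Nat.choose_one_right]
  have hr : ∀ l ∈ (Finset.range (D+1)).erase 1, Tendsto (fun N => |(c N l : ℝ) / (q N) ^ D * q N|) atTop (𝓝 0) := by
    intro l hl
    rw [Finset.mem_erase, Finset.mem_range] at hl
    have hlD : l ≤ D := by omega
    rw [← abs_zero]
    refine Tendsto.abs ?_
    rcases Nat.eq_zero_or_pos l with rfl | hl0
    · have hroot : (P.map (algebraMap ℤ ℝ)).IsRoot a := by
        rw [Polynomial.IsRoot, Polynomial.eval_map_algebraMap, hPa]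
      obtain ⟨R, hR⟩ := Polynomial.dvd_iff_isRoot.2 hroot
      have h1 : ∀ N, (c N 0 : ℝ) / (q N) ^ D * q N = - ((q N : ℝ) * a - p N) * R.eval (x N) := by
        intro N
        rw [hc N 0 hlD, hH0, ← Polynomial.eval_map_algebraMap, hR]
        have := (hq0 N).ne'
        simp only [x, eval_mul, eval_sub, eval_X, eval_C]
        field_simp; ring
      simp_rw [h1]
      have := hqu.neg.mul ((R.continuous.tendsto a).comp hx)
      simpa using this
    · have h1 : ∀ N, (c N l : ℝ) / (q N) ^ D * q N = (1 / (q N : ℝ)) ^ (l - 1) * Hl l (x N) := by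
        intro N
        rw [hc N l hlD]
        obtain ⟨m, rfl⟩ : ∃ m, l = m + 1 := ⟨l - 1, by omega⟩
        have := (hq0 N).ne'
        rw [Nat.add_sub_cancel, pow_succ]; field_simp
      simp_rw [h1]
      have := (hqt.pow (l-1)).mul (((hHc l).tendsto a).comp hx)
      rw [zero_pow (by omega), zero_mul] at this
      exact this
  have hr1 : Tendsto (fun N => |(c N 1 : ℝ) / (q N) ^ D * q N|) atTop (𝓝 |aeval a (derivative P)|) := by
    have h1 : ∀ N, (c N 1 : ℝ) / (q N) ^ D * q N = Hl 1 (x N) := by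
      intro N
      have := (hq0 N).ne'
      rw [hc N 1 hD1, pow_one]; field_simp
    simp_rw [h1]
    rw [← hH1]
    exact (((hHc 1).tendsto a).comp hx).abs
  have hsum := (tendsto_finsetSum _ hr).const_mul 2
  simp only [Finset.sum_const_zero, mul_zero] at hsum
  have e1 := hsum.eventually_lt hr1 (abs_pos.2 hder)
  have e2 : ∀ᶠ N in atTop, |(q N : ℝ) * a - p N| < 1 := by
    have := hqu.abs; rw [abs_zero] at this
    exact this.eventually_lt tendsto_const_nhds one_pos
  obtain ⟨N, h1, h2⟩ := (e1.and e2).exists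
  have hqD : (0:ℝ) < q N / (q N) ^ D := div_pos (hq0 N) (pow_pos (hq0 N) _)
  have habs : ∀ l, |(c N l : ℝ) / (q N) ^ D * q N| = |(c N l : ℝ)| * (q N / (q N) ^ D) := by
    intro l
    rw [div_mul_eq_mul_div, mul_div_assoc, abs_mul, abs_of_pos hqD]
  simp_rw [habs] at h1
  rw [← Finset.sum_mul, ← mul_assoc] at h1
  have h3 := lt_of_mul_lt_mul_right h1 hqD.le
  have h4 : 2 * ∑ l ∈ (Finset.range (D+1)).erase 1, |c N l| < |c N 1| := by exact_mod_cast h3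
  have hne : (q N : ℝ) * a - p N ≠ 0 := by
    have : Irrational ((q N:ℝ) * a) := ha.natCast_mul (by have := hq N; omega)
    exact sub_ne_zero.2 (this.ne_int _)
  obtain ⟨A0, h⟩ := udata_mk A ((q N : ℝ) * a - p N)
    (A.sub_mem (A.mul_mem (natCast_mem A _) haA) (intCast_mem A _)) (c N) D (by
      intro h0
      rw [h0, abs_zero] at h4
      have := Finset.sum_nonneg (s := (Finset.range (D+1)).erase 1) (f := fun l => |c N l|) fun _ _ => abs_nonneg _
      linarith) hD1 h4.le (by
      simp only [c]
      push_cast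
      simp_rw [Finset.sum_mul]
      rw [Finset.sum_comm]
      have : ∀ k ∈ Finset.range (D+1), ∑ l ∈ Finset.range (D+1), (P.coeff k : ℝ) * (q N : ℝ) ^ (D - k) * (k.choose l) * (p N : ℝ) ^ (k - l) * ((q N : ℝ) * a - p N) ^ l = (q N : ℝ) ^ D * (P.coeff k * a ^ k) := by
        intro k hk
        rw [Finset.mem_range] at hk
        have h5 : ∑ l ∈ Finset.range (D+1), ((q N : ℝ) * a - p N) ^ l * (p N : ℝ) ^ (k - l) * (k.choose l) = ((q N : ℝ) * a) ^ k := by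
          have := add_pow ((q N : ℝ) * a - p N) (p N) k
          rw [sub_add_cancel] at this
          rw [this]
          symm
          apply Finset.sum_subset
          · intro i hi; rw [Finset.mem_range] at *; omega
          · intro i _ hi
            rw [Finset.mem_range] at hi
            rw [Nat.choose_eq_zero_of_lt (by omega)]; simp
        calc _ = (P.coeff k : ℝ) * (q N : ℝ) ^ (D - k) * ∑ l ∈ Finset.range (D+1), ((q N : ℝ) * a - p N) ^ l * (p N : ℝ) ^ (k - l) * (k.choose l) := by
              rw [Finset.mul_sum]; exact Finset.sum_congr rfl fun _ _ => by ring
          _ = _ := by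
              rw [h5, mul_pow]
              have : (q N : ℝ) ^ D = (q N : ℝ) ^ (D - k) * (q N : ℝ) ^ k := by rw [← pow_add]; congr 1; omega
              rw [this]; ring
      rw [Finset.sum_congr rfl this, ← Finset.mul_sum]
      rw [Polynomial.aeval_eq_sum_range, hPd] at hPa
      simp only [zsmul_eq_mul] at hPa
      rw [hPa, mul_zero]) h2 hne
  exact ⟨_, A0, _, _, h⟩

lemma exists_UData (A : Subring ℝ)
    (hAalg : ∃ a : ℝ, a ∈ A ∧ IsAlgebraic ℚ a ∧ a ∉ Set.range (Int.cast : ℤ → ℝ)) :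
    ∃ (u : ℝ) (A0 : Subring ℝ) (c : ℕ → ℤ) (d : ℕ), A0 ≤ A ∧ UData u A0 c d := by
  obtain ⟨a, haA, halg, haZ⟩ := hAalg
  by_cases h : Irrational a
  · exact udata_irr A a haA ((IsFractionRing.isAlgebraic_iff ℤ ℚ ℝ).2 halg) h
  · rw [Irrational, not_not] at h
    obtain ⟨q, rfl⟩ := h
    exact udata_rat A q haA haZ

lemma UData.dense {u : ℝ} {A0 : Subring ℝ} {c : ℕ → ℤ} {d : ℕ} (hu : UData u A0 c d) : Dense (A0 : Set ℝ) := by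
  have : Dense (A0.toAddSubgroup : Set ℝ) := by
    refine AddSubgroup.dense_of_not_isolated_zero _ fun ε hε => ?_
    have hu1 := abs_pos.2 hu.ne
    have h2 : u ^ 2 < 1 := by rw [← sq_abs]; exact pow_lt_one₀ hu1.le hu.lt two_ne_zero
    obtain ⟨N, hN⟩ := exists_pow_lt_of_lt_one hε h2
    exact ⟨(u^2)^N, A0.pow_mem (A0.pow_mem hu.mem _) _, by have := hu.ne; positivity, hN⟩
  exact this
end OESuperrigidity

namespace OESuperrigidity
open Filter Topology
open scoped symmDiff

section Koop
variable (𝕜 : Type) [RCLike 𝕜] {Y : Type} [MeasurableSpace Y] {μ : Measure Y}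

noncomputable def koop (T : Y ≃ᵐ Y) (hT : MeasurePreserving T μ μ) : Lp 𝕜 2 μ ≃ₗᵢ[𝕜] Lp 𝕜 2 μ :=
  LinearIsometryEquiv.ofSurjective (Lp.compMeasurePreservingₗᵢ 𝕜 T hT) (by
    intro h
    refine ⟨Lp.compMeasurePreserving T.symm (hT.symm T) h, ?_⟩
    show Lp.compMeasurePreserving T hT _ = h
    rw [← Lp.compMeasurePreserving_comp_apply]
    conv_rhs => rw [← Lp.compMeasurePreserving_id_apply h]
    congr 2
    funext y; simp)

lemma koop_apply (T : Y ≃ᵐ Y) (hT : MeasurePreserving T μ μ) (h : Lp 𝕜 2 μ) :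
    koop 𝕜 T hT h = Lp.compMeasurePreserving T hT h := rfl

lemma koop_mul {R S T : Y ≃ᵐ Y} (hR : MeasurePreserving R μ μ) (hS : MeasurePreserving S μ μ) (hT : MeasurePreserving T μ μ)
    (h : ∀ y, R y = S (T y)) (x : Lp 𝕜 2 μ) : koop 𝕜 R hR x = koop 𝕜 T hT (koop 𝕜 S hS x) := by
  simp only [koop_apply]
  rw [← Lp.compMeasurePreserving_comp_apply]
  congr 2
  funext y; exact h y

lemma koop_comm {S T S' T' : Y ≃ᵐ Y} (hS : MeasurePreserving S μ μ) (hT : MeasurePreserving T μ μ)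
    (hS' : MeasurePreserving S' μ μ) (hT' : MeasurePreserving T' μ μ)
    (h : ∀ y, S (T y) = S' (T' y)) (x : Lp 𝕜 2 μ) : koop 𝕜 T hT (koop 𝕜 S hS x) = koop 𝕜 T' hT' (koop 𝕜 S' hS' x) := by
  simp only [koop_apply]
  rw [← Lp.compMeasurePreserving_comp_apply, ← Lp.compMeasurePreserving_comp_apply]
  congr 2
  funext y; exact h y

lemma norm_ind {S : Set Y} (hS : MeasurableSet S) (hμS : μ S ≠ ⊤) :
    ‖indicatorConstLp 2 hS hμS (1:𝕜)‖ ^ 2 = μ.real S := by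
  rw [norm_indicatorConstLp (by norm_num) (by norm_num)]
  simp only [norm_one, one_mul, ENNReal.toReal_ofNat]
  rw [← Real.sqrt_eq_rpow, Real.sq_sqrt measureReal_nonneg]

lemma koop_ind (T : Y ≃ᵐ Y) (hT : MeasurePreserving T μ μ) {S : Set Y} (hS : MeasurableSet S) (hμS : μ S ≠ ⊤) :
    ‖koop 𝕜 T hT (indicatorConstLp 2 hS hμS (1:𝕜)) - indicatorConstLp 2 hS hμS (1:𝕜)‖ ^ 2 = 2 * μ.real (S \ T ⁻¹' S) := by
  rw [koop_apply, Lp.indicatorConstLp_compMeasurePreserving, ← dist_eq_norm, dist_indicatorConstLp_eq_norm, norm_ind]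
  have hS' := hS.preimage T.measurable
  have hp : μ (T ⁻¹' S) = μ S := hT.measure_preimage hS.nullMeasurableSet
  have hf : μ (T ⁻¹' S) ≠ ⊤ := by rw [hp]; exact hμS
  rw [measureReal_symmDiff_eq (μ := μ) hS' hS hf hμS, two_mul]
  congr 1
  have h1 := measureReal_diff_add_inter (μ := μ) (s := T ⁻¹' S) (t := S) hS hf
  have h2 := measureReal_diff_add_inter (μ := μ) (s := S) (t := T ⁻¹' S) hS' hμS
  rw [Set.inter_comm] at h2
  have : μ.real (T ⁻¹' S) = μ.real S := by rw [measureReal_def, hp]; rfl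
  linarith
end Koop

section Tw
variable {X : Type} [MeasurableSpace X] {μ : Measure X} [SigmaFinite μ]
  {Λ : Type} [Group Λ] [Countable Λ] [MeasurableSpace Λ] [DiscreteMeasurableSpace Λ]

def tw (e : X ≃ᵐ X) (p q : X → Λ) (hp : Measurable p) (hq : Measurable q) : X × Λ ≃ᵐ X × Λ where
  toFun y := (e y.1, p y.1 * y.2 * (q y.1)⁻¹)
  invFun y := (e.symm y.1, (p (e.symm y.1))⁻¹ * y.2 * q (e.symm y.1))
  left_inv y := by ext <;> simp [mul_assoc]
  right_inv y := by ext <;> simp [mul_assoc]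
  measurable_toFun := (e.measurable.comp measurable_fst).prodMk
    (((hp.comp measurable_fst).mul measurable_snd).mul ((hq.comp measurable_fst).inv))
  measurable_invFun := by
    have h : Measurable (fun y : X × Λ => e.symm y.1) := e.symm.measurable.comp measurable_fst
    exact h.prodMk ((((hp.comp h).inv).mul measurable_snd).mul (hq.comp h))

lemma tw_mp (e : X ≃ᵐ X) (he : MeasurePreserving e μ μ) (p q : X → Λ) (hp : Measurable p) (hq : Measurable q) :
    MeasurePreserving (tw e p q hp hq) (μ.prod Measure.count) (μ.prod Measure.count) := by
  refine MeasurePreserving.skew_product (g := fun x l => p x * l * (q x)⁻¹) he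
    (((hp.comp measurable_fst).mul measurable_snd).mul ((hq.comp measurable_fst).inv)) (Eventually.of_forall fun x => ?_)
  let E : Λ ≃ Λ := (Equiv.mulLeft (p x)).trans (Equiv.mulRight (q x)⁻¹)
  have hE : Measurable E := measurable_of_countable _
  show Measure.map E Measure.count = Measure.count
  ext s hs
  rw [Measure.map_apply hE hs, Measure.count_apply (hE hs), Measure.count_apply hs]
  rw [Set.encard_preimage_of_bijective E.bijective]

variable (𝕜 : Type) [RCLike 𝕜]

lemma prod_one (D : Set X) : (μ.prod (Measure.count : Measure Λ)).real (D ×ˢ {1}) = μ.real D := by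
  rw [measureReal_def, Measure.prod_prod]; simp [measureReal_def]

lemma prod_one_ne {B : Set X} (hμB : μ B ≠ ⊤) : (μ.prod (Measure.count : Measure Λ)) (B ×ˢ {1}) ≠ ⊤ := by
  rw [Measure.prod_prod]; simpa using hμB

noncomputable def xi (Λ : Type) [Group Λ] [Countable Λ] [MeasurableSpace Λ] [DiscreteMeasurableSpace Λ]
    {B : Set X} (hB : MeasurableSet B) (hμB : μ B ≠ ⊤) : Lp 𝕜 2 (μ.prod (Measure.count : Measure Λ)) :=
  indicatorConstLp 2 (hB.prod (measurableSet_singleton (1:Λ))) (prod_one_ne hμB) (1:𝕜)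

lemma norm_xi {B : Set X} (hB : MeasurableSet B) (hμB : μ B ≠ ⊤) : ‖xi 𝕜 Λ hB hμB‖ ^ 2 = μ.real B := by
  rw [xi, norm_ind, prod_one]

lemma tw_xi (e : X ≃ᵐ X) (he : MeasurePreserving e μ μ) (p q : X → Λ) (hp : Measurable p) (hq : Measurable q)
    {B : Set X} (hB : MeasurableSet B) (hμB : μ B ≠ ⊤) :
    ‖koop 𝕜 (tw e p q hp hq) (tw_mp e he p q hp hq) (xi 𝕜 Λ hB hμB) - xi 𝕜 Λ hB hμB‖ ^ 2 =
      2 * μ.real {x ∈ B | e x ∉ B ∨ p x ≠ q x} := by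
  rw [xi, koop_ind, ← prod_one (Λ := Λ) {x ∈ B | e x ∉ B ∨ p x ≠ q x}]
  congr 2
  ext ⟨x, l⟩
  simp only [Set.mem_diff, Set.mem_prod, Set.mem_singleton_iff, Set.mem_preimage, tw, MeasurableEquiv.coe_mk, Equiv.coe_fn_mk, Set.mem_ofPred_eq]
  constructor
  · rintro ⟨⟨h1, rfl⟩, h2⟩
    refine ⟨⟨h1, ?_⟩, rfl⟩
    rw [mul_one, mul_inv_eq_one] at h2; tauto
  · rintro ⟨⟨h1, h2⟩, rfl⟩
    refine ⟨⟨h1, rfl⟩, ?_⟩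
    rw [mul_one, mul_inv_eq_one]; tauto
end Tw
end OESuperrigidity

namespace OESuperrigidity
open Filter Topology

section Box
variable {ι : Type} [Fintype ι] [DecidableEq ι]

def box (ι : Type) (R : ℝ) : Set (ι → ℝ) := Set.pi Set.univ fun _ => Set.Ioc (-R) R

def unitc (ι : Type) : Set (ι → ℝ) := Set.pi Set.univ fun _ => Set.Ioc 0 1

lemma box_meas (R : ℝ) : MeasurableSet (box ι R) := MeasurableSet.univ_pi fun _ => measurableSet_Ioc
lemma unitc_meas : MeasurableSet (unitc ι) := MeasurableSet.univ_pi fun _ => measurableSet_Ioc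

lemma mem_box {R : ℝ} {z : ι → ℝ} : z ∈ box ι R ↔ ∀ i, -R < z i ∧ z i ≤ R := by
  simp [box, Set.mem_pi]

lemma box_vol (R : ℝ) : volume (box ι R) = ENNReal.ofReal (2 * R) ^ Fintype.card ι := by
  rw [box, volume_pi_pi]
  simp only [Real.volume_Ioc, Finset.prod_const, Finset.card_univ]
  congr 2; ring

lemma box_ne_top (R : ℝ) : volume (box ι R) ≠ ⊤ := by rw [box_vol]; finiteness

lemma box_pos {R : ℝ} (hR : 0 < R) : 0 < volume.real (box ι R) := by
  rw [measureReal_def, box_vol]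
  refine ENNReal.toReal_pos ?_ (by finiteness)
  exact pow_ne_zero _ (by simpa using hR)

lemma box_edge {R η : ℝ} (hR : 0 < R) (hη : 0 ≤ η) (i : ι) :
    volume.real {z ∈ box ι R | R - η ≤ |z i|} ≤ η / R * volume.real (box ι R) := by
  let J : Set ℝ := Set.Icc (R - η) R ∪ Set.Icc (-R) (-(R - η))
  have hsub : {z ∈ box ι R | R - η ≤ |z i|} ⊆ Set.pi Set.univ (Function.update (fun _ => Set.Ioc (-R) R) i J) := by
    rintro z ⟨hz, hz2⟩ l _
    rw [mem_box] at hz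
    by_cases hl : l = i
    · subst hl
      rw [Function.update_self]
      have := hz l
      rcases le_abs.1 hz2 with h | h
      · exact Or.inl ⟨h, this.2⟩
      · exact Or.inr ⟨this.1.le, by linarith⟩
    · rw [Function.update_of_ne hl]; exact hz l
  have hJ : volume J ≤ ENNReal.ofReal (2 * η) := by
    refine (measure_union_le _ _).trans ?_
    rw [Real.volume_Icc, Real.volume_Icc, ← ENNReal.ofReal_add (by linarith) (by linarith)]
    exact ENNReal.ofReal_le_ofReal (by linarith)
  have hv : volume {z ∈ box ι R | R - η ≤ |z i|} ≤ ENNReal.ofReal (η / R) * volume (box ι R) := by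
    refine (measure_mono hsub).trans ?_
    rw [volume_pi_pi, box, volume_pi_pi, ← Finset.mul_prod_erase _ _ (Finset.mem_univ i), ← Finset.mul_prod_erase (a := i) _ _ (Finset.mem_univ i), ← mul_assoc]
    have : ∀ l ∈ Finset.univ.erase i, volume (Function.update (fun _ => Set.Ioc (-R) R) i J l) = volume (Set.Ioc (-R) R) := by
      intro l hl
      rw [Function.update_of_ne (Finset.ne_of_mem_erase hl)]
    rw [Finset.prod_congr rfl this, Function.update_self]
    gcongr
    refine hJ.trans ?_
    rw [Real.volume_Ioc, ← ENNReal.ofReal_mul (by positivity)]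
    apply ENNReal.ofReal_le_ofReal
    field_simp; linarith
  rw [measureReal_def, measureReal_def]
  calc _ ≤ (ENNReal.ofReal (η / R) * volume (box ι R)).toReal :=
        ENNReal.toReal_mono (ENNReal.mul_ne_top (by finiteness) (box_ne_top R)) hv
    _ = _ := by rw [ENNReal.toReal_mul, ENNReal.toReal_ofReal (by positivity)]

abbrev Zsp (ι : Type) := (ι → ℝ) × ℝ
variable (ν : Measure ℝ) [IsFiniteMeasure ν]

noncomputable abbrev muZ (ι : Type) [Fintype ι] (ν : Measure ℝ) : Measure (Zsp ι) := (volume : Measure (ι → ℝ)).prod ν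
noncomputable abbrev mu3 (ι : Type) [Fintype ι] (ν : Measure ℝ) : Measure ((ι → ℝ) × Zsp ι) := (volume : Measure (ι → ℝ)).prod (muZ ι ν)

lemma tile {P : Set ((ι → ℝ) × Zsp ι)} (hP : MeasurableSet P)
    (hper : ∀ (k : ι → ℤ) v z c, (v, (z, c)) ∈ P ↔ (v, (z + fun i => (k i : ℝ), c)) ∈ P) (N : ℕ)
    (hfin : mu3 ι ν {x ∈ P | x.2.1 ∈ box ι N} ≠ ⊤) :
    volume.real (box ι N) * (mu3 ι ν).real {x ∈ P | x.2.1 ∈ unitc ι} ≤ (mu3 ι ν).real {x ∈ P | x.2.1 ∈ box ι N} := by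
  let I : Finset (ι → ℤ) := Fintype.piFinset fun _ => Finset.Ico (-(N:ℤ)) N
  let kc : (ι → ℤ) → ι → ℝ := fun k i => (k i : ℝ)
  let Q : (ι → ℤ) → Set ((ι → ℝ) × Zsp ι) := fun k => {x ∈ P | x.2.1 + (- kc k) ∈ unitc ι}
  have hm : ∀ k : ι → ℤ, Measurable fun x : (ι → ℝ) × Zsp ι => x.2.1 + (- kc k) := fun k =>
    (measurable_fst.comp measurable_snd).add_const _
  have hQm : ∀ k, MeasurableSet (Q k) := fun k => hP.inter (unitc_meas.preimage (hm k))
  have hQ : ∀ k, (mu3 ι ν) (Q k) = mu3 ι ν {x ∈ P | x.2.1 ∈ unitc ι} := by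
    intro k
    have hmp : MeasurePreserving (fun x : (ι → ℝ) × Zsp ι => (x.1, (x.2.1 + (- kc k), x.2.2))) (mu3 ι ν) (mu3 ι ν) :=
      (MeasurePreserving.id _).prod ((measurePreserving_add_right volume (- kc k)).prod (MeasurePreserving.id _))
    have hmm : MeasurableSet {x ∈ P | x.2.1 ∈ unitc ι} := hP.inter (unitc_meas.preimage (measurable_fst.comp measurable_snd))
    rw [← hmp.measure_preimage hmm.nullMeasurableSet]
    congr 1
    ext ⟨v, z, c⟩
    have h1 := hper (-k) v z c
    have h2 : (fun i => (((-k) i : ℤ) : ℝ)) = - kc k := by ext i; simp [kc]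
    rw [h2] at h1
    simp only [Q, Set.mem_ofPred_eq, Set.mem_preimage, Set.mem_inter_iff, Function.comp]
    rw [h1]
  have hd : (I : Set (ι → ℤ)).PairwiseDisjoint Q := by
    intro k _ k' _ hne
    rw [Function.onFun, Set.disjoint_left]
    rintro x ⟨_, h1⟩ ⟨_, h2⟩
    apply hne
    funext i
    have h1 := h1 i trivial
    have h2 := h2 i trivial
    simp only [kc, Pi.add_apply, Pi.neg_apply, Set.mem_Ioc] at h1 h2
    have a1 : (k i : ℝ) < k' i + 1 := by linarith
    have a2 : (k' i : ℝ) < k i + 1 := by linarith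
    have a1' : k i < k' i + 1 := by exact_mod_cast a1
    have a2' : k' i < k i + 1 := by exact_mod_cast a2
    omega
  have hsub : ⋃ k ∈ I, Q k ⊆ {x ∈ P | x.2.1 ∈ box ι N} := by
    intro x hx
    simp only [Set.mem_iUnion] at hx
    obtain ⟨k, hk, hxP, hx⟩ := hx
    refine ⟨hxP, mem_box.2 fun i => ?_⟩
    have h1 := hx i trivial
    have h2 := Finset.mem_Ico.1 (Fintype.mem_piFinset.1 hk i)
    simp only [kc, Pi.add_apply, Pi.neg_apply, Set.mem_Ioc] at h1
    have a1 : -(N:ℝ) ≤ k i := by exact_mod_cast h2.1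
    have a2 : (k i:ℝ) + 1 ≤ N := by exact_mod_cast h2.2
    constructor <;> linarith
  have h1 := measure_biUnion_finset (μ := mu3 ι ν) hd (fun k _ => hQm k)
  have h2 := measure_mono (μ := mu3 ι ν) hsub
  rw [h1, Finset.sum_congr rfl (fun k _ => hQ k), Finset.sum_const, nsmul_eq_mul] at h2
  have h3 := ENNReal.toReal_mono hfin h2
  rw [ENNReal.toReal_mul] at h3
  have h4 : ((I.card : ENNReal)).toReal = volume.real (box ι N) := by
    rw [measureReal_def, box_vol, Fintype.card_piFinset]
    have : (Finset.Ico (-(N:ℤ)) N).card = 2 * N := by rw [Int.card_Ico]; omega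
    simp [this]
  rw [h4] at h3
  exact h3

variable {Λ : Type} [Countable Λ] [MeasurableSpace Λ] [DiscreteMeasurableSpace Λ]

lemma close_ev {R : ℝ} {h : Zsp ι → Λ} (hh : Measurable h) {η : ℝ} (hη : 0 < η) :
    ∀ᶠ v in 𝓝 (0 : ι → ℝ), muZ ι ν ((box ι R ×ˢ Set.univ) ∩ {x | h (x.1 + v, x.2) ≠ h x}) ≤ ENNReal.ofReal η := by
  letI : TopologicalSpace Λ := ⊥
  haveI : DiscreteTopology Λ := ⟨rfl⟩
  have := cm (μ := muZ ι ν) (fun (v : ι → ℝ) (x : Zsp ι) => (x.1 + v, x.2)) (by fun_prop)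
    (fun v => (measurePreserving_add_right volume v).prod (MeasurePreserving.id _)) 0 (by simp) hh
    (B := box ι R ×ˢ Set.univ) ((box_meas R).prod MeasurableSet.univ) (by
      rw [Measure.prod_prod]
      exact ENNReal.mul_lt_top (box_ne_top R).lt_top (measure_lt_top ν _))
  rw [ENNReal.tendsto_nhds_zero] at this
  exact this _ (by simpa using hη)

lemma close_int {R r : ℝ} {h : Zsp ι → Λ} (hh : Measurable h) {η : ℝ} (hη : 0 < η)
    (hr : ∀ v ∈ box ι r, muZ ι ν ((box ι R ×ˢ Set.univ) ∩ {x | h (x.1 + v, x.2) ≠ h x}) ≤ ENNReal.ofReal η) :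
    (mu3 ι ν).real {x | x.1 ∈ box ι r ∧ x.2.1 ∈ box ι R ∧ h (x.2.1 + x.1, x.2.2) ≠ h x.2} ≤ volume.real (box ι r) * η := by
  have hm : MeasurableSet {x : (ι → ℝ) × Zsp ι | x.1 ∈ box ι r ∧ x.2.1 ∈ box ι R ∧ h (x.2.1 + x.1, x.2.2) ≠ h x.2} := by
    refine ((box_meas r).preimage measurable_fst).inter (((box_meas R).preimage (measurable_fst.comp measurable_snd)).inter ?_)
    refine (measurableSet_eq_fun (hh.comp ?_) (hh.comp measurable_snd)).compl
    fun_prop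
  have hle : mu3 ι ν {x | x.1 ∈ box ι r ∧ x.2.1 ∈ box ι R ∧ h (x.2.1 + x.1, x.2.2) ≠ h x.2} ≤ volume (box ι r) * ENNReal.ofReal η := by
    rw [Measure.prod_apply hm, mul_comm, ← setLIntegral_const, ← lintegral_indicator (box_meas r)]
    refine lintegral_mono fun v => ?_
    by_cases hv : v ∈ box ι r
    · rw [Set.indicator_of_mem hv]
      refine (measure_mono ?_).trans (hr v hv)
      rintro ⟨z, c⟩ ⟨_, h2, h3⟩
      exact ⟨⟨h2, trivial⟩, h3⟩
    · rw [Set.indicator_of_notMem hv]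
      simp [hv]
  rw [measureReal_def, measureReal_def]
  calc _ ≤ (volume (box ι r) * ENNReal.ofReal η).toReal := ENNReal.toReal_mono (ENNReal.mul_ne_top (box_ne_top r) (by finiteness)) hle
    _ = _ := by rw [ENNReal.toReal_mul, ENNReal.toReal_ofReal hη.le]
end Box
end OESuperrigidity

namespace OESuperrigidity
open Filter Topology

section CDs
variable {ι : Type} [Fintype ι] [DecidableEq ι]
  {Λ : Type} [Group Λ] [Countable Λ] [MeasurableSpace Λ] [DiscreteMeasurableSpace Λ] {A0 : Subring ℝ}

def cv (b : ι → A0) : ι → ℝ := fun i => (b i : ℝ)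

lemma cv_add (b b' : ι → A0) : cv (b + b') = cv b + cv b' := by ext i; simp [cv]

lemma cv_single (i : ι) (a : A0) : cv (Pi.single i a : ι → A0) = Pi.single i (a : ℝ) := by
  ext l; by_cases h : l = i
  · subst h; simp [cv]
  · simp [cv, h]

structure CD (u : A0) (f : (ι → A0) → Zsp ι → Λ) (g : ι → ι → ℕ → Zsp ι → Λ) : Prop where
  mf : ∀ b, Measurable (f b)
  mg : ∀ i j k, Measurable (g i j k)
  R1 : ∀ b b' z c, f (b + b') (z, c) = f b (z + cv b', c) * f b' (z, c)
  R2 : ∀ i j, i ≠ j → ∀ k b z c, g i j k (z + cv b, c) * f b (z, c) =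
    f (b + Pi.single i (u ^ k * b j)) (z + Pi.single i ((u:ℝ) ^ k * z j), c) * g i j k (z, c)

def icv (k : ι → ℤ) : ι → A0 := fun i => (k i : A0)

lemma CD.twist {u : A0} {f : (ι → A0) → Zsp ι → Λ} {g : ι → ι → ℕ → Zsp ι → Λ} (h : CD u f g) {φ : Zsp ι → Λ} (hφ : Measurable φ) :
    CD u (fun b x => φ (x.1 + cv b, x.2) * f b x * (φ x)⁻¹)
      (fun i j k x => φ (x.1 + Pi.single i ((u:ℝ) ^ k * x.1 j), x.2) * g i j k x * (φ x)⁻¹) where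
  mf b := by
    have : Measurable fun x : Zsp ι => (x.1 + cv b, x.2) := by fun_prop
    exact ((hφ.comp this).mul (h.mf b)).mul hφ.inv
  mg i j k := by
    have : Measurable fun x : Zsp ι => (x.1 + Pi.single i ((u:ℝ) ^ k * x.1 j), x.2) := by
      have := (meas_single (ι := ι) i).comp (show Measurable fun x : Zsp ι => (u:ℝ) ^ k * x.1 j by fun_prop)
      exact (measurable_fst.add this).prodMk measurable_snd
    exact ((hφ.comp this).mul (h.mg i j k)).mul hφ.inv
  R1 b b' z c := by
    simp only
    rw [h.R1, cv_add, show z + (cv b + cv b') = z + cv b' + cv b by abel]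
    group
  R2 i j hij k b z c := by
    have h2 := h.R2 i j hij k b z c
    have e : z + cv b + Pi.single i ((u:ℝ) ^ k * (z + cv b) j) =
        z + Pi.single i ((u:ℝ) ^ k * z j) + cv (b + Pi.single i (u ^ k * b j)) := by
      rw [cv_add, cv_single]
      simp only [Pi.add_apply, mul_add, Pi.single_add, cv, Subring.coe_mul, Subring.coe_pow]
      abel
    simp only
    rw [e]
    have : ∀ a b c d e : Λ, a * b * c⁻¹ * (c * d * e⁻¹) = a * (b * d) * e⁻¹ := by intros; group
    rw [this, h2]
    group

lemma CD.trivialize {u : A0} {f : (ι → A0) → Zsp ι → Λ} {g : ι → ι → ℕ → Zsp ι → Λ} (h : CD u f g) :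
    ∃ φ : Zsp ι → Λ, Measurable φ ∧ ∀ (k : ι → ℤ) (x : Zsp ι), φ (x.1 + cv (icv k : ι → A0), x.2) * f (icv k) x * (φ x)⁻¹ = 1 := by
  refine ⟨fun x => f (icv fun i => - ⌊x.1 i⌋) x, ?_, ?_⟩
  · have hm : Measurable fun x : Zsp ι => fun i => - ⌊x.1 i⌋ := by fun_prop
    have h2 : Measurable fun p : (ι → ℤ) × Zsp ι => f (icv p.1) p.2 := measurable_from_prod_countable_right fun k => h.mf (icv k)
    exact h2.comp (hm.prodMk measurable_id)
  · rintro k ⟨z, c⟩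
    simp only
    rw [← h.R1]
    have : (icv (fun i => - ⌊(z + cv (icv k : ι → A0)) i⌋) + icv k : ι → A0) = icv fun i => - ⌊z i⌋ := by
      funext i
      simp [icv, cv]
    rw [this, mul_inv_cancel]

def Per (f : (ι → A0) → Zsp ι → Λ) : Prop := ∀ (k : ι → ℤ) x, f (icv k) x = 1

lemma CD.per_add {u : A0} {f : (ι → A0) → Zsp ι → Λ} {g : ι → ι → ℕ → Zsp ι → Λ} (h : CD u f g) (hp : Per f) (b : ι → A0) (k : ι → ℤ) (x : Zsp ι) :
    f (b + icv k) x = f b x := by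
  obtain ⟨z, c⟩ := x
  rw [add_comm, h.R1, hp, one_mul]

lemma CD.per {u : A0} {f : (ι → A0) → Zsp ι → Λ} {g : ι → ι → ℕ → Zsp ι → Λ} (h : CD u f g) (hp : Per f) (b : ι → A0) (k : ι → ℤ) (z : ι → ℝ) (c : ℝ) :
    f b (z + fun i => (k i : ℝ), c) = f b (z, c) := by
  have h1 := h.R1 b (icv k) z c
  rw [h.per_add hp, hp, mul_one] at h1
  rw [h1]; congr 3

noncomputable def shearEquiv (i j : ι) (hij : i ≠ j) (a : ℝ) : (ι → ℝ) ≃ᵐ (ι → ℝ) where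
  toFun z := z + Pi.single i (a * z j)
  invFun z := z + Pi.single i (-a * z j)
  left_inv z := by
    have : (Pi.single i (a * z j) : ι → ℝ) j = 0 := by simp [hij.symm]
    simp only [Pi.add_apply, this, add_zero]
    rw [add_assoc, ← Pi.single_add]; simp
  right_inv z := by
    have : (Pi.single i (-a * z j) : ι → ℝ) j = 0 := by simp [hij.symm]
    simp only [Pi.add_apply, this, add_zero]
    rw [add_assoc, ← Pi.single_add]; simp
  measurable_toFun := by exact (mp_shear i j hij a).measurable
  measurable_invFun := by exact (mp_shear i j hij (-a)).measurable

variable (ν : Measure ℝ) [IsFiniteMeasure ν]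

def eT (w : ι → ℝ) : (ι → ℝ) × Zsp ι ≃ᵐ (ι → ℝ) × Zsp ι :=
  (MeasurableEquiv.refl _).prodCongr ((MeasurableEquiv.addRight w).prodCongr (MeasurableEquiv.refl _))

lemma eT_mp (w : ι → ℝ) : MeasurePreserving (eT w) (mu3 ι ν) (mu3 ι ν) :=
  (MeasurePreserving.id _).prod ((measurePreserving_add_right volume w).prod (MeasurePreserving.id _))

noncomputable def eW (i j : ι) (hij : i ≠ j) (a : ℝ) : (ι → ℝ) × Zsp ι ≃ᵐ (ι → ℝ) × Zsp ι :=
  (shearEquiv i j hij a).prodCongr ((shearEquiv i j hij a).prodCongr (MeasurableEquiv.refl _))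

lemma eW_mp (i j : ι) (hij : i ≠ j) (a : ℝ) : MeasurePreserving (eW i j hij a) (mu3 ι ν) (mu3 ι ν) :=
  (mp_shear i j hij a).prod ((mp_shear i j hij a).prod (MeasurePreserving.id _))

lemma meas_p {h : Zsp ι → Λ} (hh : Measurable h) : Measurable fun x : (ι → ℝ) × Zsp ι => h (x.2.1 + x.1, x.2.2) :=
  hh.comp (by fun_prop)

noncomputable def KU {f : (ι → A0) → Zsp ι → Λ} (mf : ∀ b, Measurable (f b)) (b : ι → A0) :=
  koop ℂ (tw (eT (cv b)) _ _ (meas_p (mf b)) ((mf b).comp measurable_snd)) (tw_mp _ (eT_mp ν (cv b)) _ _ _ _)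

noncomputable def KW {g : ℕ → Zsp ι → Λ} (mg : ∀ k, Measurable (g k)) (i j : ι) (hij : i ≠ j) (u : ℝ) (k : ℕ) :=
  koop ℂ (tw (eW i j hij (u ^ k)) _ _ (meas_p (mg k)) ((mg k).comp measurable_snd)) (tw_mp _ (eW_mp ν i j hij (u ^ k)) _ _ _ _)

lemma KU_add {u : A0} {f : (ι → A0) → Zsp ι → Λ} {g : ι → ι → ℕ → Zsp ι → Λ} (h : CD u f g) (a b : ι → A0) (x) :
    KU ν h.mf (a + b) x = KU ν h.mf a (KU ν h.mf b x) := by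
  refine koop_mul _ _ _ _ ?_ x
  rintro ⟨⟨v, z, c⟩, l⟩
  have e1 : f (a + b) (z + v, c) = f b (z + cv a + v, c) * f a (z + v, c) := by
    rw [add_comm a b, h.R1, show z + v + cv a = z + cv a + v by abel]
  have e2 : f (a + b) (z, c) = f b (z + cv a, c) * f a (z, c) := by rw [add_comm a b, h.R1]
  simp only [tw, eT, MeasurableEquiv.coe_mk, Equiv.coe_fn_mk, MeasurableEquiv.prodCongr, Equiv.prodCongr_apply, Prod.map, MeasurableEquiv.refl, MeasurableEquiv.addRight,
    Equiv.coe_addRight, Function.comp, Equiv.refl_apply]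
  erw [e1, e2]
  refine Prod.ext (Prod.ext rfl (Prod.ext ?_ rfl)) ?_
  · show z + cv (a + b) = z + cv a + cv b
    rw [cv_add, add_assoc]
  · show f b (z + cv a + v, c) * f a (z + v, c) * l * (f b (z + cv a, c) * f a (z, c))⁻¹ =
      f b (z + cv a + v, c) * (f a (z + v, c) * l * (f a (z, c))⁻¹) * (f b (z + cv a, c))⁻¹
    group

lemma KU_KW {u : A0} {f : (ι → A0) → Zsp ι → Λ} {g : ι → ι → ℕ → Zsp ι → Λ} (h : CD u f g) (i j : ι) (hij : i ≠ j) (k : ℕ) (b : ι → A0) (x) :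
    KU ν h.mf b (KW ν (h.mg i j) i j hij u k x) = KW ν (h.mg i j) i j hij u k (KU ν h.mf (b + Pi.single i (u ^ k * b j)) x) := by
  refine koop_comm _ _ _ _ _ ?_ x
  rintro ⟨⟨v, z, c⟩, l⟩
  have h1 := h.R2 i j hij k b (z + v) c
  have h2 := h.R2 i j hij k b z c
  have e : z + cv b + Pi.single i ((u:ℝ) ^ k * (z + cv b) j) =
        z + Pi.single i ((u:ℝ) ^ k * z j) + cv (b + Pi.single i (u ^ k * b j)) := by
      rw [cv_add, cv_single]
      simp only [Pi.add_apply, mul_add, Pi.single_add, cv, Subring.coe_mul, Subring.coe_pow]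
      abel
  refine Prod.ext (Prod.ext rfl (Prod.ext e rfl)) ?_
  show g i j k (z + cv b + v, c) * (f b (z + v, c) * l * (f b (z, c))⁻¹) * (g i j k (z + cv b, c))⁻¹ =
    f (b + Pi.single i (u ^ k * b j)) (z + Pi.single i ((u:ℝ) ^ k * z j) + (v + Pi.single i ((u:ℝ) ^ k * v j)), c) *
      (g i j k (z + v, c) * l * (g i j k (z, c))⁻¹) * (f (b + Pi.single i (u ^ k * b j)) (z + Pi.single i ((u:ℝ) ^ k * z j), c))⁻¹
  rw [show z + cv b + v = z + v + cv b by abel]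
  have e3 : z + Pi.single i ((u:ℝ) ^ k * z j) + (v + Pi.single i ((u:ℝ) ^ k * v j)) = z + v + Pi.single i ((u:ℝ) ^ k * (z + v) j) := by
    simp only [Pi.add_apply, mul_add, Pi.single_add]; abel
  rw [e3]
  calc _ = (g i j k (z + v + cv b, c) * f b (z + v, c)) * l * (g i j k (z + cv b, c) * f b (z, c))⁻¹ := by group
    _ = _ := by rw [h1, h2]; group
end CDs
end OESuperrigidity

namespace OESuperrigidity
open Filter Topology

section Est
variable {ι : Type} [Fintype ι] [DecidableEq ι]
  {Λ : Type} [Group Λ] [Countable Λ] [MeasurableSpace Λ] [DiscreteMeasurableSpace Λ] {A0 : Subring ℝ}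
  (ν : Measure ℝ) [IsFiniteMeasure ν]

def bB (ι : Type) (r R : ℝ) : Set ((ι → ℝ) × Zsp ι) := box ι r ×ˢ (box ι R ×ˢ Set.univ)

lemma bB_meas (r R : ℝ) : MeasurableSet (bB ι r R) := (box_meas r).prod ((box_meas R).prod MeasurableSet.univ)

lemma bB_real (r R : ℝ) : (mu3 ι ν).real (bB ι r R) = volume.real (box ι r) * (volume.real (box ι R) * ν.real Set.univ) := by
  rw [bB, measureReal_prod_prod, measureReal_prod_prod]

lemma bB_ne_top (r R : ℝ) : mu3 ι ν (bB ι r R) ≠ ⊤ := by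
  rw [bB, Measure.prod_prod, Measure.prod_prod]
  exact ENNReal.mul_ne_top (box_ne_top r) (ENNReal.mul_ne_top (box_ne_top R) (measure_ne_top ν _))

lemma edge_z {r R η : ℝ} (hR : 0 < R) (hη : 0 ≤ η) (i : ι) :
    (mu3 ι ν).real {x ∈ bB ι r R | R - η ≤ |x.2.1 i|} ≤ η / R * (mu3 ι ν).real (bB ι r R) := by
  have : {x ∈ bB ι r R | R - η ≤ |x.2.1 i|} = box ι r ×ˢ ({z ∈ box ι R | R - η ≤ |z i|} ×ˢ Set.univ) := by
    ext ⟨v, z, c⟩; simp [bB]; tauto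
  rw [this, measureReal_prod_prod, measureReal_prod_prod, bB_real]
  have h := box_edge hR hη i
  have h1 : 0 ≤ volume.real (box ι r) := measureReal_nonneg
  have h2 : 0 ≤ ν.real Set.univ := measureReal_nonneg
  calc _ ≤ volume.real (box ι r) * (η / R * volume.real (box ι R) * ν.real Set.univ) := by gcongr
    _ = _ := by ring

lemma edge_v {r R η : ℝ} (hr : 0 < r) (hη : 0 ≤ η) (i : ι) :
    (mu3 ι ν).real {x ∈ bB ι r R | r - η ≤ |x.1 i|} ≤ η / r * (mu3 ι ν).real (bB ι r R) := by
  have : {x ∈ bB ι r R | r - η ≤ |x.1 i|} = {v ∈ box ι r | r - η ≤ |v i|} ×ˢ (box ι R ×ˢ Set.univ) := by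
    ext ⟨v, z, c⟩; simp [bB]; tauto
  rw [this, measureReal_prod_prod, measureReal_prod_prod, bB_real]
  have h := box_edge hr hη i
  have h1 : 0 ≤ volume.real (box ι R) := measureReal_nonneg
  have h2 : 0 ≤ ν.real Set.univ := measureReal_nonneg
  calc _ ≤ (η / r * volume.real (box ι r)) * (volume.real (box ι R) * ν.real Set.univ) := by gcongr
    _ = _ := by ring

lemma box_add {R t : ℝ} {z : ι → ℝ} {i : ι} (hz : z ∈ box ι R) (h : z + Pi.single i t ∉ box ι R) {η : ℝ} (ht : |t| ≤ η) :
    R - η ≤ |z i| := by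
  rw [mem_box] at hz h
  by_contra hc
  push Not at hc
  apply h
  intro l
  by_cases hl : l = i
  · subst hl
    simp only [Pi.add_apply, Pi.single_eq_same]
    have h1 := abs_lt.1 hc
    have h2 := abs_le.1 ht
    constructor <;> linarith
  · simpa [hl] using hz l

lemma bad_T {r R : ℝ} (hR : 0 < R) {h : Zsp ι → Λ} (hh : Measurable h) {η : ℝ} (hη : 0 < η)
    (hr : ∀ v ∈ box ι r, muZ ι ν ((box ι R ×ˢ Set.univ) ∩ {x | h (x.1 + v, x.2) ≠ h x}) ≤ ENNReal.ofReal η)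
    (i : ι) (a : ℝ) :
    (mu3 ι ν).real {x ∈ bB ι r R | eT (Pi.single i a) x ∉ bB ι r R ∨ h (x.2.1 + x.1, x.2.2) ≠ h x.2} ≤
      |a| / R * (mu3 ι ν).real (bB ι r R) + volume.real (box ι r) * η := by
  refine le_trans (measureReal_mono ?_ ?_) ((measureReal_union_le _ _).trans
    (add_le_add (edge_z ν hR (abs_nonneg a) i) (close_int ν hh hη hr)))
  · rintro ⟨v, z, c⟩ ⟨h1, h2⟩
    simp only [bB, Set.mem_prod, Set.mem_univ, and_true] at h1
    rcases h2 with h2 | h2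
    · left
      refine ⟨by simpa [bB] using h1, ?_⟩
      have : z + Pi.single i a ∉ box ι R := fun h3 => h2 (by
        refine ⟨h1.1, h3, trivial⟩)
      exact box_add h1.2 this le_rfl
    · right; exact ⟨h1.1, h1.2, h2⟩
  · refine measure_ne_top_of_subset ?_ (bB_ne_top ν r R)
    rintro ⟨v, z, c⟩ (h1 | h1)
    · exact h1.1
    · exact ⟨h1.1, h1.2.1, trivial⟩

lemma bad_W {r R : ℝ} (hR : 0 < R) (hr0 : 0 < r) {h : Zsp ι → Λ} (hh : Measurable h) {η : ℝ} (hη : 0 < η)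
    (hr : ∀ v ∈ box ι r, muZ ι ν ((box ι R ×ˢ Set.univ) ∩ {x | h (x.1 + v, x.2) ≠ h x}) ≤ ENNReal.ofReal η)
    (i j : ι) (hij : i ≠ j) (a : ℝ) :
    (mu3 ι ν).real {x ∈ bB ι r R | eW i j hij a x ∉ bB ι r R ∨ h (x.2.1 + x.1, x.2.2) ≠ h x.2} ≤
      2 * |a| * (mu3 ι ν).real (bB ι r R) + volume.real (box ι r) * η := by
  have e1 := edge_z (ι := ι) ν (r := r) hR (η := |a| * R) (by positivity) i
  have e2 := edge_v (ι := ι) ν (R := R) hr0 (η := |a| * r) (by positivity) i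
  rw [mul_div_assoc, div_self hR.ne', mul_one] at e1
  rw [mul_div_assoc, div_self hr0.ne', mul_one] at e2
  have key : ∀ {ρ : ℝ} {z : ι → ℝ}, z ∈ box ι ρ → z + Pi.single i (a * z j) ∉ box ι ρ → ρ - |a| * ρ ≤ |z i| := by
    intro ρ z h1 h2
    refine box_add h1 h2 ?_
    rw [abs_mul]
    have := mem_box.1 h1 j
    exact mul_le_mul_of_nonneg_left (abs_le.2 ⟨this.1.le, this.2⟩) (abs_nonneg _)
  refine le_trans (measureReal_mono (s₂ := ({x ∈ bB ι r R | R - |a| * R ≤ |x.2.1 i|} ∪ {x ∈ bB ι r R | r - |a| * r ≤ |x.1 i|}) ∪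
      {x | x.1 ∈ box ι r ∧ x.2.1 ∈ box ι R ∧ h (x.2.1 + x.1, x.2.2) ≠ h x.2}) ?_ ?_) ((measureReal_union_le _ _).trans
    (add_le_add ((measureReal_union_le _ _).trans ?_) (close_int ν hh hη hr)))
  · rintro ⟨v, z, c⟩ ⟨h1, h2⟩
    have h1' := h1
    simp only [bB, Set.mem_prod, Set.mem_univ, and_true] at h1
    rcases h2 with h2 | h2
    · left
      by_cases h3 : z + Pi.single i (a * z j) ∈ box ι R
      · right
        refine ⟨h1', key h1.1 fun h4 => h2 ⟨h4, h3, trivial⟩⟩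
      · left; exact ⟨h1', key h1.2 h3⟩
    · right; exact ⟨h1.1, h1.2, h2⟩
  · refine measure_ne_top_of_subset ?_ (bB_ne_top ν r R)
    rintro ⟨v, z, c⟩ ((h1 | h1) | h1)
    · exact h1.1
    · exact h1.1
    · exact ⟨h1.1, h1.2.1, trivial⟩
  · linarith

lemma le_of_sq {a b : ℝ} (hb : 0 ≤ b) (h : a ^ 2 ≤ b ^ 2) : a ≤ b := abs_le_of_sq_le_sq' h hb |>.2

lemma KU_xi {f : (ι → A0) → Zsp ι → Λ} (mf : ∀ b, Measurable (f b)) (b : ι → A0) (r R : ℝ) :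
    ‖KU ν mf b (xi (μ := mu3 ι ν) ℂ Λ (bB_meas (ι := ι) r R) (bB_ne_top ν r R)) - xi (μ := mu3 ι ν) ℂ Λ (bB_meas (ι := ι) r R) (bB_ne_top ν r R)‖ ^ 2 =
    2 * (mu3 ι ν).real {x ∈ bB ι r R | eT (cv b) x ∉ bB ι r R ∨ f b (x.2.1 + x.1, x.2.2) ≠ f b x.2} :=
  tw_xi ℂ _ (eT_mp ν (cv b)) _ _ _ _ _ _

lemma KW_xi {g : ℕ → Zsp ι → Λ} (mg : ∀ k, Measurable (g k)) (i j : ι) (hij : i ≠ j) (u : ℝ) (k : ℕ) (r R : ℝ) :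
    ‖KW ν mg i j hij u k (xi (μ := mu3 ι ν) ℂ Λ (bB_meas (ι := ι) r R) (bB_ne_top ν r R)) - xi (μ := mu3 ι ν) ℂ Λ (bB_meas (ι := ι) r R) (bB_ne_top ν r R)‖ ^ 2 =
    2 * (mu3 ι ν).real {x ∈ bB ι r R | eW i j hij (u ^ k) x ∉ bB ι r R ∨ g k (x.2.1 + x.1, x.2.2) ≠ g k x.2} :=
  tw_xi ℂ _ (eW_mp ν i j hij (u ^ k)) _ _ _ _ _ _

lemma pair_rel {H : Type} [NormedAddCommGroup H] [InnerProductSpace ℂ H] {U : (ι → A0) → H ≃ₗᵢ[ℂ] H} {u : A0} {i j : ι} (hij : i ≠ j)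
    {W W' : ℕ → H ≃ₗᵢ[ℂ] H} (hU : ∀ a b x, U (a + b) x = U a (U b x))
    (hW : ∀ k b x, U b (W k x) = W k (U (b + Pi.single i (u ^ k * b j)) x))
    (hW' : ∀ k b x, U b (W' k x) = W' k (U (b + Pi.single j (u ^ k * b i)) x)) :
    (∀ (a b : A0 × A0) (x : H), U (Pi.single i (a + b).1 + Pi.single j (a + b).2) x =
      U (Pi.single i a.1 + Pi.single j a.2) (U (Pi.single i b.1 + Pi.single j b.2) x)) ∧
    (∀ (k : ℕ) (b : A0 × A0) (x : H), U (Pi.single i b.1 + Pi.single j b.2) (W k x) =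
      W k (U (Pi.single i (b.1 + u ^ k * b.2) + Pi.single j b.2) x)) ∧
    (∀ (k : ℕ) (b : A0 × A0) (x : H), U (Pi.single i b.1 + Pi.single j b.2) (W' k x) =
      W' k (U (Pi.single i b.1 + Pi.single j (b.2 + u ^ k * b.1)) x)) := by
  refine ⟨fun a b x => ?_, fun k b x => ?_, fun k b x => ?_⟩
  · rw [← hU]
    congr 2
    simp only [Prod.fst_add, Prod.snd_add, Pi.single_add]
    abel
  · have e : (Pi.single i (b.1 + u ^ k * b.2) + Pi.single j b.2 : ι → A0) =
        Pi.single i b.1 + Pi.single j b.2 + Pi.single i (u ^ k * (Pi.single i b.1 + Pi.single j b.2 : ι → A0) j) := by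
      simp [Pi.single_add, hij.symm]; abel
    rw [e, hW]
  · have e : (Pi.single i b.1 + Pi.single j (b.2 + u ^ k * b.1) : ι → A0) =
        Pi.single i b.1 + Pi.single j b.2 + Pi.single j (u ^ k * (Pi.single i b.1 + Pi.single j b.2 : ι → A0) i) := by
      simp [Pi.single_add, hij]; abel
    rw [e, hW']

lemma nall {H : Type} [NormedAddCommGroup H] [InnerProductSpace ℂ H] {U : (ι → A0) → H ≃ₗᵢ[ℂ] H}
    (hU : ∀ a b x, U (a + b) x = U a (U b x)) {ξ : H} {κ : ℝ}
    (n1 : ∀ (i : ι) (b : A0), |(b : ℝ)| ≤ 1 → ‖U (Pi.single i b) ξ - ξ‖ ≤ κ)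
    (b : ι → A0) (hb : ∀ i, |(b i : ℝ)| ≤ 1) (s : Finset ι) : ‖U (∑ i ∈ s, Pi.single i (b i)) ξ - ξ‖ ≤ s.card * κ := by
  induction s using Finset.induction_on with
  | empty =>
    have : U 0 ξ = ξ := by
      have h1 := hU 0 0 ξ
      rw [add_zero] at h1
      exact (U 0).injective h1.symm
    simp [this]
  | insert a s ha ih =>
    rw [Finset.sum_insert ha, hU, Finset.card_insert_of_notMem ha]
    calc _ = ‖U (Pi.single a (b a)) (U (∑ i ∈ s, Pi.single i (b i)) ξ - ξ) + (U (Pi.single a (b a)) ξ - ξ)‖ := by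
          rw [map_sub]; congr 1; abel
      _ ≤ ‖U (∑ i ∈ s, Pi.single i (b i)) ξ - ξ‖ + ‖U (Pi.single a (b a)) ξ - ξ‖ := by
          refine (norm_add_le _ _).trans ?_
          rw [LinearIsometryEquiv.norm_map]
      _ ≤ _ := by
          have := n1 a (b a) (hb a)
          push_cast
          linarith

lemma pairS {H : Type} [NormedAddCommGroup H] [InnerProductSpace ℂ H] {U : (ι → A0) → H ≃ₗᵢ[ℂ] H} {u : A0} {i j : ι} (hij : i ≠ j)
    {W W' : ℕ → H ≃ₗᵢ[ℂ] H} (hU : ∀ a b x, U (a + b) x = U a (U b x))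
    (hW : ∀ k b x, U b (W k x) = W k (U (b + Pi.single i (u ^ k * b j)) x))
    (hW' : ∀ k b x, U b (W' k x) = W' k (U (b + Pi.single j (u ^ k * b i)) x)) {C K j0 : ℕ} {ε1 ε2 κ : ℝ} {ξ : H}
    (hS : ∀ (U : A0 × A0 → (H ≃ₗᵢ[ℂ] H)) (W W' : ℕ → (H ≃ₗᵢ[ℂ] H)) (ξ : H),
        (∀ a b x, U (a + b) x = U a (U b x)) →
        (∀ k b x, U b (W k x) = W k (U (b.1 + u ^ k * b.2, b.2) x)) →
        (∀ k b x, U b (W' k x) = W' k (U (b.1, b.2 + u ^ k * b.1) x)) →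
        (∀ i < C, ‖U (u ^ i, 0) ξ - ξ‖ ≤ ε2 * ‖ξ‖) →
        (∀ i < C, ‖U (0, u ^ i) ξ - ξ‖ ≤ ε2 * ‖ξ‖) →
        (∀ k ∈ Finset.Icc 1 K, ‖W (k * j0) ξ - ξ‖ ≤ ε1 * ‖ξ‖) →
        (∀ k ∈ Finset.Icc 1 K, ‖W' (k * j0) ξ - ξ‖ ≤ ε1 * ‖ξ‖) →
        ∀ b : A0, |(b : ℝ)| ≤ 1 → ‖U (b, 0) ξ - ξ‖ ≤ κ * ‖ξ‖)
    (nU : ∀ i : ι, ∀ k < C, ‖U (Pi.single i (u ^ k)) ξ - ξ‖ ≤ ε2 * ‖ξ‖)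
    (n1 : ∀ k ∈ Finset.Icc 1 K, ‖W (k * j0) ξ - ξ‖ ≤ ε1 * ‖ξ‖)
    (n2 : ∀ k ∈ Finset.Icc 1 K, ‖W' (k * j0) ξ - ξ‖ ≤ ε1 * ‖ξ‖) (b : A0) (hb : |(b : ℝ)| ≤ 1) :
    ‖U (Pi.single i b) ξ - ξ‖ ≤ κ * ‖ξ‖ := by
  obtain ⟨p1, p2, p3⟩ := pair_rel hij hU hW hW'
  have h1 := hS (fun b => U (Pi.single i b.1 + Pi.single j b.2)) W W' ξ p1 p2 p3
      (by intro k hk; simpa using nU i k hk)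
      (by intro k hk; simpa using nU j k hk) n1 n2 b hb
  simpa using h1

noncomputable section
def HH (ι Λ : Type) [Fintype ι] [MeasurableSpace Λ] (ν : Measure ℝ) : Type := Lp ℂ 2 ((mu3 ι ν).prod (Measure.count : Measure Λ))
instance : NormedAddCommGroup (HH ι Λ ν) := inferInstanceAs (NormedAddCommGroup (Lp ℂ 2 ((mu3 ι ν).prod (Measure.count : Measure Λ))))
instance : InnerProductSpace ℂ (HH ι Λ ν) := inferInstanceAs (InnerProductSpace ℂ (Lp ℂ 2 ((mu3 ι ν).prod (Measure.count : Measure Λ))))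
instance : CompleteSpace (HH ι Λ ν) := inferInstanceAs (CompleteSpace (Lp ℂ 2 ((mu3 ι ν).prod (Measure.count : Measure Λ))))
def KU' {f : (ι → A0) → Zsp ι → Λ} (mf : ∀ b, Measurable (f b)) (b : ι → A0) : HH ι Λ ν ≃ₗᵢ[ℂ] HH ι Λ ν := KU ν mf b
def KW' {g : ℕ → Zsp ι → Λ} (mg : ∀ k, Measurable (g k)) (i j : ι) (hij : i ≠ j) (u : ℝ) (k : ℕ) : HH ι Λ ν ≃ₗᵢ[ℂ] HH ι Λ ν := KW ν mg i j hij u k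
lemma KU'_add {u : A0} {f : (ι → A0) → Zsp ι → Λ} {g : ι → ι → ℕ → Zsp ι → Λ} (h : CD u f g) (a b : ι → A0) (x) :
    KU' ν h.mf (a + b) x = KU' ν h.mf a (KU' ν h.mf b x) := KU_add ν h a b x
lemma KU'_KW {u : A0} {f : (ι → A0) → Zsp ι → Λ} {g : ι → ι → ℕ → Zsp ι → Λ} (h : CD u f g) (i j : ι) (hij : i ≠ j) (k : ℕ) (b : ι → A0) (x) :
    KU' ν h.mf b (KW' ν (h.mg i j) i j hij u k x) = KW' ν (h.mg i j) i j hij u k (KU' ν h.mf (b + Pi.single i (u ^ k * b j)) x) := KU_KW ν h i j hij k b x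
def xi' (r R : ℝ) : HH ι Λ ν := xi (μ := mu3 ι ν) ℂ Λ (bB_meas (ι := ι) r R) (bB_ne_top ν r R)
lemma KU'_xi {f : (ι → A0) → Zsp ι → Λ} (mf : ∀ b, Measurable (f b)) (b : ι → A0) (r R : ℝ) :
    ‖KU' ν mf b (xi' ν r R) - xi' ν r R‖ ^ 2 =
    2 * (mu3 ι ν).real {x ∈ bB ι r R | eT (cv b) x ∉ bB ι r R ∨ f b (x.2.1 + x.1, x.2.2) ≠ f b x.2} := KU_xi ν mf b r R
lemma KW'_xi {g : ℕ → Zsp ι → Λ} (mg : ∀ k, Measurable (g k)) (i j : ι) (hij : i ≠ j) (u : ℝ) (k : ℕ) (r R : ℝ) :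
    ‖KW' ν mg i j hij u k (xi' ν r R) - xi' ν r R‖ ^ 2 =
    2 * (mu3 ι ν).real {x ∈ bB ι r R | eW i j hij (u ^ k) x ∉ bB ι r R ∨ g k (x.2.1 + x.1, x.2.2) ≠ g k x.2} := KW_xi ν mg i j hij u k r R
lemma xi'_norm (r R : ℝ) : ‖(xi' ν r R : HH ι Λ ν)‖ ^ 2 = (mu3 ι ν).real (bB ι r R) := norm_xi ℂ _ _
end
set_option maxHeartbeats 1000000 in
lemma est [Nontrivial ι] {u : ℝ} {c : ℕ → ℤ} {d : ℕ} (hu : UData u A0 c d) {f : (ι → A0) → Zsp ι → Λ} {g : ι → ι → ℕ → Zsp ι → Λ}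
    (h : CD ⟨u, hu.mem⟩ f g) (hp : Per f) (ε : ℝ) (hε : 0 < ε) (ρ : ℝ) (hρ : 0 < ρ) :
    ∃ r, 0 < r ∧ r < ρ ∧ ∀ b, (mu3 ι ν).real {x | x.1 ∈ box ι r ∧ x.2.1 ∈ unitc ι ∧ f b (x.2.1 + x.1, x.2.2) ≠ f b x.2} ≤
      ε * (volume.real (box ι r) * ν.real Set.univ) := by
  rcases (measureReal_nonneg (μ := ν) (s := Set.univ)).eq_or_lt with hν | hν
  · have : ν = 0 := by
      rw [← Measure.measure_univ_eq_zero]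
      rw [eq_comm, measureReal_def, ENNReal.toReal_eq_zero_iff] at hν
      exact hν.resolve_right (measure_ne_top ν _)
    subst this
    refine ⟨ρ / 2, by positivity, by linarith, fun b => ?_⟩
    simp [mu3, muZ, measureReal_def]
  set m : ℝ := ((Fintype.card ι : ℕ) : ℝ) with hm
  have hm0 : 0 < m := by rw [hm]; exact_mod_cast Fintype.card_pos
  obtain ⟨K, hK0, ε1, hε1, hS⟩ := lemmaS hu (min 1 ε / m) (by positivity)
  have hu1 := abs_pos.2 hu.ne
  obtain ⟨j0, hj0, hj0'⟩ : ∃ j0 : ℕ, 3 * d < j0 ∧ |u| ^ j0 < ε1 ^ 2 / 8 := by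
    have h1 := (tendsto_pow_atTop_nhds_zero_of_lt_one hu1.le hu.lt).eventually (gt_mem_nhds (show (0:ℝ) < ε1 ^ 2 / 8 by positivity))
    exact ((eventually_gt_atTop (3*d)).and h1).exists
  obtain ⟨C, ε2, hε2, hS⟩ := hS j0 hj0
  obtain ⟨N, hN⟩ := exists_nat_gt (4 / ε2 ^ 2)
  have hN0 : (0:ℝ) < N := lt_trans (by positivity) hN
  have hN1 : 1 / (N:ℝ) ≤ ε2 ^ 2 / 4 := by
    rw [div_le_div_iff₀ hN0 (by norm_num)]
    rw [div_lt_iff₀ (by positivity)] at hN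
    nlinarith
  set M := volume.real (box ι N) * ν.real Set.univ with hM
  have hM0 : 0 < M := mul_pos (box_pos hN0) hν
  set η := min (ε1 ^ 2) (ε2 ^ 2) / 4 with hη
  have hη0 : 0 < η := by positivity
  have hηM : 0 < η * M := by positivity
  have ev1 : ∀ᶠ v in 𝓝 (0 : ι → ℝ), ∀ i : ι, ∀ k ∈ Finset.range C,
      muZ ι ν ((box ι N ×ˢ Set.univ) ∩ {x | f (Pi.single i (⟨u, hu.mem⟩ ^ k)) (x.1 + v, x.2) ≠ f (Pi.single i (⟨u, hu.mem⟩ ^ k)) x}) ≤ ENNReal.ofReal (η * M) :=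
    eventually_all.2 fun i => (Finset.eventually_all _).2 fun k _ => close_ev ν (h.mf _) hηM
  have ev2 : ∀ᶠ v in 𝓝 (0 : ι → ℝ), ∀ i j : ι, ∀ k ∈ Finset.Icc 1 K,
      muZ ι ν ((box ι N ×ˢ Set.univ) ∩ {x | g i j (k * j0) (x.1 + v, x.2) ≠ g i j (k * j0) x}) ≤ ENNReal.ofReal (η * M) :=
    eventually_all.2 fun i => eventually_all.2 fun j => (Finset.eventually_all _).2 fun k _ => close_ev ν (h.mg _ _ _) hηM
  obtain ⟨r', hr'0, hr'⟩ := Metric.eventually_nhds_iff.1 (ev1.and ev2)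
  set r := min r' ρ / 2 with hr
  have hr0 : 0 < r := by positivity
  have hrr' : r < r' := by have := min_le_left r' ρ; rw [hr]; linarith
  have hrρ : r < ρ := by have := min_le_right r' ρ; rw [hr]; linarith
  have hbox : ∀ v ∈ box ι r, dist v 0 < r' := by
    intro v hv
    rw [dist_zero_right]
    refine lt_of_le_of_lt ((pi_norm_le_iff_of_nonneg hr0.le).2 fun i => ?_) hrr'
    have := mem_box.1 hv i
    exact abs_le.2 ⟨this.1.le, this.2⟩
  refine ⟨r, hr0, hrρ, ?_⟩
  set μB := (mu3 ι ν).real (bB ι r N) with hμB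
  have hμB' : μB = volume.real (box ι r) * M := bB_real ν r N
  have hμB0 : 0 ≤ μB := measureReal_nonneg
  let ξ : HH ι Λ ν := xi' ν r N
  have hξ : ‖ξ‖ ^ 2 = μB := xi'_norm ν r N
  have nU : ∀ i : ι, ∀ k < C, ‖KU' ν h.mf (Pi.single i (⟨u, hu.mem⟩ ^ k)) ξ - ξ‖ ≤ ε2 * ‖ξ‖ := by
    intro i k hk
    refine le_of_sq (by positivity) ?_
    rw [mul_pow, hξ, show ξ = xi' ν r N from rfl, KU'_xi]
    have h1 := bad_T ν hN0 (h.mf (Pi.single i (⟨u, hu.mem⟩ ^ k))) hηM (fun v hv => (hr' (hbox v hv)).1 i k (Finset.mem_range.2 hk)) i (u ^ k)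
    rw [show (Pi.single i (u ^ k) : ι → ℝ) = cv (Pi.single i ((⟨u, hu.mem⟩ : A0) ^ k) : ι → A0) by rw [cv_single]; rfl] at h1
    refine (mul_le_mul_of_nonneg_left h1 zero_le_two).trans ?_
    have h2 : |u ^ k| ≤ 1 := by rw [abs_pow]; exact pow_le_one₀ hu1.le hu.lt.le
    have h3 : |u ^ k| / N ≤ ε2 ^ 2 / 4 := (div_le_div_of_nonneg_right h2 hN0.le).trans hN1
    have h4 : η ≤ ε2 ^ 2 / 4 := by rw [hη]; have := min_le_right (ε1 ^ 2) (ε2 ^ 2); linarith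
    have h5 : volume.real (box ι r) * (η * M) = η * μB := by rw [hμB']; ring
    rw [h5, ← hμB]
    nlinarith
  have nW : ∀ (i j : ι) (hij : i ≠ j), ∀ k ∈ Finset.Icc 1 K, ‖KW' ν (h.mg i j) i j hij u (k * j0) ξ - ξ‖ ≤ ε1 * ‖ξ‖ := by
    intro i j hij k hk
    refine le_of_sq (by positivity) ?_
    rw [mul_pow, hξ, show ξ = xi' ν r N from rfl, KW'_xi]
    have h1 := bad_W ν hN0 hr0 (h.mg i j (k * j0)) hηM (fun v hv => (hr' (hbox v hv)).2 i j k hk) i j hij (u ^ (k * j0))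
    refine (mul_le_mul_of_nonneg_left h1 zero_le_two).trans ?_
    have h2 : |u ^ (k * j0)| ≤ ε1 ^ 2 / 8 := by
      rw [abs_pow]
      refine (pow_le_pow_of_le_one hu1.le hu.lt.le ?_).trans hj0'.le
      exact Nat.le_mul_of_pos_left _ (by have := (Finset.mem_Icc.1 hk).1; omega)
    have h4 : η ≤ ε1 ^ 2 / 4 := by rw [hη]; have := min_le_left (ε1 ^ 2) (ε2 ^ 2); linarith
    have h5 : volume.real (box ι r) * (η * M) = η * μB := by rw [hμB']; ring
    rw [h5, ← hμB]
    nlinarith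
  have n1 : ∀ (i : ι) (b : A0), |(b : ℝ)| ≤ 1 → ‖KU' ν h.mf (Pi.single i b) ξ - ξ‖ ≤ min 1 ε / m * ‖ξ‖ := by
    intro i
    obtain ⟨j, hij⟩ := exists_ne i
    exact pairS hij.symm (KU'_add ν h) (KU'_KW ν h i j hij.symm) (KU'_KW ν h j i hij) (hS (HH ι Λ ν)) nU (nW i j hij.symm) (nW j i hij)
  intro b
  obtain ⟨k, b', hb', rfl⟩ : ∃ (k : ι → ℤ) (b' : ι → A0), (∀ i, |(b' i : ℝ)| ≤ 1) ∧ b = b' + icv k := by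
    refine ⟨fun i => ⌊(b i : ℝ)⌋, b - icv fun i => ⌊(b i : ℝ)⌋, fun i => ?_, by simp⟩
    have : (((b - icv (fun i => ⌊(b i : ℝ)⌋) : ι → A0) i : A0) : ℝ) = Int.fract (b i : ℝ) := by
      rw [Int.fract]; simp [icv]
    rw [this, abs_of_nonneg (Int.fract_nonneg _)]
    exact (Int.fract_lt_one _).le
  simp_rw [h.per_add hp]
  have h1 := nall (KU'_add ν h) n1 b' hb' Finset.univ
  rw [Finset.univ_sum_single, Finset.card_univ, ← hm, ← mul_assoc, mul_div_cancel₀ _ hm0.ne'] at h1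
  have h2 := pow_le_pow_left₀ (norm_nonneg _) h1 2
  rw [mul_pow, hξ, show ξ = xi' ν r N from rfl, KU'_xi] at h2
  let P : Set ((ι → ℝ) × Zsp ι) := {x | x.1 ∈ box ι r ∧ f b' (x.2.1 + x.1, x.2.2) ≠ f b' x.2}
  have hPm : MeasurableSet P := ((box_meas r).preimage measurable_fst).inter
    (measurableSet_eq_fun (meas_p (h.mf b')) ((h.mf b').comp measurable_snd)).compl
  have hPs : {x ∈ P | x.2.1 ∈ box ι N} ⊆ {x ∈ bB ι r N | eT (cv b') x ∉ bB ι r N ∨ f b' (x.2.1 + x.1, x.2.2) ≠ f b' x.2} := by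
    rintro ⟨v, z, c⟩ ⟨⟨q1, q2⟩, q3⟩
    exact ⟨⟨q1, q3, trivial⟩, Or.inr q2⟩
  have hDs : {x ∈ bB ι r N | eT (cv b') x ∉ bB ι r N ∨ f b' (x.2.1 + x.1, x.2.2) ≠ f b' x.2} ⊆ bB ι r N := fun x hx => hx.1
  have h3 := tile ν hPm (by
    intro k v z c
    simp only [P, Set.mem_ofPred_eq]
    rw [h.per hp, show z + (fun i => (k i : ℝ)) + v = z + v + fun i => (k i : ℝ) by abel, h.per hp]) N
    (measure_ne_top_of_subset (hPs.trans hDs) (bB_ne_top ν r N))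
  have h4 := measureReal_mono hPs (measure_ne_top_of_subset hDs (bB_ne_top ν r N))
  have h5 : min 1 ε ^ 2 ≤ ε := by
    have a1 := min_le_left 1 ε
    have a2 := min_le_right 1 ε
    have a3 : 0 < min 1 ε := by positivity
    nlinarith
  have h6 : {x : (ι → ℝ) × Zsp ι | x.1 ∈ box ι r ∧ x.2.1 ∈ unitc ι ∧ f b' (x.2.1 + x.1, x.2.2) ≠ f b' x.2} = {x ∈ P | x.2.1 ∈ unitc ι} := by
    ext x; simp only [P, Set.mem_ofPred_eq]; tauto
  rw [h6]
  have hb0 := box_pos (ι := ι) hN0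
  refine le_of_mul_le_mul_left (h3.trans (h4.trans ?_)) hb0
  have h7 : min 1 ε ^ 2 * μB ≤ ε * μB := mul_le_mul_of_nonneg_right h5 hμB0
  have h8 : volume.real (box ι N) * (ε * (volume.real (box ι r) * ν.real Set.univ)) = ε * μB := by rw [hμB', hM]; ring
  rw [h8]
  have h9 : (0:ℝ) ≤ (mu3 ι ν).real {x ∈ bB ι r N | eT (cv b') x ∉ bB ι r N ∨ f b' (x.2.1 + x.1, x.2.2) ≠ f b' x.2} := measureReal_nonneg
  linarith
end Est
end OESuperrigidity

namespace OESuperrigidity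
open Filter Topology

lemma fixedpt {B H : Type} [AddCommGroup B] [NormedAddCommGroup H] [InnerProductSpace ℝ H] [CompleteSpace H] (U : B → H ≃ₗᵢ[ℝ] H)
    (hU : ∀ a b x, U (a + b) x = U a (U b x)) (ξ : H) (κ : ℝ) (hκ : ∀ b, ‖U b ξ - ξ‖ ≤ κ) :
    ∃ ζ ∈ closure (convexHull ℝ (Set.range fun b => U b ξ)), (∀ b, U b ζ = ζ) ∧ ‖ζ - ξ‖ ≤ κ := by
  set S := Set.range fun b => U b ξ
  set K := closure (convexHull ℝ S)
  have hK : Convex ℝ K := (convex_convexHull ℝ S).closure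
  have hne : K.Nonempty := ⟨U 0 ξ, subset_closure (subset_convexHull ℝ S ⟨0, rfl⟩)⟩
  obtain ⟨ζ, hζ, hmin⟩ := exists_norm_eq_iInf_of_complete_convex hne isClosed_closure.isComplete hK 0
  have hinner := (norm_eq_iInf_iff_real_inner_le_zero hK hζ).1 hmin
  refine ⟨ζ, hζ, fun b => ?_, ?_⟩
  · have hmem : U b ζ ∈ K := by
      have h1 : (U b) '' K ⊆ K := by
        refine (image_closure_subset_closure_image (U b).continuous).trans (closure_mono ?_)
        have := (U b).toLinearEquiv.toLinearMap.image_convexHull S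
        erw [this]
        refine convexHull_mono ?_
        rintro _ ⟨_, ⟨a, rfl⟩, rfl⟩
        exact ⟨b + a, hU b a ξ⟩
      exact h1 ⟨ζ, hζ, rfl⟩
    have h2 := hinner _ hmem
    have h3 : ‖U b ζ‖ = ‖ζ‖ := (U b).norm_map ζ
    have h4 := norm_sub_sq_real (U b ζ) ζ
    simp only [zero_sub, inner_neg_left, inner_sub_right, real_inner_self_eq_norm_sq] at h2
    rw [real_inner_comm] at h2
    rw [h3] at h4
    have h5 : ‖U b ζ - ζ‖ ^ 2 ≤ 0 := by linarith
    have h6 : ‖U b ζ - ζ‖ = 0 := by nlinarith [norm_nonneg (U b ζ - ζ)]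
    exact sub_eq_zero.1 (norm_eq_zero.1 h6)
  · have : K ⊆ Metric.closedBall ξ κ := by
      refine closure_minimal (convexHull_min ?_ (convex_closedBall ξ κ)) Metric.isClosed_closedBall
      rintro _ ⟨b, rfl⟩
      simpa [dist_eq_norm] using hκ b
    simpa [dist_eq_norm] using this hζ

section Torus
variable {ι : Type} [Fintype ι] [DecidableEq ι]

abbrev Tor (ι : Type) := ι → UnitAddCircle
def mkv (x : ι → ℝ) : Tor ι := fun i => (x i : UnitAddCircle)
noncomputable def sec (τ : Tor ι) : ι → ℝ := fun i => (AddCircle.measurableEquivIoc 1 0 (τ i) : ℝ)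

lemma mkv_sec (τ : Tor ι) : mkv (sec τ) = τ := by
  funext i
  exact (AddCircle.equivIoc (1:ℝ) 0).symm_apply_apply (τ i)

lemma sec_mkv {x : ι → ℝ} (hx : x ∈ unitc ι) : sec (mkv x) = x := by
  funext i
  have h := hx i (Set.mem_univ i)
  have h' : x i ∈ Set.Ioc (0:ℝ) (0 + 1) := by simpa using h
  have := (AddCircle.equivIoc (1:ℝ) 0).apply_symm_apply ⟨x i, h'⟩
  exact congrArg Subtype.val this

lemma sec_meas : Measurable (sec : Tor ι → ι → ℝ) :=
  measurable_pi_lambda _ fun i => measurable_subtype_coe.comp ((AddCircle.measurableEquivIoc 1 0).measurable.comp (measurable_pi_apply i))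

lemma mkv_add (x y : ι → ℝ) : mkv (x + y) = mkv x + mkv y := by
  funext i; simp [mkv]

lemma mkv_meas : Measurable (mkv : (ι → ℝ) → Tor ι) :=
  measurable_pi_lambda _ fun i => AddCircle.measurable_mk'.comp (measurable_pi_apply i)

lemma sec_add (τ : Tor ι) (w : ι → ℝ) : ∃ k : ι → ℤ, sec (τ + mkv w) = sec τ + w + fun i => (k i : ℝ) := by
  have h : mkv (sec (τ + mkv w)) = mkv (sec τ + w) := by rw [mkv_sec, mkv_add, mkv_sec]
  have h2 : ∀ i, ∃ k : ℤ, sec (τ + mkv w) i = (sec τ + w) i + k := by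
    intro i
    have := congrFun h i
    simp only [mkv] at this
    have h3 : ((sec (τ + mkv w) i - (sec τ + w) i : ℝ) : UnitAddCircle) = 0 := by rw [AddCircle.coe_sub, this, sub_self]
    obtain ⟨k, hk⟩ := (AddCircle.coe_eq_zero_iff 1).1 h3
    refine ⟨k, ?_⟩
    rw [zsmul_eq_mul, mul_one] at hk
    linarith
  choose k hk using h2
  exact ⟨k, funext hk⟩

lemma mkv_mp : MeasurePreserving (mkv : (ι → ℝ) → Tor ι) (volume.restrict (unitc ι)) volume := by
  have h := measurePreserving_pi (fun _ : ι => (volume : Measure ℝ).restrict (Set.Ioc 0 1)) (fun _ : ι => (volume : Measure UnitAddCircle))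
    (f := fun _ x => (x : UnitAddCircle)) (fun i => by simpa using UnitAddCircle.measurePreserving_mk 0)
  rw [← Measure.restrict_pi_pi] at h
  exact h
end Torus
end OESuperrigidity

namespace OESuperrigidity
open Filter Topology

section Z
variable {ι : Type} [Fintype ι] [DecidableEq ι]
  {Λ : Type} [Group Λ] [Countable Λ] [MeasurableSpace Λ] [DiscreteMeasurableSpace Λ] {A0 : Subring ℝ}
  (ν : Measure ℝ) [IsFiniteMeasure ν]

noncomputable def mu4 (ι : Type) [Fintype ι] (ν : Measure ℝ) (r : ℝ) : Measure ((ι → ℝ) × (Tor ι × ℝ)) :=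
  (volume.restrict (box ι r)).prod ((volume : Measure (Tor ι)).prod ν)

instance (r : ℝ) : IsFiniteMeasure (volume.restrict (box ι r)) := ⟨by simpa using (box_ne_top r).lt_top⟩
instance (r : ℝ) : IsFiniteMeasure (mu4 ι ν r) := by unfold mu4; infer_instance

noncomputable def fR (w : ι → ℝ) : (ι → ℝ) × (Tor ι × ℝ) ≃ᵐ (ι → ℝ) × (Tor ι × ℝ) :=
  (MeasurableEquiv.refl _).prodCongr ((MeasurableEquiv.addRight (mkv w)).prodCongr (MeasurableEquiv.refl _))

lemma fR_mp (r : ℝ) (w : ι → ℝ) : MeasurePreserving (fR w) (mu4 ι ν r) (mu4 ι ν r) :=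
  (MeasurePreserving.id _).prod ((measurePreserving_add_right volume (mkv w)).prod (MeasurePreserving.id _))

lemma meas_p4 {h : Zsp ι → Λ} (hh : Measurable h) : Measurable fun x : (ι → ℝ) × (Tor ι × ℝ) => h (sec x.2.1 + x.1, x.2.2) :=
  hh.comp (((sec_meas.comp (measurable_fst.comp measurable_snd)).add measurable_fst).prodMk (measurable_snd.comp measurable_snd))

lemma meas_q4 {h : Zsp ι → Λ} (hh : Measurable h) : Measurable fun x : (ι → ℝ) × (Tor ι × ℝ) => h (sec x.2.1, x.2.2) :=
  hh.comp ((sec_meas.comp (measurable_fst.comp measurable_snd)).prodMk (measurable_snd.comp measurable_snd))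

noncomputable def T4 {f : (ι → A0) → Zsp ι → Λ} (mf : ∀ b, Measurable (f b)) (b : ι → A0) :=
  tw (fR (cv b)) _ _ (meas_p4 (mf b)) (meas_q4 (mf b))

noncomputable def HT (ι Λ : Type) [Fintype ι] [MeasurableSpace Λ] (ν : Measure ℝ) (r : ℝ) : Type :=
  Lp ℝ 2 ((mu4 ι ν r).prod (Measure.count : Measure Λ))
noncomputable instance (r : ℝ) : NormedAddCommGroup (HT ι Λ ν r) := inferInstanceAs (NormedAddCommGroup (Lp ℝ 2 ((mu4 ι ν r).prod (Measure.count : Measure Λ))))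
noncomputable instance (r : ℝ) : InnerProductSpace ℝ (HT ι Λ ν r) := inferInstanceAs (InnerProductSpace ℝ (Lp ℝ 2 ((mu4 ι ν r).prod (Measure.count : Measure Λ))))
instance (r : ℝ) : CompleteSpace (HT ι Λ ν r) := inferInstanceAs (CompleteSpace (Lp ℝ 2 ((mu4 ι ν r).prod (Measure.count : Measure Λ))))

lemma T4_mp {f : (ι → A0) → Zsp ι → Λ} (mf : ∀ b, Measurable (f b)) (r : ℝ) (b : ι → A0) :
    MeasurePreserving (T4 mf b) ((mu4 ι ν r).prod Measure.count) ((mu4 ι ν r).prod Measure.count) := tw_mp _ (fR_mp ν r (cv b)) _ _ _ _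

noncomputable def K4 {f : (ι → A0) → Zsp ι → Λ} (mf : ∀ b, Measurable (f b)) (r : ℝ) (b : ι → A0) : HT ι Λ ν r ≃ₗᵢ[ℝ] HT ι Λ ν r :=
  koop ℝ (T4 mf b) (T4_mp ν mf r b)

lemma T4_apply {f : (ι → A0) → Zsp ι → Λ} (mf : ∀ b, Measurable (f b)) (b : ι → A0) (v τ c l) :
    T4 mf b ((v, τ, c), l) = ((v, τ + mkv (cv b), c), f b (sec τ + v, c) * l * (f b (sec τ, c))⁻¹) := rfl

lemma sec_f {u : A0} {f : (ι → A0) → Zsp ι → Λ} {g : ι → ι → ℕ → Zsp ι → Λ} (h : CD u f g) (hp : Per f) (b : ι → A0) (τ : Tor ι) (w v : ι → ℝ) (c : ℝ) :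
    f b (sec (τ + mkv w) + v, c) = f b (sec τ + v + w, c) := by
  obtain ⟨k, hk⟩ := sec_add τ w
  rw [hk, show sec τ + w + (fun i => (k i : ℝ)) + v = sec τ + v + w + fun i => (k i : ℝ) by abel, h.per hp]

lemma K4_add {u : A0} {f : (ι → A0) → Zsp ι → Λ} {g : ι → ι → ℕ → Zsp ι → Λ} (h : CD u f g) (hp : Per f) (r : ℝ) (a b : ι → A0) (x) :
    K4 ν h.mf r (a + b) x = K4 ν h.mf r a (K4 ν h.mf r b x) := by
  refine koop_mul _ _ _ _ ?_ x
  rintro ⟨⟨v, τ, c⟩, l⟩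
  have e1 : f (a + b) (sec τ + v, c) = f b (sec (τ + mkv (cv a)) + v, c) * f a (sec τ + v, c) := by
    rw [add_comm a b, h.R1, sec_f h hp]
  have e2 : f (a + b) (sec τ, c) = f b (sec (τ + mkv (cv a)), c) * f a (sec τ, c) := by
    have := sec_f h hp b τ (cv a) 0 c
    rw [add_zero, add_zero] at this
    rw [add_comm a b, h.R1, this]
  rw [T4_apply, T4_apply, T4_apply, e1, e2, cv_add, mkv_add, add_assoc]
  congr 1
  group

structure Pr (g : (ι → ℝ) → (ι → ℝ) → ℝ → Λ → ℝ) : Prop where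
  tri : ∀ x y y' c, g x y c 1 + g x y' c 1 - 1 ≤ g y y' c 1
  two : ∀ x y c l, l ≠ 1 → g x y c 1 + g x y c l ≤ 1

def CC (Λ : Type) [Group Λ] [MeasurableSpace Λ] (r : ℝ) : Set (HT ι Λ ν r) :=
  {h : Lp ℝ 2 ((mu4 ι ν r).prod (Measure.count : Measure Λ)) | ∃ g, Pr g ∧ ∀ᵐ y ∂((mu4 ι ν r).prod (Measure.count : Measure Λ)),
    h y = g (sec y.1.2.1) (sec y.1.2.1 + y.1.1) y.1.2.2 y.2}

lemma CC_convex (r : ℝ) : Convex ℝ (CC (ι := ι) ν Λ r) := by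
  rintro h1 ⟨g1, p1, e1⟩ h2 ⟨g2, p2, e2⟩ a b ha hb hab
  refine ⟨fun x y c l => a * g1 x y c l + b * g2 x y c l, ⟨fun x y y' c => ?_, fun x y c l hl => ?_⟩, ?_⟩
  · have q1 := mul_le_mul_of_nonneg_left (p1.tri x y y' c) ha
    have q2 := mul_le_mul_of_nonneg_left (p2.tri x y y' c) hb
    nlinarith
  · have q1 := mul_le_mul_of_nonneg_left (p1.two x y c l hl) ha
    have q2 := mul_le_mul_of_nonneg_left (p2.two x y c l hl) hb
    nlinarith
  · have := Lp.coeFn_add (p := 2) (μ := (mu4 ι ν r).prod (Measure.count : Measure Λ)) (E := ℝ) (a • (show Lp ℝ 2 _ from h1)) (b • (show Lp ℝ 2 _ from h2))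
    filter_upwards [e1, e2, this, Lp.coeFn_smul (p := 2) (μ := (mu4 ι ν r).prod (Measure.count : Measure Λ)) (E := ℝ) a (show Lp ℝ 2 _ from h1),
      Lp.coeFn_smul (p := 2) (μ := (mu4 ι ν r).prod (Measure.count : Measure Λ)) (E := ℝ) b (show Lp ℝ 2 _ from h2)] with y q1 q2 q3 q4 q5
    refine q3.trans ?_
    rw [Pi.add_apply, q4, q5, Pi.smul_apply, Pi.smul_apply]
    erw [q1, q2]
    rfl

noncomputable def xi4 (r : ℝ) : HT ι Λ ν r := xi (μ := mu4 ι ν r) ℝ Λ MeasurableSet.univ (measure_ne_top _ _)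

lemma xi4_ae (r : ℝ) : ∀ᵐ y ∂((mu4 ι ν r).prod (Measure.count : Measure Λ)),
    (show Lp ℝ 2 ((mu4 ι ν r).prod (Measure.count : Measure Λ)) from xi4 ν r) y = Set.indicator {y | y.2 = 1} (fun _ => (1:ℝ)) y := by
  filter_upwards [indicatorConstLp_coeFn (p := 2) (hs := MeasurableSet.univ.prod (measurableSet_singleton (1:Λ)))
    (hμs := prod_one_ne (μ := mu4 ι ν r) (Λ := Λ) (measure_ne_top (mu4 ι ν r) Set.univ)) (c := (1:ℝ))] with y hy
  refine hy.trans ?_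
  obtain ⟨x, l⟩ := y
  by_cases hl : l = 1
  · subst hl; simp
  · rw [Set.indicator_of_notMem (by simp [hl]), Set.indicator_of_notMem (by simp [hl])]

lemma CC_mem {u : A0} {f : (ι → A0) → Zsp ι → Λ} {g : ι → ι → ℕ → Zsp ι → Λ} (h : CD u f g) (r : ℝ) (b : ι → A0) :
    K4 ν h.mf r b (xi4 ν r) ∈ CC (ι := ι) ν Λ r := by
  classical
  refine ⟨fun x y c l => if f b (y, c) * l = f b (x, c) then 1 else 0, ⟨fun x y y' c => ?_, fun x y c l hl => ?_⟩, ?_⟩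
  · simp only [mul_one]
    by_cases h1 : f b (y, c) = f b (x, c) <;> by_cases h2 : f b (y', c) = f b (x, c) <;> simp [h1, h2]
    all_goals split_ifs <;> norm_num
  · simp only [mul_one]
    by_cases h1 : f b (y, c) = f b (x, c)
    · have : ¬ (f b (y, c) * l = f b (x, c)) := by rw [h1]; simpa using hl
      simp [h1, hl]
    · simp only [h1, if_false, zero_add]; split_ifs <;> norm_num
  · have h1 := Lp.coeFn_compMeasurePreserving (p := 2) (show Lp ℝ 2 ((mu4 ι ν r).prod (Measure.count : Measure Λ)) from xi4 ν r) (T4_mp ν h.mf r b)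
    filter_upwards [h1, (T4_mp ν h.mf r b).quasiMeasurePreserving.ae (xi4_ae ν r)] with y q1 q2
    obtain ⟨⟨v, τ, c⟩, l⟩ := y
    refine q1.trans (q2.trans ?_)
    rw [T4_apply]
    simp [Set.indicator, mul_inv_eq_one]

lemma K4_xi {u : A0} {f : (ι → A0) → Zsp ι → Λ} {g : ι → ι → ℕ → Zsp ι → Λ} (h : CD u f g) (r : ℝ) (b : ι → A0) :
    ‖K4 ν h.mf r b (xi4 ν r) - xi4 ν r‖ ^ 2 =
      2 * (mu3 ι ν).real {x | x.1 ∈ box ι r ∧ x.2.1 ∈ unitc ι ∧ f b (x.2.1 + x.1, x.2.2) ≠ f b x.2} := by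
  have h1 := tw_xi (μ := mu4 ι ν r) ℝ _ (fR_mp ν r (cv b)) _ _ (meas_p4 (h.mf b)) (meas_q4 (h.mf b)) MeasurableSet.univ (measure_ne_top _ _)
  refine h1.trans ?_
  congr 1
  have hmp : MeasurePreserving (Prod.map id (Prod.map mkv id)) ((volume.restrict (box ι r)).prod ((volume.restrict (unitc ι)).prod ν)) (mu4 ι ν r) :=
    (MeasurePreserving.id _).prod (mkv_mp.prod (MeasurePreserving.id _))
  have hms : MeasurableSet {x : (ι → ℝ) × (Tor ι × ℝ) | x ∈ Set.univ ∧ (fR (cv b) x ∉ Set.univ ∨ f b (sec x.2.1 + x.1, x.2.2) ≠ f b (sec x.2.1, x.2.2))} := by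
    simp only [Set.mem_univ, true_and, not_true, false_or]
    exact (measurableSet_eq_fun (meas_p4 (h.mf b)) (meas_q4 (h.mf b))).compl
  rw [← hmp.measureReal_preimage hms.nullMeasurableSet]
  have e : (volume.restrict (box ι r)).prod ((volume.restrict (unitc ι)).prod ν) = (mu3 ι ν).restrict (box ι r ×ˢ (unitc ι ×ˢ Set.univ)) := by
    rw [mu3, muZ, ← Measure.prod_restrict, ← Measure.prod_restrict, Measure.restrict_univ]
  rw [e, measureReal_restrict_apply' ((box_meas r).prod (unitc_meas.prod MeasurableSet.univ))]
  congr 1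
  ext ⟨v, z, c⟩
  simp only [Set.mem_inter_iff, Set.mem_preimage, Set.mem_univ, true_and, not_true, false_or, Prod.map, id, Set.mem_prod, and_true, Set.mem_ofPred_eq]
  constructor
  · rintro ⟨q1, q2, q3⟩; rw [sec_mkv q3] at q1; exact ⟨q2, q3, q1⟩
  · rintro ⟨q2, q3, q1⟩; rw [sec_mkv q3]; exact ⟨q1, q2, q3⟩
end Z
end OESuperrigidity

namespace OESuperrigidity
open Filter Topology

lemma ae_count {X L : Type} [MeasurableSpace X] [MeasurableSpace L] [Countable L] [MeasurableSingletonClass L] {μ : Measure X} [SFinite μ] {P : X × L → Prop}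
    (h : ∀ᵐ y ∂μ.prod (Measure.count : Measure L), P y) (l : L) : ∀ᵐ x ∂μ, P (x, l) := by
  have h2 : ∀ᵐ y ∂(Measure.count : Measure L).prod μ, P y.swap := by
    exact (Measure.measurePreserving_swap (μ := (Measure.count : Measure L)) (ν := μ)).quasiMeasurePreserving.ae h
  have h3 := Measure.ae_ae_of_ae_prod h2
  rw [ae_iff, Measure.count_eq_zero_iff] at h3
  by_contra hc
  exact (Set.eq_empty_iff_forall_notMem.1 h3 l) hc

section Z
variable {ι : Type} [Fintype ι] [DecidableEq ι]
  {Λ : Type} [Group Λ] [Countable Λ] [MeasurableSpace Λ] [DiscreteMeasurableSpace Λ] {A0 : Subring ℝ}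
  (ν : Measure ℝ) [IsFiniteMeasure ν]

def reg (ι : Type) (r : ℝ) : Set ((ι → ℝ) × Zsp ι) := {p | p.2.1 - p.1 ∈ box ι r ∧ p.1 ∈ unitc ι}

def tm (p : (ι → ℝ) × Zsp ι) : (ι → ℝ) × (Tor ι × ℝ) := (p.2.1 - p.1, (mkv p.1, p.2.2))

lemma tm_meas : Measurable (tm : (ι → ℝ) × Zsp ι → _) := by
  have := (mkv_meas (ι := ι)).comp (measurable_fst : Measurable fun p : (ι → ℝ) × Zsp ι => p.1)
  unfold tm Zsp
  exact ((measurable_fst.comp measurable_snd).sub measurable_fst).prodMk (this.prodMk (measurable_snd.comp measurable_snd))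

lemma reg_meas (r : ℝ) : MeasurableSet (reg ι r) := by
  have h : Measurable fun p : (ι → ℝ) × Zsp ι => p.2.1 - p.1 := by unfold Zsp; fun_prop
  exact (h (box_meas r)).inter (measurable_fst unitc_meas)

lemma tm_mp (r : ℝ) : MeasurePreserving tm ((mu3 ι ν).restrict (reg ι r)) (mu4 ι ν r) := by
  have h1 : MeasurePreserving (fun p : (ι → ℝ) × Zsp ι => (p.2.1 - p.1, (p.1, p.2.2))) (mu3 ι ν) (mu3 ι ν) := by
    have a1 := (measurePreserving_prodAssoc (volume : Measure (ι → ℝ)) (volume : Measure (ι → ℝ)) ν).symm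
    have a2 : MeasurePreserving (fun z : (ι → ℝ) × (ι → ℝ) => (z.2 - z.1, z.1)) (volume.prod volume) (volume.prod volume) :=
      (measurePreserving_sub_prod volume volume).comp Measure.measurePreserving_swap
    exact ((measurePreserving_prodAssoc (volume : Measure (ι → ℝ)) (volume : Measure (ι → ℝ)) ν).comp (a2.prod (MeasurePreserving.id ν))).comp a1
  have h2 := h1.restrict_preimage ((box_meas (ι := ι) r).prod ((unitc_meas (ι := ι)).prod (MeasurableSet.univ (α := ℝ))))
  have e : (mu3 ι ν).restrict (box ι r ×ˢ (unitc ι ×ˢ Set.univ)) = (volume.restrict (box ι r)).prod ((volume.restrict (unitc ι)).prod ν) := by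
    rw [mu3, muZ, ← Measure.prod_restrict, ← Measure.prod_restrict, Measure.restrict_univ]
  rw [e] at h2
  have hmp : MeasurePreserving (Prod.map id (Prod.map mkv id)) ((volume.restrict (box ι r)).prod ((volume.restrict (unitc ι)).prod ν)) (mu4 ι ν r) :=
    (MeasurePreserving.id _).prod (mkv_mp.prod (MeasurePreserving.id _))
  have h3 := hmp.comp h2
  have e2 : (fun p : (ι → ℝ) × Zsp ι => (p.2.1 - p.1, (p.1, p.2.2))) ⁻¹' (box ι r ×ˢ (unitc ι ×ˢ (Set.univ : Set ℝ))) = reg ι r := by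
    ext ⟨x, y, c⟩; simp [reg]
  rw [e2] at h3
  exact h3

lemma tr {r : ℝ} {P : (ι → ℝ) × (Tor ι × ℝ) → Prop} (h : ∀ᵐ x ∂mu4 ι ν r, P x) : ∀ᵐ p ∂mu3 ι ν, p ∈ reg ι r → P (tm p) :=
  (ae_restrict_iff' (reg_meas r)).1 ((tm_mp ν r).quasiMeasurePreserving.ae h)

lemma lemZ [Nontrivial ι] {u : ℝ} {c : ℕ → ℤ} {d : ℕ} (hu : UData u A0 c d) {f : (ι → A0) → Zsp ι → Λ} {g : ι → ι → ℕ → Zsp ι → Λ}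
    (h : CD ⟨u, hu.mem⟩ f g) (hp : Per f) (ε : ℝ) (hε : 0 < ε) (ρ : ℝ) (hρ : 0 < ρ) :
    ∃ r, 0 < r ∧ r < ρ ∧ ∃ Z : (ι → ℝ) × Zsp ι → Λ → ℝ, (∀ l, Measurable fun p => Z p l) ∧
      (∃ gn : ℕ → (ι → ℝ) → (ι → ℝ) → ℝ → Λ → ℝ, (∀ n, Pr (gn n)) ∧
        ∀ᵐ p ∂mu3 ι ν, p ∈ reg ι r → ∀ l, Tendsto (fun n => gn n p.1 p.2.1 p.2.2 l) atTop (𝓝 (Z p l))) ∧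
      (∀ b, ∀ᵐ p ∂mu3 ι ν, p ∈ reg ι r → ∀ l, Z (p.1 + cv b, (p.2.1 + cv b, p.2.2)) (f b p.2 * l * (f b (p.1, p.2.2))⁻¹) = Z p l) ∧
      mu3 ι ν {p | p ∈ reg ι r ∧ Z p 1 ≤ 3 / 4} ≤ ENNReal.ofReal (ε * (volume.real (box ι r) * ν.real Set.univ)) := by
  obtain ⟨r, hr0, hr1, hr⟩ := est ν hu h hp (ε / 32) (by positivity) ρ hρ
  set V := volume.real (box ι r) * ν.real Set.univ
  have hV : 0 ≤ V := by positivity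
  have hκ0 : 0 ≤ ε / 16 * V := by positivity
  obtain ⟨ζ, hζ, hinv, hnorm⟩ := fixedpt (K4 ν h.mf r) (K4_add ν h hp r) (xi4 ν r) (Real.sqrt (ε / 16 * V)) fun b => by
    refine le_of_sq (Real.sqrt_nonneg _) ?_
    rw [K4_xi ν h, Real.sq_sqrt hκ0]
    linarith [hr b]
  refine ⟨r, hr0, hr1, ?_⟩
  let ζ' : Lp ℝ 2 ((mu4 ι ν r).prod (Measure.count : Measure Λ)) := ζ
  let ξ' : Lp ℝ 2 ((mu4 ι ν r).prod (Measure.count : Measure Λ)) := xi4 ν r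
  have hζm : Measurable ζ' := (Lp.stronglyMeasurable ζ').measurable
  refine ⟨fun p l => ζ' (tm p, l), fun l => hζm.comp (tm_meas.prodMk measurable_const), ?_, ?_, ?_⟩
  · have hsub : closure (convexHull ℝ (Set.range fun b => K4 ν h.mf r b (xi4 ν r))) ⊆ closure (CC (ι := ι) ν Λ r) :=
      closure_mono (convexHull_min (by rintro _ ⟨b, rfl⟩; exact CC_mem ν h r b) (CC_convex ν r))
    obtain ⟨s, hs1, hs2⟩ := mem_closure_iff_seq_limit.1 (hsub hζ)
    let s' : ℕ → Lp ℝ 2 ((mu4 ι ν r).prod (Measure.count : Measure Λ)) := s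
    have hs3 : Tendsto s' atTop (𝓝 ζ') := hs2
    obtain ⟨ns, -, hns⟩ := (tendstoInMeasure_of_tendsto_Lp hs3).exists_seq_tendsto_ae
    choose gn hg1 hg2 using hs1
    refine ⟨fun n => gn (ns n), fun n => hg1 _, ?_⟩
    have : ∀ᵐ y ∂((mu4 ι ν r).prod (Measure.count : Measure Λ)), Tendsto (fun n => gn (ns n) (sec y.1.2.1) (sec y.1.2.1 + y.1.1) y.1.2.2 y.2) atTop (𝓝 (ζ' y)) := by
      filter_upwards [hns, ae_all_iff.2 fun n => hg2 n] with y h1 h2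
      refine h1.congr fun n => ?_
      exact h2 (ns n)
    have := tr ν (ae_all_iff.2 fun l => ae_count this l)
    filter_upwards [this] with p hp1 hp2 l
    have := hp1 hp2 l
    simp only [tm, sec_mkv hp2.2, add_sub_cancel] at this ⊢
    exact this
  · intro b
    have h1 := Lp.coeFn_compMeasurePreserving (p := 2) ζ' (T4_mp ν h.mf r b)
    have h2 : Lp.compMeasurePreserving (T4 h.mf b) (T4_mp ν h.mf r b) ζ' = ζ' := hinv b
    rw [h2] at h1
    have := tr ν (ae_all_iff.2 fun l => ae_count h1 l)
    filter_upwards [this] with p hp1 hp2 l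
    have := hp1 hp2 l
    obtain ⟨x, y, c⟩ := p
    simp only [tm, Function.comp, T4_apply, sec_mkv hp2.2, add_sub_cancel] at this ⊢
    rw [this, mkv_add, add_sub_add_right_eq_sub]
  · have h1 := Lp.mul_meas_ge_le_pow_enorm' (ζ' - ξ') (by norm_num) (by norm_num) (1/4)
    have hn : ‖ζ' - ξ'‖ ≤ Real.sqrt (ε / 16 * V) := hnorm
    set N : Set ((ι → ℝ) × (Tor ι × ℝ)) := {x | ζ' (x, 1) ≤ 3 / 4}
    have hN : MeasurableSet N := (hζm.comp (measurable_id.prodMk measurable_const)) measurableSet_Iic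
    have e1 : mu3 ι ν {p | p ∈ reg ι r ∧ ζ' (tm p, 1) ≤ 3 / 4} = mu4 ι ν r N := by
      rw [← (tm_mp ν r).measure_preimage hN.nullMeasurableSet, Measure.restrict_apply (tm_meas hN)]
      congr 1; ext p; simp [N, and_comm]
    refine e1.le.trans ?_
    have e2 : mu4 ι ν r N = ((mu4 ι ν r).prod Measure.count) (N ×ˢ {(1:Λ)}) := by rw [Measure.prod_prod]; simp
    have e3 : ((mu4 ι ν r).prod Measure.count) (N ×ˢ {(1:Λ)}) ≤ ((mu4 ι ν r).prod Measure.count) {x | (1/4 : ENNReal) ≤ ‖(ζ' - ξ') x‖₊} := by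
      refine measure_mono_ae ?_
      filter_upwards [Lp.coeFn_sub ζ' ξ', xi4_ae (ι := ι) (Λ := Λ) ν r] with y q1 q2 hy
      change (1/4 : ENNReal) ≤ ‖(ζ' - ξ') y‖₊
      obtain ⟨x, l⟩ := y
      obtain ⟨q3, rfl⟩ := hy
      rw [q1, Pi.sub_apply]
      have q2' : ξ' (x, 1) = 1 := by simpa using q2
      rw [q2']
      have q4 : ζ' (x, 1) ≤ 3 / 4 := q3
      have : (1/4 : ENNReal) = ENNReal.ofReal (1/4) := by rw [ENNReal.ofReal_div_of_pos (by norm_num)]; simp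
      rw [this, ← enorm_eq_nnnorm, ← ofReal_norm]
      refine ENNReal.ofReal_le_ofReal ?_
      rw [Real.norm_eq_abs, abs_of_nonpos (by linarith)]; linarith
    rw [e2]
    refine e3.trans ?_
    have h2 : ENNReal.ofReal ‖ζ' - ξ'‖ ^ (2 : ENNReal).toReal ≤ ENNReal.ofReal (ε / 16 * V) := by
      have := ENNReal.ofReal_le_ofReal hn
      calc _ ≤ ENNReal.ofReal (Real.sqrt (ε / 16 * V)) ^ (2 : ENNReal).toReal := by gcongr
        _ = _ := by
          rw [ENNReal.ofReal_rpow_of_nonneg (Real.sqrt_nonneg _) (by norm_num)]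
          congr 1
          have : ((2:ENNReal).toReal) = ((2:ℕ):ℝ) := by norm_num
          rw [this, Real.rpow_natCast, Real.sq_sqrt hκ0]
    have h3 := h1.trans h2
    have e5 : ((1/4 : ENNReal) ^ (2 : ENNReal).toReal) = ENNReal.ofReal (1/16) := by
      have : (1/4 : ENNReal) = ENNReal.ofReal (1/4) := by rw [ENNReal.ofReal_div_of_pos (by norm_num)]; simp
      rw [this, ENNReal.ofReal_rpow_of_nonneg (by norm_num) (by norm_num)]
      congr 1
      have : ((2:ENNReal).toReal) = ((2:ℕ):ℝ) := by norm_num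
      rw [this, Real.rpow_natCast]; norm_num
    rw [e5] at h3
    have h4 : ENNReal.ofReal (ε * V) = ENNReal.ofReal 16 * ENNReal.ofReal (ε / 16 * V) := by
      rw [← ENNReal.ofReal_mul (by norm_num)]; congr 1; ring
    rw [h4]
    refine le_trans (le_of_eq ?_) (mul_le_mul_right h3 (ENNReal.ofReal 16))
    rw [← mul_assoc, ← ENNReal.ofReal_mul (by norm_num)]; norm_num
end Z
end OESuperrigidity

namespace OESuperrigidity
open Filter Topology

section P
variable {ι : Type} [Fintype ι] [DecidableEq ι]
  {Λ : Type} [Group Λ] [Countable Λ] [MeasurableSpace Λ] [DiscreteMeasurableSpace Λ] {A0 : Subring ℝ}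
  (ν : Measure ℝ) [IsFiniteMeasure ν]

lemma perm1 {P : (ι → ℝ) × Zsp ι → Prop} (h : ∀ᵐ p ∂mu3 ι ν, P p) : ∀ᵐ c ∂ν, ∀ᵐ x : ι → ℝ, ∀ᵐ y : ι → ℝ, P (x, (y, c)) := by
  have a1 : MeasurePreserving (fun q : ℝ × ((ι → ℝ) × (ι → ℝ)) => (q.2.1, (q.2.2, q.1))) (ν.prod (volume.prod volume)) (mu3 ι ν) :=
    (measurePreserving_prodAssoc (volume : Measure (ι → ℝ)) (volume : Measure (ι → ℝ)) ν).comp Measure.measurePreserving_swap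
  have := Measure.ae_ae_of_ae_prod (a1.quasiMeasurePreserving.ae h)
  filter_upwards [this] with c hc
  exact Measure.ae_ae_of_ae_prod hc

lemma perm2 {P : (ι → ℝ) × Zsp ι → Prop} (h : ∀ᵐ p ∂mu3 ι ν, P p) : ∀ᵐ x : ι → ℝ, ∀ᵐ c ∂ν, ∀ᵐ y : ι → ℝ, P (x, (y, c)) := by
  filter_upwards [Measure.ae_ae_of_ae_prod h] with x hx
  exact Measure.ae_ae_of_ae_prod (Measure.measurePreserving_swap (μ := ν) (ν := (volume : Measure (ι → ℝ))).quasiMeasurePreserving.ae hx)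

lemma shift2 {P : (ι → ℝ) → (ι → ℝ) → Prop} (h : ∀ᵐ x : ι → ℝ, ∀ᵐ y : ι → ℝ, P x y) (w : ι → ℝ) :
    ∀ᵐ x : ι → ℝ, ∀ᵐ y : ι → ℝ, P (x + w) (y + w) := by
  have q := (measurePreserving_add_right (volume : Measure (ι → ℝ)) w).quasiMeasurePreserving
  filter_upwards [q.ae h] with x hx
  exact q.ae hx

lemma lemP [Nontrivial ι] {u : ℝ} {c : ℕ → ℤ} {d : ℕ} (hu : UData u A0 c d) {f : (ι → A0) → Zsp ι → Λ} {g : ι → ι → ℕ → Zsp ι → Λ}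
    (h : CD ⟨u, hu.mem⟩ f g) (hp : Per f) (η : ℝ) (hη : 0 < η) :
    ∃ E : Set (Zsp ι), MeasurableSet E ∧ (∀ p ∈ E, p.1 ∈ unitc ι) ∧
      (∀ b, ∀ᵐ c ∂ν, ∀ᵐ z1 : ι → ℝ, ∀ᵐ z2 : ι → ℝ, (z1, c) ∈ E → (z2, c) ∈ E → (z1 + cv b, c) ∈ E → (z2 + cv b, c) ∈ E → f b (z1, c) = f b (z2, c)) ∧
      ν {c | volume {z | (z, c) ∈ E} = 0} ≤ ENNReal.ofReal η := by
  set m := Fintype.card ι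
  obtain ⟨r, hr0, hr1, Z, hZm, ⟨gn, hgn, hlim⟩, hinv, hbad⟩ := lemZ ν hu h hp (η / (2 * (4 ^ m * (ν.real Set.univ + 1)))) (by positivity) (1/4) (by norm_num)
  set Q0 : Set (ι → ℝ) := (fun q => q - fun _ => 1/2) ⁻¹' box ι (1/4)
  have hQ0m : MeasurableSet Q0 := (show Measurable fun q : ι → ℝ => q - fun _ => 1/2 by fun_prop) (box_meas _)
  have hQ0v : volume Q0 = volume (box ι (1/4)) := (measurePreserving_sub_right volume (fun _ : ι => (1/2:ℝ))).measure_preimage (box_meas _).nullMeasurableSet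
  have hQ0 : ∀ q ∈ Q0, ∀ i, 1/4 < q i ∧ q i ≤ 3/4 := by
    intro q hq i
    have := mem_box.1 hq i
    simp only [Pi.sub_apply] at this
    constructor <;> linarith
  have hregQ : ∀ q ∈ Q0, ∀ z c, z - q ∈ box ι (r/2) → (q, (z, c)) ∈ reg ι r := by
    intro q hq z c hz
    refine ⟨mem_box.2 fun i => ?_, fun i _ => ?_⟩
    · have := mem_box.1 hz i; constructor <;> linarith
    · have := hQ0 q hq i; constructor <;> linarith
  have hsl : ∀ q : ι → ℝ, MeasurableSet {p : Zsp ι | p.1 - q ∈ box ι (r/2)} := fun q =>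
    (show Measurable fun p : Zsp ι => p.1 - q by fun_prop) (box_meas _)
  have hZq : ∀ q : ι → ℝ, Measurable fun p : Zsp ι => Z (q, p) 1 := fun q => (hZm 1).comp (measurable_const.prodMk measurable_id)
  let s : (ι → ℝ) → Set (Zsp ι) := fun q => {p | p.1 - q ∈ box ι (r/2) ∧ Z (q, p) 1 ≤ 3/4}
  have hsm : ∀ q, MeasurableSet (s q) := fun q => (hsl q).inter (hZq q measurableSet_Iic)
  set K : ENNReal := ENNReal.ofReal η * volume (box ι (r/2))
  -- good q
  have hgood : ¬ ∀ᵐ q ∂(volume.restrict Q0), K < muZ ι ν (s q) := by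
    intro hc
    set S : Set ((ι → ℝ) × Zsp ι) := {p | p.1 ∈ Q0 ∧ p.2 ∈ s p.1}
    have hSm : MeasurableSet S := by
      have h1 : Measurable fun p : (ι → ℝ) × Zsp ι => p.2.1 - p.1 := by unfold Zsp; fun_prop
      exact (measurable_fst hQ0m).inter ((h1 (box_meas _)).inter (hZm 1 measurableSet_Iic))
    have h1 : mu3 ι ν S ≤ ENNReal.ofReal (η / (2 * (4 ^ m * (ν.real Set.univ + 1))) * (volume.real (box ι r) * ν.real Set.univ)) := by
      refine (measure_mono ?_).trans hbad
      rintro ⟨q, z, c⟩ ⟨q1, q2, q3⟩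
      exact ⟨hregQ q q1 z c q2, q3⟩
    have h2 : K * volume Q0 ≤ mu3 ι ν S := by
      rw [mu3, Measure.prod_apply hSm, ← setLIntegral_const]
      calc _ ≤ ∫⁻ q in Q0, muZ ι ν (s q) := lintegral_mono_ae (hc.mono fun q hq => hq.le)
        _ = ∫⁻ q in Q0, muZ ι ν (Prod.mk q ⁻¹' S) := by
          refine setLIntegral_congr_fun hQ0m fun q hq => ?_
          congr 1
          ext p; simp [S, hq]
        _ ≤ _ := setLIntegral_le_lintegral _ _
    have h3 := h2.trans h1
    have h4 : K * volume Q0 = ENNReal.ofReal (η * (2 * (r/2)) ^ m * (2 * (1/4)) ^ m) := by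
      rw [hQ0v, ENNReal.ofReal_mul (p := η * _) (by positivity), ENNReal.ofReal_mul hη.le, ENNReal.ofReal_pow (by positivity), ENNReal.ofReal_pow (by positivity),
        ← box_vol, ← box_vol]
    rw [h4, ENNReal.ofReal_le_ofReal_iff (by positivity)] at h3
    have h5 : volume.real (box ι r) = (2 * r) ^ m := by
      rw [measureReal_def, box_vol, ← ENNReal.ofReal_pow (by positivity), ENNReal.toReal_ofReal (by positivity)]
    rw [h5] at h3
    have hn : 0 ≤ ν.real Set.univ := measureReal_nonneg
    set N := ν.real Set.univ
    have h6 : η / (2 * (4 ^ m * (N + 1))) * ((2 * r) ^ m * N) = (η * (2 * (r/2)) ^ m * (2 * (1/4)) ^ m) * (N / (2 * (N + 1))) := by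
      have : (4:ℝ) ^ m = 2 ^ m * 2 ^ m := by rw [← mul_pow]; norm_num
      rw [show (2:ℝ) * (r/2) = r by ring, show (2:ℝ) * (1/4) = 2⁻¹ by norm_num, mul_pow, this, inv_pow]
      field_simp
    rw [h6] at h3
    have h7 : N / (2 * (N + 1)) < 1 := by rw [div_lt_one (by positivity)]; linarith
    have h8 : 0 < η * (2 * (r/2)) ^ m * (2 * (1/4)) ^ m := by positivity
    nlinarith
  have hfreq : ∃ q, q ∈ Q0 ∧ muZ ι ν (s q) ≤ K ∧ (∀ᵐ c ∂ν, ∀ᵐ z : ι → ℝ, (q, (z, c)) ∈ reg ι r → ∀ l, Tendsto (fun n => gn n q z c l) atTop (𝓝 (Z (q, (z, c)) l))) := by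
    by_contra hc
    refine hgood ((ae_restrict_iff' hQ0m).2 ?_)
    filter_upwards [perm2 ν hlim] with q hq hq0
    by_contra h1
    exact hc ⟨q, hq0, not_lt.1 h1, hq⟩
  obtain ⟨q, hq, hK, hq1⟩ := hfreq
  have hEm : MeasurableSet {p : Zsp ι | p.1 - q ∈ box ι (r/2) ∧ 3/4 < Z (q, p) 1} := (hsl q).inter (hZq q measurableSet_Ioi)
  refine ⟨{p | p.1 - q ∈ box ι (r/2) ∧ 3/4 < Z (q, p) 1}, hEm, ?_, ?_, ?_⟩
  · rintro ⟨z, c⟩ ⟨hz, -⟩ i -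
    have h1 := mem_box.1 hz i
    have h2 := hQ0 q hq i
    simp only [Pi.sub_apply] at h1
    constructor <;> simp only <;> linarith
  · intro b
    filter_upwards [hq1, perm1 ν hlim, perm1 ν (hinv b)] with c h1 h2 h3
    have h5 := (measurePreserving_add_right (volume : Measure (ι → ℝ)) (cv b)).quasiMeasurePreserving.ae h1
    filter_upwards [h1, h2, h3, shift2 h2 (cv b), h5] with z1 k1 k2 k3 k4 k5
    filter_upwards [h1, k2, k3, k4, h5] with z2 l1 l2 l3 l4 l5 m1 m2 m3 m4
    have hreg : ∀ w1 w2, w1 - q ∈ box ι (r/2) → w2 - q ∈ box ι (r/2) → (w1, (w2, c)) ∈ reg ι r := by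
      intro w1 w2 e1 e2
      refine ⟨mem_box.2 fun i => ?_, fun i _ => ?_⟩
      all_goals
        have a1 := mem_box.1 e1 i
        have a2 := mem_box.1 e2 i
        have a3 := hQ0 q hq i
        simp only [Pi.sub_apply] at a1 a2 ⊢
        constructor <;> linarith
    have t1 := k1 (hregQ q hq _ _ m1.1) 1
    have t2 := l1 (hregQ q hq _ _ m2.1) 1
    have t3 := l2 (hreg _ _ m1.1 m2.1) 1
    have t4 := l4 (hreg _ _ m3.1 m4.1)
    have t5 := l3 (hreg _ _ m1.1 m2.1) 1
    have t6 := k5 (hregQ q hq _ _ m3.1) 1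
    have t7 := l5 (hregQ q hq _ _ m4.1) 1
    by_contra hne
    have i1 := le_of_tendsto_of_tendsto' ((t1.add t2).sub_const 1) t3 fun n => (hgn n).tri q z1 z2 c
    have i2 := le_of_tendsto' ((t4 1).add (t4 (f b (z2, c) * 1 * (f b (z1, c))⁻¹))) fun n => (hgn n).two _ _ _ _ (by
      rw [mul_one]; intro e; exact hne (mul_inv_eq_one.1 e).symm)
    have i6 := le_of_tendsto_of_tendsto' ((t6.add t7).sub_const 1) (t4 1) fun n => (hgn n).tri q (z1 + cv b) (z2 + cv b) c
    have i3 := m1.2; have i4 := m2.2; have i7 := m3.2; have i8 := m4.2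
    beta_reduce at i2
    rw [t5] at i2
    linarith
  · have hV0 : volume (box ι (r/2)) ≠ 0 := fun e => by
      have := box_pos (ι := ι) (half_pos hr0); rw [measureReal_def, e] at this; simp at this
    rw [← ENNReal.mul_le_mul_iff_left hV0 (box_ne_top _)]
    refine le_trans ?_ hK
    rw [muZ, Measure.prod_apply_symm (hsm q), mul_comm]
    refine le_trans ?_ (mul_meas_ge_le_lintegral (measurable_measure_prodMk_right (hsm q)) (volume (box ι (r/2))))
    refine mul_le_mul_right (measure_mono ?_) _
    intro c hc
    change volume (box ι (r/2)) ≤ volume _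
    have e1 : volume (box ι (r/2)) = volume ((fun z : ι → ℝ => z - q) ⁻¹' box ι (r/2)) :=
      ((measurePreserving_sub_right volume q).measure_preimage (box_meas _).nullMeasurableSet).symm
    rw [e1]
    refine (measure_mono (t := {z | (z, c) ∈ {p : Zsp ι | p.1 - q ∈ box ι (r/2) ∧ 3/4 < Z (q, p) 1}} ∪ (fun x => (x, c)) ⁻¹' s q) ?_).trans ((measure_union_le _ _).trans ?_)
    · intro z hz
      by_cases hzz : 3/4 < Z (q, (z, c)) 1
      · exact Or.inl ⟨hz, hzz⟩
      · exact Or.inr ⟨hz, not_lt.1 hzz⟩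
    · have : volume {z | (z, c) ∈ {p : Zsp ι | p.1 - q ∈ box ι (r/2) ∧ 3/4 < Z (q, p) 1}} = 0 := hc
      rw [this, zero_add]
end P
end OESuperrigidity

namespace OESuperrigidity
open Filter Topology

lemma sel {X L : Type*} [MeasurableSpace X] [MeasurableSpace L] [Countable L] [Nonempty L] (S : L → Set X) (hS : ∀ l, MeasurableSet (S l)) :
    ∃ g : X → L, Measurable g ∧ ∀ x, (∃ l, x ∈ S l) → x ∈ S (g x) := by
  classical
  obtain ⟨e, he⟩ := exists_surjective_nat L
  have hex : ∀ x, ∃ n, x ∈ S (e n) ∨ ∀ l, x ∉ S l := by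
    intro x
    by_cases h : ∃ l, x ∈ S l
    · obtain ⟨l, hl⟩ := h
      obtain ⟨n, rfl⟩ := he l
      exact ⟨n, Or.inl hl⟩
    · push Not at h; exact ⟨0, Or.inr h⟩
  refine ⟨fun x => e (Nat.find (hex x)), ?_, fun x hx => ?_⟩
  · refine (measurable_from_nat (f := e)).comp (measurable_find hex fun n => ?_)
    have : {x | x ∈ S (e n) ∨ ∀ l, x ∉ S l} = S (e n) ∪ ⋂ l, (S l)ᶜ := by ext; simp
    rw [this]
    exact (hS _).union (MeasurableSet.iInter fun l => (hS l).compl)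
  · rcases Nat.find_spec (hex x) with h | h
    · exact h
    · obtain ⟨l, hl⟩ := hx; exact absurd hl (h l)

section T
variable {X : Type*} [TopologicalSpace X] [MeasurableSpace X] [BorelSpace X] [R1Space X]
  {μ : Measure X} [μ.InnerRegularCompactLTTop] [IsLocallyFiniteMeasure μ] [SigmaFinite μ]

lemma trick_set (T : ℝ → X → X) (hT : Continuous (Function.uncurry T)) (hmp : ∀ p, MeasurePreserving (T p) μ μ)
    (h0 : ∀ x, T 0 x = x) (hadd : ∀ s t x, T (s + t) x = T s (T t x)) (A : AddSubgroup ℝ) (hA : Dense (A : Set ℝ))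
    {S : Set X} (hS : MeasurableSet S) (hα : ∀ b ∈ A, ∀ᵐ x ∂μ, (T b x ∈ S ↔ x ∈ S)) (t : ℝ) : ∀ᵐ x ∂μ, (T t x ∈ S ↔ x ∈ S) := by
  classical
  letI : MeasurableSpace ℤˣ := ⊤
  have hf : Measurable fun x => if x ∈ S then (1 : ℤˣ) else -1 := Measurable.ite hS measurable_const measurable_const
  have := trick T hT hmp h0 hadd A hA hf (fun b hb => ⟨fun _ => 1, fun _ => 1, by simp, by simp, by
    filter_upwards [hα b hb] with x hx
    simp [hx]⟩) t
  filter_upwards [this] with x hx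
  by_cases h1 : T t x ∈ S <;> by_cases h2 : x ∈ S <;> simp [h1, h2] at hx ⊢
end T

section D
variable {ι : Type} [Fintype ι] [DecidableEq ι]

lemma cont_single (i : ι) : Continuous fun t : ℝ => (Pi.single i t : ι → ℝ) := continuous_single (A := fun _ : ι => ℝ) i

lemma all_of_indep {S : Set (ι → ℝ)} (hS : MeasurableSet S) (h : ∀ i, ∀ t : ℝ, ∀ᵐ x : ι → ℝ, (x + Pi.single i t ∈ S ↔ x ∈ S)) (h0 : volume S ≠ 0) : ∀ᵐ x, x ∈ S := by
  obtain ⟨c, hc⟩ := indep_const (f := fun x => x ∈ S) (measurableSet_setOf.1 hS) fun i t => by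
    filter_upwards [h i t] with x hx; exact propext hx
  by_cases hcc : c
  · filter_upwards [hc] with x hx; rw [hx]; exact hcc
  · exfalso; refine h0 (measure_eq_zero_iff_ae_notMem.2 ?_)
    filter_upwards [hc] with x hx; rw [hx]; exact hcc

lemma hit {A0 : Subring ℝ} [Countable A0] (hA : Dense (A0 : Set ℝ)) {P : Set (ι → ℝ)} (hP : MeasurableSet P) (h0 : volume P ≠ 0) :
    ∀ᵐ z : ι → ℝ, ∃ b : ι → A0, z + cv b ∈ P := by
  have hm : MeasurableSet {z : ι → ℝ | ∃ b : ι → A0, z + cv b ∈ P} := by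
    have : {z : ι → ℝ | ∃ b : ι → A0, z + cv b ∈ P} = ⋃ b : ι → A0, (fun z => z + cv b) ⁻¹' P := by ext; simp
    rw [this]
    exact MeasurableSet.iUnion fun b => (measurable_add_const (cv b)) hP
  refine all_of_indep hm (fun i => ?_) fun e => h0 (measure_mono_null (fun z hz => show ∃ b : ι → A0, z + cv b ∈ P from ⟨0, ?_⟩) e)
  · refine trick_set (μ := (volume : Measure (ι → ℝ))) (fun t z => z + Pi.single i t) ?_ (fun t => measurePreserving_add_right _ _) (by simp) (by intro s t x; rw [Pi.single_add]; abel)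
      A0.toAddSubgroup hA hm fun a ha => Eventually.of_forall fun z => ?_
    · exact continuous_snd.add ((cont_single i).comp continuous_fst)
    · have ha' : a ∈ A0 := ha
      constructor
      · rintro ⟨b, hb⟩; refine ⟨Pi.single i ⟨a, ha'⟩ + b, ?_⟩; rw [cv_add, cv_single, ← add_assoc]; exact hb
      · rintro ⟨b, hb⟩; refine ⟨b - Pi.single i ⟨a, ha'⟩, ?_⟩
        have : z + Pi.single i a + cv (b - Pi.single i ⟨a, ha'⟩) = z + cv b := by
          have e : cv b = cv (b - Pi.single i ⟨a, ha'⟩) + Pi.single i a := by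
            have e2 := cv_add (b - Pi.single i ⟨a, ha'⟩) (Pi.single i ⟨a, ha'⟩ : ι → A0)
            rw [sub_add_cancel, cv_single] at e2; exact e2
          rw [e]; abel
        rw [this]; exact hb
  · have : cv (0 : ι → A0) = 0 := by ext; simp [cv]
    simpa [this] using hz

def sm (A0 : Subring ℝ) (s : ℝ) (b : ι → A0) : Prop := ∀ i, |(b i : ℝ)| < s

lemma ext1 {A0 : Subring ℝ} {M : Type*} [CommGroup M] {s : ℝ} (t : A0) (ht : 0 < (t:ℝ)) (hts : 2 * (t:ℝ) < s) (D : A0 → M)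
    (hD : ∀ a b : A0, |(a:ℝ)| < s → |(b:ℝ)| < s → D (a + b) = D a * D b) :
    ∃ Δ : A0 → M, (∀ a b, Δ (a + b) = Δ a * Δ b) ∧ ∀ a : A0, |(a:ℝ)| < t → Δ a = D a := by
  let k : A0 → ℤ := fun a => ⌊(a:ℝ) / t⌋
  let r : A0 → A0 := fun a => a - k a * t
  have hr : ∀ a, 0 ≤ (r a : ℝ) ∧ (r a : ℝ) < t := by
    intro a
    have h1 := Int.floor_le ((a:ℝ) / t)
    have h2 := Int.lt_floor_add_one ((a:ℝ) / t)
    rw [le_div_iff₀ ht] at h1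
    rw [div_lt_iff₀ ht] at h2
    simp only [r, k, AddSubgroupClass.coe_sub, Subring.coe_mul, Subring.coe_intCast]
    constructor <;> linarith
  have huniq : ∀ (a : A0) (m : ℤ) (q : A0), a = m * t + q → 0 ≤ (q:ℝ) → (q:ℝ) < t → k a = m ∧ r a = q := by
    intro a m q e h0 h1
    have hk : k a = m := by
      simp only [k]
      rw [Int.floor_eq_iff, le_div_iff₀ ht, div_lt_iff₀ ht, e]
      simp only [Subring.coe_add, Subring.coe_mul, Subring.coe_intCast]
      constructor <;> linarith
    refine ⟨hk, ?_⟩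
    simp only [r]; rw [hk, e]; ring
  have hst : |(t:ℝ)| < s := by rw [abs_of_pos ht]; linarith
  have hsr : ∀ a, |(r a:ℝ)| < s := fun a => by rw [abs_of_nonneg (hr a).1]; linarith [(hr a).2]
  have ea : ∀ a, a = k a * t + r a := fun a => by simp only [r]; ring
  refine ⟨fun a => D t ^ k a * D (r a), fun a b => ?_, fun a ha => ?_⟩
  · have h1 := hD (r a) (r b) (hsr a) (hsr b)
    have hra := hr a; have hrb := hr b
    by_cases hlt : ((r a + r b : A0) : ℝ) < t
    · obtain ⟨e1, e2⟩ := huniq (a + b) (k a + k b) (r a + r b) (by nth_rw 1 [ea a, ea b]; push_cast; ring) (by push_cast; linarith) hlt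
      simp only [e1, e2, h1, zpow_add]
      exact mul_mul_mul_comm _ _ _ _
    · rw [not_lt] at hlt; push_cast at hlt
      obtain ⟨e1, e2⟩ := huniq (a + b) (k a + k b + 1) (r a + r b - t) (by nth_rw 1 [ea a, ea b]; push_cast; ring) (by push_cast; linarith) (by push_cast; linarith)
      have h2 := hD t (r a + r b - t) hst (by push_cast; rw [abs_of_nonneg (by linarith)]; linarith)
      rw [add_sub_cancel] at h2
      simp only [e1, e2, zpow_add, zpow_one]
      calc _ = D t ^ k a * D t ^ k b * (D t * D (r a + r b - t)) := by rw [mul_assoc]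
        _ = _ := by rw [← h2, h1]; exact mul_mul_mul_comm _ _ _ _
  · rw [abs_lt] at ha
    by_cases h0 : 0 ≤ (a:ℝ)
    · obtain ⟨e1, e2⟩ := huniq a 0 a (by simp) h0 ha.2
      simp [e1, e2]
    · obtain ⟨e1, e2⟩ := huniq a (-1) (a + t) (by push_cast; ring) (by push_cast; linarith) (by push_cast; linarith)
      have := hD a t (by rw [abs_lt]; constructor <;> linarith) hst
      simp only [e1, e2, this]
      simp

lemma ext2 {A0 : Subring ℝ} {M : Type*} [CommGroup M] {s : ℝ} (t : A0) (ht : 0 < (t:ℝ)) (hts : 2 * (t:ℝ) < s) (D : (ι → A0) → M)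
    (hD : ∀ a b, sm A0 s a → sm A0 s b → D (a + b) = D a * D b) :
    ∃ Δ : (ι → A0) → M, (∀ a b, Δ (a + b) = Δ a * Δ b) ∧ ∀ a, sm A0 t a → Δ a = D a := by
  have hs : ∀ (i : ι) (a : A0), |(a:ℝ)| < s → sm A0 s (Pi.single i a) := by
    intro i a ha j
    by_cases h : j = i
    · subst h; simpa using ha
    · simp [h]; linarith
  have h1 : ∀ i : ι, ∃ Δ : A0 → M, (∀ a b, Δ (a + b) = Δ a * Δ b) ∧ ∀ a : A0, |(a:ℝ)| < t → Δ a = D (Pi.single i a) := fun i =>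
    ext1 t ht hts (fun a => D (Pi.single i a)) fun a b ha hb => by rw [Pi.single_add, hD _ _ (hs i a ha) (hs i b hb)]
  choose Δ h2 h3 using h1
  have hD0 : D 0 = 1 := by
    have := hD 0 0 (fun i => by simp; linarith) (fun i => by simp; linarith)
    simpa using this
  refine ⟨fun b => ∏ i, Δ i (b i), fun a b => ?_, fun a ha => ?_⟩
  · rw [← Finset.prod_mul_distrib]; exact Finset.prod_congr rfl fun i _ => h2 i _ _
  · have key : ∀ S : Finset ι, D (∑ i ∈ S, Pi.single i (a i)) = ∏ i ∈ S, Δ i (a i) := by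
      intro S
      induction S using Finset.induction_on with
      | empty => simpa using hD0
      | insert i S hi ih =>
        rw [Finset.sum_insert hi, Finset.prod_insert hi, hD _ _ (hs i _ (by linarith [ha i])), ih, h3 i _ (ha i)]
        intro j
        simp only [Finset.sum_apply, Finset.sum_pi_single]
        split_ifs
        · linarith [ha j]
        · simp; linarith
    have := key Finset.univ
    rw [Finset.univ_sum_single] at this
    exact this.symm

lemma ext3 {A0 : Subring ℝ} {M : Type} [Group M] {s : ℝ} (t : A0) (ht : 0 < (t:ℝ)) (hts : 2 * (t:ℝ) < s) (D : (ι → A0) → M)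
    (hD : ∀ a b, sm A0 s a → sm A0 s b → D (a + b) = D a * D b) :
    ∃ Δ : (ι → A0) → M, (∀ a b, Δ (a + b) = Δ a * Δ b) ∧ ∀ a, sm A0 t a → Δ a = D a := by
  classical
  let S : Set M := D '' {b | sm A0 s b}
  have hc : ∀ x ∈ S, ∀ y ∈ S, x * y = y * x := by
    rintro _ ⟨a, ha, rfl⟩ _ ⟨b, hb, rfl⟩
    rw [← hD a b ha hb, ← hD b a hb ha, add_comm]
  have h0 : ∀ a b : ι → A0, sm A0 s a → sm A0 s b → D (a + b) ∈ Subgroup.closure S := fun a b ha hb => by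
    rw [hD a b ha hb]
    exact mul_mem (Subgroup.subset_closure ⟨a, ha, rfl⟩) (Subgroup.subset_closure ⟨b, hb, rfl⟩)
  letI := Subgroup.closureCommGroupOfComm hc
  let D' : (ι → A0) → Subgroup.closure S := fun b => if h : D b ∈ Subgroup.closure S then ⟨D b, h⟩ else 1
  have hD' : ∀ b, D b ∈ Subgroup.closure S → (D' b : M) = D b := fun b h => by simp [D', h]
  have hin : ∀ a, sm A0 s a → D a ∈ Subgroup.closure S := fun a ha => Subgroup.subset_closure ⟨a, ha, rfl⟩
  obtain ⟨Δ, h1, h2⟩ := ext2 t ht hts D' fun a b ha hb => by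
    apply Subtype.ext
    rw [hD' _ (h0 a b ha hb), hD a b ha hb, ← hD' a (hin a ha), ← hD' b (hin b hb)]; rfl
  refine ⟨fun b => Δ b, fun a b => by simp only [h1]; rfl, fun a ha => ?_⟩
  simp only [h2 a ha]; rw [hD' _ (hin a fun i => by linarith [ha i])]

lemma small_list {A0 : Subring ℝ} (t : A0) (ht : 0 < (t:ℝ)) {s : ℝ} (hts : 2 * (t:ℝ) < s) (b : ι → A0) :
    ∃ L : List (ι → A0), L.sum = b ∧ ∀ x ∈ L, sm A0 s x := by
  have hs : ∀ (i : ι) (a : A0), |(a:ℝ)| < s → sm A0 s (Pi.single i a) := by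
    intro i a ha j
    by_cases h : j = i
    · subst h; simpa using ha
    · simp [h]; linarith
  have h1 : b ∈ AddSubgroup.closure {x : ι → A0 | sm A0 s x} := by
    rw [← Finset.univ_sum_single b]
    refine AddSubgroup.sum_mem _ fun i _ => ?_
    have e : b i = ⌊(b i : ℝ) / t⌋ • t + (b i - ⌊(b i : ℝ) / t⌋ * t) := by rw [zsmul_eq_mul]; ring
    rw [e, Pi.single_add, Pi.single_smul]
    refine add_mem (AddSubgroup.zsmul_mem _ (AddSubgroup.subset_closure (hs i t ?_)) _) (AddSubgroup.subset_closure (hs i _ ?_))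
    · rw [abs_of_pos ht]; linarith
    · have h1 := Int.floor_le ((b i:ℝ) / t)
      have h2 := Int.lt_floor_add_one ((b i:ℝ) / t)
      rw [le_div_iff₀ ht] at h1
      rw [div_lt_iff₀ ht] at h2
      simp only [AddSubgroupClass.coe_sub, Subring.coe_mul, Subring.coe_intCast]
      rw [abs_lt]; constructor <;> linarith
  rw [← AddSubgroup.mem_toAddSubmonoid, AddSubgroup.closure_toAddSubmonoid] at h1
  obtain ⟨L, hL, hs⟩ := AddSubmonoid.exists_list_of_mem_closure h1
  refine ⟨L, hs, fun x hx => ?_⟩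
  rcases hL x hx with h | h
  · exact h
  · intro i; have := h i; simpa using this
end D
end OESuperrigidity

namespace OESuperrigidity
open Filter Topology

section K
variable {ι : Type} [Fintype ι] [DecidableEq ι]
  {Λ : Type} [Group Λ] [Countable Λ] [MeasurableSpace Λ] [DiscreteMeasurableSpace Λ] {A0 : Subring ℝ}

lemma cv_neg (b : ι → A0) : cv (-b) = - cv b := by ext i; simp [cv]

lemma solve_c [Countable A0] {F : (ι → A0) → (ι → ℝ) → Λ} (R1 : ∀ b b' z, F (b + b') z = F b (z + cv b') * F b' z)
    {S Q : Set (ι → ℝ)} {D : (ι → A0) → Λ} (hp : ∀ b, ∀ᵐ z : ι → ℝ, z ∈ S → z + cv b ∈ S → F b z = D b) {s : ℝ} (t t' : A0)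
    (ht : 0 < (t:ℝ)) (hts : 2 * (t:ℝ) < s) (hQ : ∀ w ∈ Q, ∀ w' ∈ Q, ∀ i, |w i - w' i| < t)
    (hpos : ∀ b b', sm A0 s b → sm A0 s b' → volume {z | z ∈ S ∧ z + cv b' ∈ S ∧ z + cv b' + cv b ∈ S} ≠ 0)
    (L : (ι → A0) → List (ι → A0)) (hL : ∀ b, (L b).sum = b) (hL' : ∀ b, ∀ x ∈ L b, sm A0 t x)
    (β : (ι → ℝ) → ι → A0) (hβ : ∀ᵐ z, z + cv (β z) ∈ S ∧ z + cv (β z) ∈ Q) (b : ι → A0) : ∃ δ : Λ, ∀ᵐ z,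
      ((((L (β (z + cv b))).map D).prod)⁻¹ * F (β (z + cv b)) (z + cv b)) * F b z * ((((L (β z)).map D).prod)⁻¹ * F (β z) z)⁻¹ = δ := by
  have hD : ∀ a b, sm A0 s a → sm A0 s b → D (a + b) = D a * D b := by
    intro a b ha hb
    have hz : ∃ᵐ z, z ∈ {z | z ∈ S ∧ z + cv b ∈ S ∧ z + cv b + cv a ∈ S} := frequently_ae_mem_iff.2 (hpos a b ha hb)
    obtain ⟨z, hz, h1, h2, h3⟩ := (hz.and_eventually ((hp (a + b)).and ((hp b).and
      ((measurePreserving_add_right volume (cv b)).quasiMeasurePreserving.ae (hp a))))).exists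
    rw [← h1 hz.1 (by rw [cv_add, show z + (cv a + cv b) = z + cv b + cv a by abel]; exact hz.2.2), R1, h2 hz.1 hz.2.1, h3 hz.2.1 hz.2.2]
  obtain ⟨Δ, hΔ, hΔD⟩ := ext3 t ht hts D hD
  have hΔ0 : Δ 0 = 1 := by simpa using hΔ 0 0
  have hΔL : ∀ b, ((L b).map D).prod = Δ b := by
    have key : ∀ l : List (ι → A0), (∀ x ∈ l, sm A0 t x) → (l.map D).prod = Δ l.sum := by
      intro l
      induction l with
      | nil => intro _; simpa using hΔ0.symm
      | cons x l ih =>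
        intro h
        rw [List.map_cons, List.prod_cons, List.sum_cons, hΔ, ih fun y hy => h y (by simp [hy]), hΔD x (h x (by simp))]
    intro b
    rw [key _ (hL' b), hL]
  refine ⟨Δ b, ?_⟩
  have hall : ∀ᵐ z : ι → ℝ, ∀ γ1 γ2 : ι → A0, z + cv γ1 ∈ S → z + cv γ1 + cv γ2 ∈ S → F γ2 (z + cv γ1) = D γ2 := by
    rw [ae_all_iff]; intro γ1
    rw [ae_all_iff]; intro γ2
    exact (measurePreserving_add_right volume (cv γ1)).quasiMeasurePreserving.ae (hp γ2)
  filter_upwards [hall, hβ, (measurePreserving_add_right volume (cv b)).quasiMeasurePreserving.ae hβ] with z h1 h2 h3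
  rw [hΔL, hΔL]
  set β1 := β z
  set β2 := β (z + cv b)
  have e : β2 + b = (b + β2 - β1) + β1 := by abel
  have ec : z + cv β1 + cv (b + β2 - β1) = z + cv b + cv β2 := by
    rw [sub_eq_add_neg, cv_add, cv_add, cv_neg]; abel
  have hs : sm A0 t (b + β2 - β1) := by
    intro i
    have := hQ _ h3.2 _ h2.2 i
    rw [← ec] at this
    simpa [cv] using this
  have h4 := h1 β1 (b + β2 - β1) h2.1 (by rw [ec]; exact h3.1)
  rw [← hΔD _ hs] at h4
  have h5 : F β2 (z + cv b) * F b z = Δ (b + β2 - β1) * F β1 z := by rw [← R1, e, R1, h4]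
  have h6 : Δ β2 * Δ b = Δ (b + β2 - β1) * Δ β1 := by rw [← hΔ, e, hΔ]
  calc _ = (Δ β2)⁻¹ * (F β2 (z + cv b) * F b z) * (F β1 z)⁻¹ * Δ β1 := by group
    _ = (Δ β2)⁻¹ * (Δ (b + β2 - β1) * Δ β1) := by rw [h5]; group
    _ = _ := by rw [← h6]; group

variable {ν : Measure ℝ} [SFinite ν]

lemma vol_meas {P : Set (Zsp ι)} (hP : MeasurableSet P) : Measurable fun c : ℝ => volume {z : ι → ℝ | (z, c) ∈ P} :=
  measurable_measure_prodMk_right hP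

lemma shift_meas (b : ι → ℝ) : Measurable fun p : Zsp ι => ((p.1 + b, p.2) : Zsp ι) := by unfold Zsp; fun_prop

lemma solve [Countable A0] (hA : Dense (A0 : Set ℝ)) {f : (ι → A0) → Zsp ι → Λ} (mf : ∀ b, Measurable (f b)) (R1 : ∀ b b' z c, f (b + b') (z, c) = f b (z + cv b', c) * f b' (z, c))
    {E : Set (Zsp ι)} (hE : MeasurableSet E) (hp : ∀ b, ∀ᵐ c ∂ν, ∀ᵐ z1 : ι → ℝ, ∀ᵐ z2 : ι → ℝ, (z1,c) ∈ E → (z2,c) ∈ E → (z1+cv b,c) ∈ E → (z2+cv b,c) ∈ E → f b (z1,c) = f b (z2,c))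
    {s : ℝ} (t t' : A0) (ht : 0 < (t:ℝ)) (hts : 2 * (t:ℝ) < s) (ht' : 0 < (t':ℝ)) (htt' : 2 * (t':ℝ) < t)
    {Q : Set (ι → ℝ)} (hQm : MeasurableSet Q) (hQ : ∀ w ∈ Q, ∀ w' ∈ Q, ∀ i, |w i - w' i| < t) :
    ∃ φ : Zsp ι → Λ, Measurable φ ∧ ∀ᵐ c ∂ν,
      (∀ b b', sm A0 s b → sm A0 s b' → volume {z : ι → ℝ | (z,c) ∈ E ∧ (z + cv b',c) ∈ E ∧ (z + cv b' + cv b,c) ∈ E} ≠ 0) →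
      volume {z : ι → ℝ | (z,c) ∈ E ∧ z ∈ Q} ≠ 0 →
      ∀ b, ∃ δ : Λ, ∀ᵐ z : ι → ℝ, φ (z + cv b, c) * f b (z,c) * (φ (z,c))⁻¹ = δ := by
  have hPm : ∀ b l, MeasurableSet ((E ∩ (fun p : Zsp ι => ((p.1 + cv b, p.2) : Zsp ι)) ⁻¹' E) ∩ (f b) ⁻¹' {l}) := fun b l =>
    (hE.inter (shift_meas (cv b) hE)).inter (mf b (measurableSet_singleton l))
  have h1 : ∀ b : ι → A0, ∃ D : ℝ → Λ, Measurable D ∧ ∀ᵐ c ∂ν, ∀ᵐ z : ι → ℝ, (z,c) ∈ E → (z + cv b,c) ∈ E → f b (z,c) = D c := by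
    intro b
    obtain ⟨D, hD, hD'⟩ := sel (fun l : Λ => {c : ℝ | volume {z : ι → ℝ | (z,c) ∈ (E ∩ (fun p : Zsp ι => ((p.1 + cv b, p.2) : Zsp ι)) ⁻¹' E) ∩ (f b) ⁻¹' {l}} ≠ 0})
      (fun l => (vol_meas (hPm b l)) (measurableSet_singleton 0).compl)
    refine ⟨D, hD, ?_⟩
    filter_upwards [hp b] with c hc
    by_cases hex : ∃ l, c ∈ (fun l : Λ => {c : ℝ | volume {z : ι → ℝ | (z,c) ∈ (E ∩ (fun p : Zsp ι => ((p.1 + cv b, p.2) : Zsp ι)) ⁻¹' E) ∩ (f b) ⁻¹' {l}} ≠ 0}) l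
    · have h2 := hD' c hex
      obtain ⟨z1, ⟨⟨h3, h4⟩, h5⟩, h6⟩ := ((frequently_ae_mem_iff.2 h2).and_eventually hc).exists
      filter_upwards [h6] with z2 h7 h8 h9
      rw [← h7 h3 h8 h4 h9]; exact h5
    · push Not at hex
      have : ∀ᵐ z : ι → ℝ, ∀ l, z ∉ {z : ι → ℝ | (z,c) ∈ (E ∩ (fun p : Zsp ι => ((p.1 + cv b, p.2) : Zsp ι)) ⁻¹' E) ∩ (f b) ⁻¹' {l}} := by
        rw [ae_all_iff]; intro l
        refine measure_eq_zero_iff_ae_notMem.1 ?_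
        have := hex l
        simpa using this
      filter_upwards [this] with z hz h8 h9
      exact absurd ⟨⟨h8, h9⟩, rfl⟩ (hz (f b (z,c)))
  choose D hDm hD using h1
  choose L hL hL' using fun b : ι → A0 => small_list t' ht' htt' b
  obtain ⟨β, hβm, hβ⟩ := sel (fun b : ι → A0 => {p : Zsp ι | (p.1 + cv b, p.2) ∈ E ∧ p.1 + cv b ∈ Q}) fun b =>
    (shift_meas (cv b) hE).inter (((measurable_fst : Measurable fun p : (ι → ℝ) × ℝ => p.1).comp (shift_meas (cv b))) hQm)
  refine ⟨fun p => (((L (β p)).map fun b => D b p.2).prod)⁻¹ * f (β p) p, ?_, ?_⟩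
  · have hm : Measurable fun q : Zsp ι × (ι → A0) => (((L q.2).map fun b => D b q.1.2).prod)⁻¹ * f q.2 q.1 := by
      refine measurable_from_prod_countable_left fun b => ?_
      refine Measurable.mul (Measurable.inv ?_) (mf b)
      have : ∀ l : List (ι → A0), Measurable fun p : Zsp ι => (l.map fun b => D b p.2).prod := by
        intro l
        induction l with
        | nil => exact measurable_const
        | cons x l ih => simp only [List.map_cons, List.prod_cons]; exact ((hDm x).comp (measurable_snd : Measurable fun p : (ι → ℝ) × ℝ => p.2)).mul ih
      exact this (L b)
    exact hm.comp (measurable_id.prodMk hβm)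
  · filter_upwards [ae_all_iff.2 hD] with c hc hpos hq b
    refine solve_c (F := fun b z => f b (z, c)) (S := {z | (z,c) ∈ E}) (Q := Q) (D := fun b => D b c) (fun b b' z => R1 b b' z c) hc t t' ht hts hQ hpos L hL hL' (fun z => β (z,c)) ?_ b
    have hPQ : MeasurableSet {z : ι → ℝ | (z,c) ∈ E ∧ z ∈ Q} := ((measurable_id.prodMk measurable_const) hE).inter hQm
    filter_upwards [hit hA hPQ hq] with z hz
    exact hβ (z,c) hz

lemma glue {I : Type} [Countable I] [Nonempty I] {f : (ι → A0) → Zsp ι → Λ} [Countable A0] (mf : ∀ b, Measurable (f b)) (φ : I → Zsp ι → Λ) (hφ : ∀ i, Measurable (φ i))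
    (h : ∀ᵐ c ∂ν, ∃ i, ∀ b, ∃ δ : Λ, ∀ᵐ z : ι → ℝ, φ i (z + cv b, c) * f b (z,c) * (φ i (z,c))⁻¹ = δ) :
    ∃ φ : Zsp ι → Λ, Measurable φ ∧ ∀ᵐ c ∂ν, ∀ b, ∃ δ : Λ, ∀ᵐ z : ι → ℝ, φ (z + cv b, c) * f b (z,c) * (φ (z,c))⁻¹ = δ := by
  letI : MeasurableSpace I := ⊤
  obtain ⟨i, hi, hi'⟩ := sel (fun i : I => {c : ℝ | ∀ b, ∃ δ : Λ, ∀ᵐ z : ι → ℝ, φ i (z + cv b, c) * f b (z,c) * (φ i (z,c))⁻¹ = δ}) fun i => by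
    have : {c : ℝ | ∀ b, ∃ δ : Λ, ∀ᵐ z : ι → ℝ, φ i (z + cv b, c) * f b (z,c) * (φ i (z,c))⁻¹ = δ} =
      ⋂ b : ι → A0, ⋃ δ : Λ, {c | volume {z : ι → ℝ | (z,c) ∈ {p : Zsp ι | φ i (p.1 + cv b, p.2) * f b p * (φ i p)⁻¹ = δ}ᶜ} = 0} := by
      ext c; simp only [Set.mem_iInter, Set.mem_iUnion]; rfl
    rw [this]
    refine MeasurableSet.iInter fun b => MeasurableSet.iUnion fun δ => vol_meas (MeasurableSet.compl ?_) (measurableSet_singleton 0)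
    exact ((((hφ i).comp (shift_meas (cv b))).mul (mf b)).mul (hφ i).inv) (measurableSet_singleton δ)
  refine ⟨fun p => φ (i p.2) p, ?_, ?_⟩
  · have hm : Measurable fun q : Zsp ι × I => φ q.2 q.1 := measurable_from_prod_countable_left hφ
    exact hm.comp (measurable_id.prodMk (hi.comp (measurable_snd : Measurable fun p : (ι → ℝ) × ℝ => p.2)))
  · filter_upwards [h] with c hc
    exact hi' c hc

lemma cover {S : Set (ι → ℝ)} (hS : MeasurableSet S) (hSu : S ⊆ unitc ι) (h0 : volume S ≠ 0) : ∃ n : ℕ, ∀ b b' : ι → A0, sm A0 (1/(n+1:ℝ)) b → sm A0 (1/(n+1:ℝ)) b' →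
    volume {z : ι → ℝ | z ∈ S ∧ z + cv b' ∈ S ∧ z + cv b' + cv b ∈ S} ≠ 0 := by
  have hfin : volume S < ⊤ := by
    refine (measure_mono (fun z hz => ?_)).trans_lt (box_ne_top (ι := ι) 1).lt_top
    rw [mem_box]; intro i
    have := (Set.mem_univ_pi.1 (hSu hz)) i
    exact ⟨by linarith [this.1], this.2⟩
  have h := cm (μ := (volume : Measure (ι → ℝ))) (fun v z : ι → ℝ => z + v) (by exact continuous_snd.add continuous_fst) (fun v => measurePreserving_add_right _ _) 0 (by simp)
    (f := fun z => z ∈ S) (measurableSet_setOf.1 hS) hS hfin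
  have h2 := h.eventually (gt_mem_nhds (show (0:ENNReal) < volume S / 2 from ENNReal.div_pos h0 (by simp)))
  obtain ⟨r, hr, h3⟩ := Metric.eventually_nhds_iff.1 h2
  obtain ⟨n, hn⟩ := exists_nat_one_div_lt (show 0 < r / 2 by linarith)
  refine ⟨n, fun b b' hb hb' hz => ?_⟩
  have k1 := h3 (y := cv b') (by
    rw [dist_zero_right, pi_norm_lt_iff hr]; intro i; rw [Real.norm_eq_abs]; have := hb' i; simp only [cv]; linarith)
  have k2 := h3 (y := cv b' + cv b) (by
    rw [dist_zero_right, pi_norm_lt_iff hr]; intro i; rw [Real.norm_eq_abs]; have := hb' i; have := hb i; simp only [cv, Pi.add_apply]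
    refine (abs_add_le _ _).trans_lt ?_; linarith)
  have : volume S < volume S := by
    calc volume S ≤ volume ({z : ι → ℝ | z ∈ S ∧ z + cv b' ∈ S ∧ z + cv b' + cv b ∈ S} ∪ ((S ∩ {x | (x + cv b' ∈ S) ≠ (x ∈ S)}) ∪ (S ∩ {x | (x + (cv b' + cv b) ∈ S) ≠ (x ∈ S)}))) := by
          refine measure_mono fun z hz => ?_
          by_cases h4 : z + cv b' ∈ S
          · by_cases h5 : z + (cv b' + cv b) ∈ S
            · left; exact ⟨hz, h4, by rw [add_assoc]; exact h5⟩
            · right; right; exact ⟨hz, by simp [hz, h5]⟩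
          · right; left; exact ⟨hz, by simp [hz, h4]⟩
      _ ≤ 0 + (volume (S ∩ {x | (x + cv b' ∈ S) ≠ (x ∈ S)}) + volume (S ∩ {x | (x + (cv b' + cv b) ∈ S) ≠ (x ∈ S)})) := by
          refine (measure_union_le _ _).trans (add_le_add hz.le (measure_union_le _ _))
      _ < 0 + (volume S / 2 + volume S / 2) := by rw [zero_add, zero_add]; exact ENNReal.add_lt_add k1 k2
      _ = volume S := by rw [zero_add, ENNReal.add_halves]
  exact lt_irrefl _ this

lemma exists_small (hA : Dense (A0 : Set ℝ)) {s : ℝ} (hs : 0 < s) : ∃ t : A0, 0 < (t:ℝ) ∧ 2 * (t:ℝ) < s := by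
  obtain ⟨t, ht, h1, h2⟩ := hA.exists_between (show 0 < s / 2 by linarith)
  exact ⟨⟨t, ht⟩, h1, by simp only; linarith⟩

theorem thmK [Nontrivial ι] [Countable A0] [IsFiniteMeasure ν] {u : ℝ} {c0 d0 : _} (hu : UData u A0 c0 d0) {f : (ι → A0) → Zsp ι → Λ} {g : ι → ι → ℕ → Zsp ι → Λ} (h : CD ⟨u, hu.mem⟩ f g) :
    ∃ φ : Zsp ι → Λ, Measurable φ ∧ ∀ᵐ c ∂ν, ∀ b, ∃ δ : Λ, ∀ᵐ z : ι → ℝ, φ (z + cv b, c) * f b (z,c) * (φ (z,c))⁻¹ = δ := by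
  have hA := hu.dense
  obtain ⟨φ0, hφ0, hper⟩ := h.trivialize
  have h' := h.twist hφ0
  choose E hE1 hE2 hE3 hE4 using fun j : ℕ => lemP ν hu h' hper (1/(j+1:ℝ)) (by positivity)
  choose t ht hts using fun n : ℕ => exists_small (A0 := A0) hA (show 0 < 1/(n+1:ℝ) by positivity)
  choose t' ht' htt' using fun n : ℕ => exists_small (A0 := A0) hA (ht n)
  let Q : ℕ → (ι → ℤ) → Set (ι → ℝ) := fun n k => {z | (fun i => ⌊z i / t n⌋) = k}
  have hQm : ∀ n k, MeasurableSet (Q n k) := fun n k => by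
    have : Measurable fun z : ι → ℝ => (fun i => ⌊z i / t n⌋) := by fun_prop
    exact this (measurableSet_singleton k)
  have hQ : ∀ n k, ∀ w ∈ Q n k, ∀ w' ∈ Q n k, ∀ i, |w i - w' i| < t n := by
    intro n k w hw w' hw' i
    have e : ⌊w i / t n⌋ = ⌊w' i / t n⌋ := congrFun (hw.trans hw'.symm) i
    have := Int.abs_sub_lt_one_of_floor_eq_floor e
    rw [← sub_div, abs_div, abs_of_pos (ht n), div_lt_one (ht n)] at this
    exact this
  choose φ hφ hφ' using fun i : ℕ × ℕ × (ι → ℤ) => solve (ν := ν) hA h'.mf h'.R1 (hE1 i.1) (hE3 i.1) (t i.2.1) (t' i.2.1) (ht _) (hts _) (ht' _) (htt' _) (hQm i.2.1 i.2.2) (hQ _ _)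
  obtain ⟨ψ, hψ, hψ'⟩ := glue (ν := ν) h'.mf φ hφ (by
    have hae : ∀ᵐ c ∂ν, ∃ j, volume {z : ι → ℝ | (z, c) ∈ E j} ≠ 0 := by
      rw [ae_iff]
      refine le_antisymm (ge_of_tendsto' (f := fun j : ℕ => ENNReal.ofReal (1/(j+1:ℝ))) (x := atTop) ?_ fun j => ?_) (by simp)
      · have := ENNReal.tendsto_ofReal (tendsto_one_div_add_atTop_nhds_zero_nat (𝕜 := ℝ))
        simpa using this
      · refine (measure_mono fun c hc => ?_).trans (hE4 j)
        simp only [Set.mem_ofPred_eq] at hc ⊢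
        push Not at hc
        exact hc j
    filter_upwards [ae_all_iff.2 hφ', hae] with c hc hj
    obtain ⟨j, hj⟩ := hj
    have hSm : MeasurableSet {z : ι → ℝ | (z,c) ∈ E j} := (measurable_id.prodMk measurable_const) (hE1 j)
    obtain ⟨n, hn⟩ := cover (A0 := A0) hSm (fun z hz => hE2 j _ hz) hj
    have : ∃ k, volume {z : ι → ℝ | (z,c) ∈ E j ∧ z ∈ Q n k} ≠ 0 := by
      by_contra hcon
      push Not at hcon
      refine hj (measure_mono_null (fun z hz => ?_) (measure_iUnion_null hcon))
      exact Set.mem_iUnion.2 ⟨_, hz, rfl⟩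
    obtain ⟨k, hk⟩ := this
    exact ⟨(j, n, k), hc (j, n, k) hn hk⟩)
  refine ⟨fun p => ψ p * φ0 p, hψ.mul hφ0, ?_⟩
  filter_upwards [hψ'] with c hc b
  obtain ⟨δ, hδ⟩ := hc b
  refine ⟨δ, ?_⟩
  filter_upwards [hδ] with z hz
  rw [← hz]; group
end K
end OESuperrigidity

namespace OESuperrigidity
open Filter Topology

section Co
variable {n : ℕ} {Λ : Type} [Group Λ] [Countable Λ] [MeasurableSpace Λ] [DiscreteMeasurableSpace Λ]

structure Coc (A : Subring ℝ) (Γ : Submonoid (Matrix (Fin n) (Fin n) ℝ)) (W : Matrix (Fin n) (Fin n) ℝ → (Fin n → ℝ) → Λ) : Prop where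
  meas : ∀ M, Measurable (W M)
  mul : ∀ M ∈ Γ, ∀ N ∈ Γ, ∀ x, W (M * N) x = W M (N.mulVec x) * W N x
  det : ∀ M ∈ Γ, M.det = 1
  tr : ∀ i j, i ≠ j → ∀ a ∈ A, Matrix.transvection i j a ∈ Γ

def twi (W : Matrix (Fin n) (Fin n) ℝ → (Fin n → ℝ) → Λ) (φ : (Fin n → ℝ) → Λ) : Matrix (Fin n) (Fin n) ℝ → (Fin n → ℝ) → Λ :=
  fun M x => φ (M.mulVec x) * W M x * (φ x)⁻¹

variable {A : Subring ℝ} {Γ : Submonoid (Matrix (Fin n) (Fin n) ℝ)} {W : Matrix (Fin n) (Fin n) ℝ → (Fin n → ℝ) → Λ}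

lemma mulVec_meas (M : Matrix (Fin n) (Fin n) ℝ) : Measurable fun x : Fin n → ℝ => M.mulVec x :=
  (LinearMap.continuous_of_finiteDimensional (Matrix.toLin' M)).measurable

lemma Coc.twi (h : Coc A Γ W) {φ : (Fin n → ℝ) → Λ} (hφ : Measurable φ) : Coc A Γ (twi W φ) where
  meas M := ((hφ.comp (mulVec_meas M)).mul (h.meas M)).mul hφ.inv
  mul M hM N hN x := by simp only [OESuperrigidity.twi]; rw [h.mul M hM N hN, Matrix.mulVec_mulVec]; group
  det := h.det
  tr := h.tr

def Nm (k : Fin n) (w : Fin n → ℝ) : Matrix (Fin n) (Fin n) ℝ := 1 + Matrix.vecMulVec w (Pi.single k 1)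

lemma Nm_mulVec (k : Fin n) (w x : Fin n → ℝ) : (Nm k w).mulVec x = x + x k • w := by
  rw [Nm, Matrix.add_mulVec, Matrix.one_mulVec, Matrix.vecMulVec_mulVec]; simp

lemma tr_mulVec (i j : Fin n) (a : ℝ) (x : Fin n → ℝ) : (Matrix.transvection i j a).mulVec x = x + Pi.single i (a * x j) := by
  rw [Matrix.transvection, Matrix.add_mulVec, Matrix.one_mulVec, Matrix.single_mulVec]
  simp [Pi.single, Function.update_eq_iff]

lemma mat_ext {M N : Matrix (Fin n) (Fin n) ℝ} (h : ∀ x, M.mulVec x = N.mulVec x) : M = N :=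
  Matrix.toLin'.injective (LinearMap.ext fun x => by simpa using h x)

lemma Nm_mul (k : Fin n) (w w' : Fin n → ℝ) (h : w' k = 0) : Nm k w * Nm k w' = Nm k (w + w') :=
  mat_ext fun x => by
    rw [← Matrix.mulVec_mulVec, Nm_mulVec, Nm_mulVec, Nm_mulVec]; simp [h]; abel

lemma Nm_single (j k : Fin n) (a : ℝ) : Nm k (Pi.single j a) = Matrix.transvection j k a :=
  mat_ext fun x => by
    rw [Nm_mulVec, tr_mulVec, ← Pi.single_smul, smul_eq_mul, mul_comm]

lemma tr_Nm (i j k : Fin n) (hik : i ≠ k) (hij : i ≠ j) (a : ℝ) (b : Fin n → ℝ) :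
    Matrix.transvection i j a * Nm k b = Nm k ((Matrix.transvection i j a).mulVec b) * Matrix.transvection i j a :=
  mat_ext fun x => by
    rw [← Matrix.mulVec_mulVec, ← Matrix.mulVec_mulVec]
    simp only [Nm_mulVec, tr_mulVec]
    ext l
    have : k ≠ i := hik.symm
    by_cases hl : l = i
    · subst hl; simp [this]; ring
    · simp [hl, this]

lemma Nm_mem (h : Coc A Γ W) (k : Fin n) (w : Fin n → ℝ) (hw : ∀ i, w i ∈ A) (hk : w k = 0) : Nm k w ∈ Γ := by
  have : ∀ S : Finset (Fin n), Nm k (∑ i ∈ S, Pi.single i (w i)) ∈ Γ ∧ (∑ i ∈ S, Pi.single i (w i) : Fin n → ℝ) k = 0 := by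
    intro S
    induction S using Finset.induction_on with
    | empty => simp [Nm, Γ.one_mem]
    | insert i S hi ih =>
      rw [Finset.sum_insert hi]
      by_cases hik : i = k
      · subst hik; simpa [hk] using ih
      · rw [← Nm_mul _ _ _ ih.2, Nm_single]
        exact ⟨Γ.mul_mem (h.tr i k hik _ (hw i)) ih.1, by rw [Pi.add_apply, ih.2]; simp [hik, Ne.symm hik]⟩
  have := (this Finset.univ).1
  rwa [Finset.univ_sum_single] at this

lemma shear_inv {k j : Fin n} (hj : j ≠ k) {f : (Fin n → ℝ) → Λ} (hf : Measurable f) (h : ∀ i, i ≠ k → Indep i f) (t : ℝ) :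
    ∀ᵐ x : Fin n → ℝ, f (x + Pi.single j (t * x k)) = f x :=
  indep_comp (fun i => i ≠ k) hf h (fun x => x + Pi.single j (t * x k)) (mp_shear j k hj t).quasiMeasurePreserving fun x i hi => by
    have : i ≠ j := fun e => by subst e; exact hi hj
    simp [this]

lemma trick_shear {j k : Fin n} (hj : j ≠ k) {A : Subring ℝ} (hA : Dense (A : Set ℝ)) {f : (Fin n → ℝ) → Λ} (hf : Measurable f)
    (hα : ∀ b ∈ A, ∃ α β : (Fin n → ℝ) → Λ, (∀ a ∈ A, ∀ᵐ x, α (x + Pi.single j (a * x k)) = α x) ∧ (∀ a ∈ A, ∀ᵐ x, β (x + Pi.single j (a * x k)) = β x) ∧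
      ∀ᵐ x, f (x + Pi.single j (b * x k)) = β x * f x * (α x)⁻¹) : Indep j f := by
  refine indep_of_shear hj hf (trick (μ := (volume : Measure (Fin n → ℝ))) (fun t x => x + Pi.single j (t * x k)) ?_ (fun t => mp_shear j k hj t) (by simp) ?_ A.toAddSubgroup hA hf hα)
  · have h1 := (cont_single j).comp (show Continuous fun p : ℝ × (Fin n → ℝ) => p.1 * p.2 k by fun_prop)
    exact continuous_snd.add h1
  · intro s t x
    simp only [Pi.add_apply, Pi.single_eq_of_ne hj.symm, add_zero]
    rw [add_mul, Pi.single_add]; abel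

lemma good2 {V : Matrix (Fin n) (Fin n) ℝ → (Fin n → ℝ) → Λ} (h : Coc A Γ V) {A0 : Subring ℝ} (h0 : A0 ≤ A) (hA : Dense (A0 : Set ℝ)) (k : Fin n)
    (hV : ∀ j, j ≠ k → ∀ a ∈ A0, ∀ i, i ≠ k → Indep i (V (Matrix.transvection j k a)))
    (w : Fin n → ℝ) (hw : ∀ i, w i ∈ A) (hk : w k = 0) (i : Fin n) (hi : i ≠ k) : Indep i (V (Nm k w)) := by
  refine trick_shear hi hA (h.meas _) fun b hb => ⟨V (Matrix.transvection i k b), fun x => V (Matrix.transvection i k b) ((Nm k w).mulVec x),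
    fun a ha => shear_inv hi (h.meas _) (hV i hi b hb) a, fun a ha => ?_, Eventually.of_forall fun x => ?_⟩
  · have h1 := (mp_det _ (h.det _ (Nm_mem h k w hw hk))).quasiMeasurePreserving.ae (shear_inv hi (h.meas _) (hV i hi b hb) a)
    filter_upwards [h1] with x hx
    rw [← hx]
    congr 1
    simp only [Nm_mulVec, Pi.add_apply, Pi.smul_apply, hk, Pi.single_eq_of_ne hi.symm]
    simp; abel
  · have hb' := h.tr i k hi b (h0 hb)
    have hN := Nm_mem h k w hw hk
    rw [eq_mul_inv_iff_mul_eq, ← tr_mulVec, ← h.mul _ hN _ hb', ← h.mul _ hb' _ hN, ← Nm_single, Nm_mul _ _ _ hk, Nm_mul _ _ _ (by simp [hi.symm]), add_comm]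

def Good (A : Subring ℝ) (V : Matrix (Fin n) (Fin n) ℝ → (Fin n → ℝ) → Λ) (k : Fin n) : Prop :=
  ∀ i j, i ≠ k → i ≠ j → ∀ a ∈ A, ∀ k', k' ≠ k → Indep k' (V (Matrix.transvection i j a))

lemma good3 {V : Matrix (Fin n) (Fin n) ℝ → (Fin n → ℝ) → Λ} (h : Coc A Γ V) (hA : Dense (A : Set ℝ)) (k : Fin n)
    (hV : ∀ w : Fin n → ℝ, (∀ i, w i ∈ A) → w k = 0 → ∀ i, i ≠ k → Indep i (V (Nm k w))) : Good A V k := by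
  intro i j hik hij a ha k' hk'
  have hs : ∀ b ∈ A, ∀ l, (Pi.single k' b : Fin n → ℝ) l ∈ A := fun b hb l => by
    by_cases e : l = k'
    · subst e; simpa using hb
    · simp [e, A.zero_mem]
  have hk0 : ∀ b : ℝ, (Pi.single k' b : Fin n → ℝ) k = 0 := fun b => by simp [hk'.symm]
  refine trick_shear hk' hA (h.meas _) fun b hb => ?_
  set w := (Matrix.transvection i j a).mulVec (Pi.single k' b) with hw
  have hwA : ∀ l, w l ∈ A := fun l => by
    rw [hw, tr_mulVec]
    refine A.add_mem (hs b hb l) ?_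
    by_cases e : l = i
    · subst e; simpa using A.mul_mem ha (hs b hb j)
    · simp [e, A.zero_mem]
  have hwk : w k = 0 := by rw [hw, tr_mulVec]; simp [hk'.symm, hik.symm]
  refine ⟨V (Nm k (Pi.single k' b)), V (Nm k w), fun c hc => shear_inv hk' (h.meas _) (hV _ (hs b hb) (hk0 b)) c,
    fun c hc => shear_inv hk' (h.meas _) (hV _ hwA hwk) c, ?_⟩
  have h1 := indep_comp (fun l => l ≠ k) (h.meas _) (hV _ hwA hwk) (fun x => (Matrix.transvection i j a).mulVec x)
    (mp_det _ (h.det _ (h.tr i j hij a ha))).quasiMeasurePreserving fun x l hl => by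
      have : l ≠ i := fun e => by subst e; exact hl hik
      simp [tr_mulVec, this]
  filter_upwards [h1] with x hx
  have hb' := Nm_mem h k _ (hs b hb) (hk0 b)
  have hg := h.tr i j hij a ha
  rw [← hx, eq_mul_inv_iff_mul_eq, ← tr_mulVec, ← Nm_single k' k b, ← h.mul _ hg _ hb', ← h.mul _ (Nm_mem h k w hwA hwk) _ hg, tr_Nm i j k hik hij]
end Co
end OESuperrigidity

namespace OESuperrigidity
open Filter Topology

section Co
variable {m : ℕ} {Λ : Type} [Group Λ] [Countable Λ] [MeasurableSpace Λ] [DiscreteMeasurableSpace Λ]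
  {A : Subring ℝ} {Γ : Submonoid (Matrix (Fin (m+1)) (Fin (m+1)) ℝ)} {W : Matrix (Fin (m+1)) (Fin (m+1)) ℝ → (Fin (m+1) → ℝ) → Λ}

def px (k : Fin (m+1)) (z : Fin m → ℝ) (c : ℝ) : Fin (m+1) → ℝ := k.insertNth c (c • z)
def em (k : Fin (m+1)) (b : Fin m → ℝ) : Fin (m+1) → ℝ := k.insertNth 0 b

lemma fin_ext (k : Fin (m+1)) {x y : Fin (m+1) → ℝ} (h : x k = y k) (h' : ∀ i, x (k.succAbove i) = y (k.succAbove i)) : x = y := by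
  ext l
  rcases Fin.eq_self_or_eq_succAbove k l with e | ⟨i, e⟩
  · rw [e, h]
  · rw [e, h']

lemma px_same (k : Fin (m+1)) (z c) : px k z c k = c := by simp [px]
lemma px_succ (k : Fin (m+1)) (z c i) : px k z c (k.succAbove i) = c * z i := by simp [px]
lemma em_same (k : Fin (m+1)) (z) : em k z k = 0 := by simp [em]
lemma em_succ (k : Fin (m+1)) (z i) : em k z (k.succAbove i) = z i := by simp [em]

lemma Nm_px (k : Fin (m+1)) (b z c) : (Nm k (em k b)).mulVec (px k z c) = px k (z + b) c := by
  rw [Nm_mulVec]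
  refine fin_ext k ?_ fun i => ?_
  · simp [px_same, em_same]
  · simp [px_same, em_succ, px_succ]; ring

lemma single_succ (k : Fin (m+1)) (i j : Fin m) (a : ℝ) : (Pi.single (k.succAbove i) a : Fin (m+1) → ℝ) (k.succAbove j) = (Pi.single i a : Fin m → ℝ) j := by
  by_cases e : j = i
  · subst e; simp
  · have : k.succAbove j ≠ k.succAbove i := fun h => e (Fin.succAbove_right_injective h)
    simp [e, this]

lemma tr_px (k : Fin (m+1)) (i j a z c) : (Matrix.transvection (k.succAbove i) (k.succAbove j) a).mulVec (px k z c) = px k (z + Pi.single i (a * z j)) c := by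
  rw [tr_mulVec]
  refine fin_ext k ?_ fun l => ?_
  · simp [px_same]
  · rw [Pi.add_apply, single_succ]
    simp only [px_succ, Pi.add_apply, mul_add]
    by_cases e : l = i
    · subst e; simp; ring
    · simp [e]

lemma em_meas (k : Fin (m+1)) : Measurable fun p : Zsp (Fin m) => px k p.1 p.2 := by
  have h : Measurable fun p : (Fin m → ℝ) × ℝ => px k p.1 p.2 := by
    rw [measurable_pi_iff]; intro l
    rcases Fin.eq_self_or_eq_succAbove k l with e | ⟨i, e⟩
    · subst e; simp only [px_same]; exact measurable_snd
    · subst e; simp only [px_succ]; fun_prop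
  exact h

lemma ae_px (k : Fin (m+1)) {P : (Fin (m+1) → ℝ) → Prop} (hP : MeasurableSet {x | P x}) (h : ∀ᵐ c : ℝ, ∀ᵐ z : Fin m → ℝ, P (px k z c)) : ∀ᵐ x, P x := by
  have mp := volume_preserving_piFinSuccAbove (fun _ : Fin (m+1) => ℝ) k
  have h2 : ∀ᵐ q : ℝ × (Fin m → ℝ), P (k.insertNth q.1 q.2) := by
    have hm : MeasurableSet {q : ℝ × (Fin m → ℝ) | P (k.insertNth q.1 q.2)} := (MeasurableEquiv.piFinSuccAbove (fun _ : Fin (m+1) => ℝ) k).symm.measurable hP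
    rw [Measure.volume_eq_prod, Measure.ae_prod_iff_ae_ae hm]
    have hne : ∀ᵐ c : ℝ, c ≠ 0 := by simp [ae_iff]
    filter_upwards [h, hne] with c hc h0
    have h3 := Measure.addHaar_preimage_smul (volume : Measure (Fin m → ℝ)) (inv_ne_zero h0) {z | ¬ P (px k z c)}
    rw [ae_iff.1 hc, mul_zero] at h3
    rw [ae_iff]
    refine measure_mono_null (fun y hy => ?_) h3
    simp only [Set.mem_preimage, Set.mem_ofPred_eq, px, smul_smul, mul_inv_cancel₀ h0, one_smul] at hy ⊢
    exact hy
  filter_upwards [mp.quasiMeasurePreserving.ae h2] with x hx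
  have e : k.insertNth (x k) (fun i => x (k.succAbove i)) = x := Fin.insertNth_self_removeNth k x
  have : P (k.insertNth (x k) (fun i => x (k.succAbove i))) := hx
  rwa [e] at this

lemma good1 (hm : 2 ≤ m) (h : Coc A Γ W) {A0 : Subring ℝ} [Countable A0] (h0 : A0 ≤ A) {u : ℝ} {c0 d0 : _} (hu : UData u A0 c0 d0) (k : Fin (m+1)) :
    ∃ φ : (Fin (m+1) → ℝ) → Λ, Measurable φ ∧ ∀ j, j ≠ k → ∀ a ∈ A0, ∀ i, i ≠ k → Indep i (twi W φ (Matrix.transvection j k a)) := by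
  haveI : Nontrivial (Fin m) := Fin.nontrivial_iff_two_le.2 hm
  have memA : ∀ b : Fin m → A0, ∀ i, em k (cv b) i ∈ A := fun b l => by
    rcases Fin.eq_self_or_eq_succAbove k l with e | ⟨i, e⟩
    · rw [e, em_same]; exact A.zero_mem
    · rw [e, em_succ]; exact h0 (b i).2
  have mem : ∀ b : Fin m → A0, Nm k (em k (cv b)) ∈ Γ := fun b => Nm_mem h k _ (memA b) (em_same _ _)
  have hmem : ∀ i j, i ≠ j → ∀ l : ℕ, Matrix.transvection (k.succAbove i) (k.succAbove j) (u ^ l) ∈ Γ := fun i j hij l =>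
    h.tr _ _ (fun e => hij (Fin.succAbove_right_injective e)) _ (A.pow_mem (h0 hu.mem) l)
  have cd : CD (⟨u, hu.mem⟩ : A0) (fun (b : Fin m → A0) (p : Zsp (Fin m)) => W (Nm k (em k (cv b))) (px k p.1 p.2))
      (fun i j l p => W (Matrix.transvection (k.succAbove i) (k.succAbove j) (u ^ l)) (px k p.1 p.2)) := by
    refine ⟨fun b => (h.meas _).comp (em_meas k), fun i j l => (h.meas _).comp (em_meas k), fun b b' z c => ?_, fun i j hij l b z c => ?_⟩
    · simp only
      rw [← Nm_px, ← h.mul _ (mem b) _ (mem b'), Nm_mul _ _ _ (em_same _ _)]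
      congr 2
      refine fin_ext k (by simp [em_same]) fun i => by simp [em_succ, cv_add]
    · simp only
      rw [← Nm_px, ← tr_px, ← h.mul _ (hmem i j hij l) _ (mem b), ← h.mul _ (mem _) _ (hmem i j hij l),
        tr_Nm _ _ _ (Fin.succAbove_ne k i) (fun e => hij (Fin.succAbove_right_injective e))]
      congr 3
      rw [tr_mulVec, cv_add, cv_single]
      refine fin_ext k (by simp [em_same]) fun i' => ?_
      rw [Pi.add_apply, single_succ]
      simp [em_succ, cv]
  obtain ⟨φ, hφ, hφ'⟩ := thmK (ν := (volume : Measure ℝ).toFinite) hu cd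
  have hφ'' : ∀ᵐ c : ℝ, ∀ b : Fin m → A0, ∃ δ : Λ, ∀ᵐ z : Fin m → ℝ, φ (z + cv b, c) * W (Nm k (em k (cv b))) (px k z c) * (φ (z,c))⁻¹ = δ := by
    rw [ae_toFinite] at hφ'; exact hφ'
  let Φ : (Fin (m+1) → ℝ) → Λ := fun x => φ (fun i => x (k.succAbove i) / x k, x k)
  have hΦm : Measurable Φ := by
    have : Measurable fun x : Fin (m+1) → ℝ => ((fun i => x (k.succAbove i) / x k, x k) : (Fin m → ℝ) × ℝ) := by fun_prop
    exact hφ.comp this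
  have hΦ : ∀ z c, c ≠ 0 → Φ (px k z c) = φ (z, c) := fun z c hc => by
    simp only [Φ, px_same, px_succ]
    congr 2
    ext i; field_simp
  refine ⟨Φ, hΦm, fun j hj a ha i hi => indep_of_shear hi ((h.twi hΦm).meas _) fun t => ?_⟩
  obtain ⟨j, rfl⟩ := Fin.exists_succAbove_eq hj
  obtain ⟨i, rfl⟩ := Fin.exists_succAbove_eq hi
  have hne : ∀ᵐ c : ℝ, c ≠ 0 := by simp [ae_iff]
  refine ae_px k (measurableSet_eq_fun (((h.twi hΦm).meas _).comp (mp_shear _ _ hi t).measurable) ((h.twi hΦm).meas _)) ?_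
  filter_upwards [hφ'', hne] with c hc hc0
  obtain ⟨δ, hδ⟩ := hc (Pi.single j ⟨a, ha⟩)
  have e1 : Matrix.transvection (k.succAbove j) k a = Nm k (em k (cv (Pi.single j ⟨a, ha⟩ : Fin m → A0))) := by
    rw [← Nm_single, cv_single]; congr 1
    exact fin_ext k (by simp [em_same]) fun i' => by rw [single_succ, em_succ]
  have e2 : ∀ z, twi W Φ (Matrix.transvection (k.succAbove j) k a) (px k z c) =
      φ (z + cv (Pi.single j ⟨a, ha⟩ : Fin m → A0), c) * W (Nm k (em k (cv (Pi.single j ⟨a, ha⟩ : Fin m → A0)))) (px k z c) * (φ (z,c))⁻¹ := fun z => by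
    rw [twi, e1, Nm_px, hΦ _ _ hc0, hΦ _ _ hc0]
  filter_upwards [hδ, (measurePreserving_add_right volume (Pi.single i t)).quasiMeasurePreserving.ae hδ] with z h1 h2
  have e3 : px k z c + Pi.single (k.succAbove i) (t * px k z c k) = px k (z + Pi.single i t) c := by
    refine fin_ext k (by simp [px_same]) fun l => ?_
    rw [Pi.add_apply, single_succ, px_same]
    simp only [px_succ, Pi.add_apply, mul_add]
    by_cases e : l = i
    · subst e; simp; ring
    · simp [e]
  rw [e3, e2, e2, h1, h2]

lemma exists_good (hm : 2 ≤ m) (h : Coc A Γ W) {A0 : Subring ℝ} [Countable A0] (h0 : A0 ≤ A) {u : ℝ} {c0 d0 : _} (hu : UData u A0 c0 d0) (k : Fin (m+1)) :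
    ∃ φ : (Fin (m+1) → ℝ) → Λ, Measurable φ ∧ Good A (twi W φ) k := by
  obtain ⟨φ, hφ, h1⟩ := good1 hm h h0 hu k
  have hc := h.twi hφ
  exact ⟨φ, hφ, good3 hc (hu.dense.mono h0) k (good2 hc h0 hu.dense k h1)⟩
end Co
end OESuperrigidity

namespace OESuperrigidity
open Filter Topology

section Co
variable {n : ℕ} {Λ : Type} [Group Λ] [Countable Λ] [MeasurableSpace Λ] [DiscreteMeasurableSpace Λ]
  {A : Subring ℝ} {Γ : Submonoid (Matrix (Fin n) (Fin n) ℝ)} {W : Matrix (Fin n) (Fin n) ℝ → (Fin n → ℝ) → Λ}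

lemma ae_comm_gen {α β : Type*} [MeasurableSpace α] [MeasurableSpace β] (μ : Measure α) (ν : Measure β) [SFinite μ] [SFinite ν] (s : Set (α × β)) (hs : MeasurableSet s)
    (h : ∀ᵐ x ∂μ, ∀ᵐ y ∂ν, (x, y) ∈ s) : ∀ᵐ y ∂ν, ∀ᵐ x ∂μ, (x, y) ∈ s :=
  (Measure.ae_ae_comm (p := fun x y => (x, y) ∈ s) hs).1 h

lemma upd_ae1 (l : Fin n) {q : (Fin n → ℝ) → Prop} (hq : Measurable q) (hs : ∀ᵐ x, q x) : ∀ᵐ x : Fin n → ℝ, ∀ᵐ t : ℝ, q (x + Pi.single l t) := by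
  have m1 : MeasurableSet {p : ℝ × (Fin n → ℝ) | q (p.2 + Pi.single l p.1)} :=
    measurableSet_setOf.2 (hq.comp (measurable_snd.add ((meas_single l).comp measurable_fst)))
  have h3 : ∀ᵐ t : ℝ, ∀ᵐ x : Fin n → ℝ, q (x + Pi.single l t) := Eventually.of_forall fun t =>
    (measurePreserving_add_right volume (Pi.single l t)).quasiMeasurePreserving.ae hs
  have := ae_comm_gen volume volume _ m1 h3
  exact this

lemma upd_ae2 (l : Fin n) {q : (Fin n → ℝ) → Prop} (hq : Measurable q) (hs : ∀ᵐ x, q x) : ∀ᵐ r : ℝ, ∀ᵐ x : Fin n → ℝ, q (x + Pi.single l (r - x l)) := by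
  have m2 : MeasurableSet {p : (Fin n → ℝ) × ℝ | q (p.1 + Pi.single l (p.2 - p.1 l))} :=
    measurableSet_setOf.2 (hq.comp (measurable_fst.add ((meas_single l).comp (show Measurable fun p : (Fin n → ℝ) × ℝ => p.2 - p.1 l by fun_prop))))
  have h4 : ∀ᵐ x : Fin n → ℝ, ∀ᵐ r : ℝ, q (x + Pi.single l (r - x l)) := by
    filter_upwards [upd_ae1 l hq hs] with x hx
    exact (measurePreserving_sub_right volume (x l)).quasiMeasurePreserving.ae hx
  have := ae_comm_gen volume volume _ m2 h4
  exact this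

lemma upd_ae (l : Fin n) {P : (Fin n → ℝ) → Prop} (h : ∀ᵐ x, P x) : ∀ᵐ r : ℝ, ∀ᵐ x : Fin n → ℝ, P (x + Pi.single l (r - x l)) := by
  obtain ⟨s, hs, hsm, hsP⟩ := h.exists_measurable_mem
  have h2 := upd_ae2 l (q := fun x => x ∈ s) (measurableSet_setOf.1 hsm) hs
  filter_upwards [h2] with r hr
  filter_upwards [hr] with x hx
  exact hsP _ hx

lemma upd_indep (l i : Fin n) (hil : i ≠ l) {w : (Fin n → ℝ) → Λ} (hw : Measurable w) (h : Indep i w) :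
    ∀ᵐ r : ℝ, Indep i fun x => w (x + Pi.single l (r - x l)) := by
  filter_upwards [upd_ae l (indep_ae_ae hw h)] with r hr
  have hm : Measurable fun x : Fin n → ℝ => x + Pi.single l (r - x l) :=
    measurable_id.add ((meas_single l).comp (show Measurable fun x : Fin n → ℝ => r - x l by fun_prop))
  refine indep_of_ae_ae (hw.comp hm) ?_
  filter_upwards [hr] with x hx
  filter_upwards [hx] with t ht
  show w _ = w _
  rw [← ht]
  congr 1
  simp [hil.symm]; abel

lemma twi_w (h : Coc A Γ W) (hA : Dense (A : Set ℝ)) {k l i : Fin n} (hik : i ≠ k) (hil : i ≠ l) {φ ψ : (Fin n → ℝ) → Λ} (hφ : Measurable φ) (hψ : Measurable ψ)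
    (h1 : Good A (twi W φ) k) (h2 : Good A (twi W ψ) l) : Indep i fun x => φ x * (ψ x)⁻¹ := by
  refine trick_shear hik hA (hφ.mul hψ.inv) fun b hb => ⟨twi W ψ (Matrix.transvection i k b), twi W φ (Matrix.transvection i k b), fun a ha => ?_, fun a ha => ?_, Eventually.of_forall fun x => ?_⟩
  · exact indep_comp (fun j => j = i) ((h.twi hψ).meas _) (fun j hj => by subst hj; exact h2 j k hil hik b hb j hil) _ (mp_shear i k hik a).quasiMeasurePreserving fun x j hj => by simp [hj]
  · exact indep_comp (fun j => j = i) ((h.twi hφ).meas _) (fun j hj => by subst hj; exact h1 j k hik hik b hb j hik) _ (mp_shear i k hik a).quasiMeasurePreserving fun x j hj => by simp [hj]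
  · simp only [twi, tr_mulVec]; group

lemma Good.change (h : Coc A Γ W) {k : Fin n} {φ ψ p : (Fin n → ℝ) → Λ} (hp : Measurable p) (h1 : Good A (twi W φ) k) (hi : ∀ i, i ≠ k → Indep i p)
    (e : ∀ᵐ x, ψ x = p x * φ x) : Good A (twi W ψ) k := by
  intro i j hik hij a ha k' hk'
  have mp := (mp_det _ (h.det _ (h.tr i j hij a ha))).quasiMeasurePreserving
  refine (((hi k' hk').mul (h1 i j hik hij a ha k' hk')).mul (hi k' hk').inv).congr ?_
  have h2 := indep_comp (fun l => l ≠ k) hp hi (fun x => (Matrix.transvection i j a).mulVec x) mp fun x l hl => by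
    have : l ≠ i := fun e => by subst e; exact hl hik
    simp [tr_mulVec, this]
  filter_upwards [e, mp.ae e, h2] with x e1 e2 e3
  simp only [twi, e1, e2, e3]
  group

lemma all_good (hn : 3 ≤ n) (h : Coc A Γ W) (hA : Dense (A : Set ℝ)) (hg : ∀ k, ∃ φ : (Fin n → ℝ) → Λ, Measurable φ ∧ Good A (twi W φ) k) :
    ∃ φ : (Fin n → ℝ) → Λ, Measurable φ ∧ ∀ k, Good A (twi W φ) k := by
  choose φ hφ hG using hg
  let l : Fin n := ⟨0, by omega⟩
  let k0 : Fin n := ⟨1, by omega⟩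
  let k1 : Fin n := ⟨2, by omega⟩
  have hk0 : k0 ≠ l := by simp [k0, l]
  have hk1 : k1 ≠ l := by simp [k1, l]
  have hk01 : k1 ≠ k0 := by simp [k0, k1]
  have hwm : ∀ k, Measurable fun x => φ k x * (φ l x)⁻¹ := fun k => (hφ k).mul (hφ l).inv
  have hw : ∀ k m i, i ≠ k → i ≠ m → Indep i fun x => φ k x * (φ m x)⁻¹ := fun k m i hk hm => twi_w h hA hk hm (hφ k) (hφ m) (hG k) (hG m)
  have H1 : ∀ᵐ r : ℝ, ∀ k i, i ≠ k → i ≠ l → Indep i fun x => φ k (x + Pi.single l (r - x l)) * (φ l (x + Pi.single l (r - x l)))⁻¹ := by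
    rw [ae_all_iff]; intro k
    rw [ae_all_iff]; intro i
    by_cases hik : i ≠ k
    · by_cases hil : i ≠ l
      · filter_upwards [upd_indep l i hil (hwm k) (hw k l i hik hil)] with r hr _ _ using hr
      · exact Eventually.of_forall fun r _ h => absurd h hil
    · exact Eventually.of_forall fun r h => absurd h hik
  have H2 : ∀ᵐ r : ℝ, ∀ k m, k ≠ l → m ≠ l → ∀ᵐ x : Fin n → ℝ, φ k (x + Pi.single l (r - x l)) * (φ m (x + Pi.single l (r - x l)))⁻¹ = φ k x * (φ m x)⁻¹ := by
    rw [ae_all_iff]; intro k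
    rw [ae_all_iff]; intro m
    by_cases hk : k ≠ l
    · by_cases hm : m ≠ l
      · have h3 := indep_ae_ae ((hφ k).mul (hφ m).inv) (hw k m l hk.symm hm.symm)
        have hq : MeasurableSet {p : (Fin n → ℝ) × ℝ | φ k (p.1 + Pi.single l (p.2 - p.1 l)) * (φ m (p.1 + Pi.single l (p.2 - p.1 l)))⁻¹ = φ k p.1 * (φ m p.1)⁻¹} := by
          have e : Measurable fun p : (Fin n → ℝ) × ℝ => p.1 + Pi.single l (p.2 - p.1 l) :=
            measurable_fst.add ((meas_single l).comp (show Measurable fun p : (Fin n → ℝ) × ℝ => p.2 - p.1 l by fun_prop))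
          exact measurableSet_eq_fun (((hφ k).mul (hφ m).inv).comp e) (((hφ k).mul (hφ m).inv).comp measurable_fst)
        have h4 := (Measure.ae_ae_comm (μ := volume) (ν := volume) (p := fun (x : Fin n → ℝ) (r : ℝ) => φ k (x + Pi.single l (r - x l)) * (φ m (x + Pi.single l (r - x l)))⁻¹ = φ k x * (φ m x)⁻¹) hq).1 (by
          filter_upwards [h3] with x hx
          exact (measurePreserving_sub_right volume (x l)).quasiMeasurePreserving.ae hx)
        filter_upwards [h4] with r hr _ _ using hr
      · exact Eventually.of_forall fun r _ h => absurd h hm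
    · exact Eventually.of_forall fun r h => absurd h hk
  obtain ⟨r, H1, H2⟩ := (H1.and H2).exists
  let p : Fin n → (Fin n → ℝ) → Λ := fun k x => φ k (x + Pi.single l (r - x l)) * (φ l (x + Pi.single l (r - x l)))⁻¹
  have hpm : ∀ k, Measurable (p k) := fun k => (hwm k).comp
    (measurable_id.add ((meas_single l).comp (show Measurable fun x : Fin n → ℝ => r - x l by fun_prop)))
  have hp : ∀ k, ∀ i, i ≠ k → Indep i (p k) := by
    intro k i hik
    by_cases hil : i = l
    · intro t; refine Eventually.of_forall fun x => ?_
      have : x + Pi.single i t + Pi.single l (r - (x + Pi.single i t : Fin n → ℝ) l) = x + Pi.single l (r - x l) := by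
        subst hil; rw [add_assoc, ← Pi.single_add]; simp; ring
      simp only [p, this]
    · exact H1 k i hik hil
  have hcomp : ∀ k, k ≠ l → ∀ᵐ x, (p k0 x)⁻¹ * φ k0 x = (p k x)⁻¹ * φ k x := by
    intro k hk
    filter_upwards [H2 k0 k hk0 hk] with x hx
    have e1 : p k0 x * (p k x)⁻¹ = φ k0 x * (φ k x)⁻¹ := by rw [← hx]; simp only [p]; group
    have e2 : p k0 x = φ k0 x * (φ k x)⁻¹ * p k x := by rw [← e1]; group
    rw [e2]; group
  refine ⟨fun x => (p k0 x)⁻¹ * φ k0 x, (hpm k0).inv.mul (hφ k0), fun k => ?_⟩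
  by_cases hk : k = l
  · subst hk
    refine (hG _).change h (p := fun x => (p k0 x)⁻¹ * (φ k0 x * (φ l x)⁻¹)) ((hpm k0).inv.mul (hwm k0)) (fun i hi => ?_) (Eventually.of_forall fun x => by simp only [l]; group)
    by_cases hi0 : i = k0
    · have hi1 : i ≠ k1 := by rw [hi0]; exact hk01.symm
      refine ((hp k1 i hi1).inv.mul (hw k1 l i hi1 hi)).congr ?_
      filter_upwards [hcomp k1 hk1] with x hx
      rw [← mul_assoc, hx, mul_assoc]
    · exact (hp k0 i hi0).inv.mul (hw k0 l i hi0 hi)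
  · exact (hG k).change h (p := fun x => (p k x)⁻¹) (hpm k).inv (fun i hi => (hp k i hi).inv) (hcomp k hk)

lemma tr_const (hn : 3 ≤ n) {V : Matrix (Fin n) (Fin n) ℝ → (Fin n → ℝ) → Λ} (h : Coc A Γ V) (hg : ∀ k, Good A V k) (i j : Fin n) (hij : i ≠ j) (a : ℝ) (ha : a ∈ A) :
    ∃ δ : Λ, ∀ᵐ x, V (Matrix.transvection i j a) x = δ := by
  refine indep_const (h.meas _) fun k' => ?_
  obtain ⟨k, hk⟩ := Finset.exists_mem_notMem_of_card_lt_card (s := ({i, k'} : Finset (Fin n))) (t := Finset.univ)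
    (by rw [Finset.card_univ, Fintype.card_fin]; exact (Finset.card_le_two).trans_lt (by omega))
  simp only [Finset.mem_univ, true_and, Finset.mem_insert, Finset.mem_singleton, not_or] at hk
  exact hg k i j (Ne.symm hk.1) hij a ha k' (Ne.symm hk.2)

def El (n : ℕ) (A : Subring ℝ) : Submonoid (Matrix (Fin n) (Fin n) ℝ) :=
  Submonoid.closure {M | ∃ i j : Fin n, i ≠ j ∧ ∃ a ∈ A, M = Matrix.transvection i j a}

lemma El_const {V : Matrix (Fin n) (Fin n) ℝ → (Fin n → ℝ) → Λ} (h : Coc A Γ V)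
    (hV : ∀ i j : Fin n, i ≠ j → ∀ a ∈ A, ∃ δ : Λ, ∀ᵐ x, V (Matrix.transvection i j a) x = δ) {M : Matrix (Fin n) (Fin n) ℝ} (hM : M ∈ El n A) :
    M ∈ Γ ∧ ∃ δ : Λ, ∀ᵐ x, V M x = δ := by
  induction hM using Submonoid.closure_induction with
  | mem M hM => obtain ⟨i, j, hij, a, ha, rfl⟩ := hM; exact ⟨h.tr i j hij a ha, hV i j hij a ha⟩
  | one =>
    refine ⟨Γ.one_mem, 1, Eventually.of_forall fun x => ?_⟩
    have := h.mul 1 Γ.one_mem 1 Γ.one_mem x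
    simpa using this
  | mul M N hM hN h1 h2 =>
    obtain ⟨h1, δ1, h3⟩ := h1
    obtain ⟨h2, δ2, h4⟩ := h2
    refine ⟨Γ.mul_mem h1 h2, δ1 * δ2, ?_⟩
    filter_upwards [h4, (mp_det _ (h.det _ h2)).quasiMeasurePreserving.ae h3] with x e1 e2
    rw [h.mul _ h1 _ h2, e1, e2]

lemma G_const {V : Matrix (Fin n) (Fin n) ℝ → (Fin n → ℝ) → Λ} (hn : 3 ≤ n) (h : Coc A Γ V) (hA : Dense (A : Set ℝ))
    (hV : ∀ i j : Fin n, i ≠ j → ∀ a ∈ A, ∃ δ : Λ, ∀ᵐ x, V (Matrix.transvection i j a) x = δ) {g : Matrix (Fin n) (Fin n) ℝ} (hg : g ∈ Γ)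
    (hnorm : ∀ i j : Fin n, i ≠ j → ∀ a ∈ A, ∃ M ∈ El n A, g * Matrix.transvection i j a = M * g) : ∃ δ : Λ, ∀ᵐ x, V g x = δ := by
  refine indep_const (h.meas _) fun i => ?_
  obtain ⟨j, hij⟩ : ∃ j, i ≠ j := by
    haveI : Nontrivial (Fin n) := Fin.nontrivial_iff_two_le.2 (by omega)
    obtain ⟨j, hj⟩ := exists_ne i; exact ⟨j, hj.symm⟩
  refine trick_shear hij hA (h.meas _) fun b hb => ?_
  obtain ⟨M, hM, e⟩ := hnorm i j hij b hb
  obtain ⟨hMG, δ, hδ⟩ := El_const h hV hM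
  obtain ⟨δ', hδ'⟩ := hV i j hij b hb
  refine ⟨fun _ => δ', fun _ => δ, by simp, by simp, ?_⟩
  filter_upwards [(mp_det _ (h.det _ hg)).quasiMeasurePreserving.ae hδ, hδ'] with x e1 e2
  rw [eq_mul_inv_iff_mul_eq, ← e1, ← e2, ← tr_mulVec, ← h.mul _ hg _ (h.tr i j hij b hb), ← h.mul _ hMG _ hg, e]
end Co
end OESuperrigidity

namespace OESuperrigidity
open Matrix
section Su
variable {n : ℕ} {A : Subring ℝ}

def Sr (A : Subring ℝ) (u : Fin n → ℝ) : AddSubmonoid (Fin n → ℝ) where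
  carrier := {v | v ⬝ᵥ u = 0 ∧ 1 + vecMulVec u v ∈ El n A}
  zero_mem' := by simp [(El n A).one_mem]
  add_mem' := by
    rintro v v' ⟨h1, h2⟩ ⟨h3, h4⟩
    refine ⟨by rw [add_dotProduct, h1, h3, add_zero], ?_⟩
    convert (El n A).mul_mem h2 h4 using 1
    rw [add_mul, mul_add, mul_add, vecMulVec_mul_vecMulVec, h1, vecMulVec_add]
    simp; abel

def Sl (A : Subring ℝ) (v : Fin n → ℝ) : AddSubmonoid (Fin n → ℝ) where
  carrier := {u | v ⬝ᵥ u = 0 ∧ 1 + vecMulVec u v ∈ El n A}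
  zero_mem' := by simp [(El n A).one_mem]
  add_mem' := by
    rintro v v' ⟨h1, h2⟩ ⟨h3, h4⟩
    refine ⟨by rw [dotProduct_add, h1, h3, add_zero], ?_⟩
    convert (El n A).mul_mem h2 h4 using 1
    rw [add_mul, mul_add, mul_add, vecMulVec_mul_vecMulVec, h3, add_vecMulVec]
    simp; abel

lemma tr_mem {i j : Fin n} (hij : i ≠ j) {a b : ℝ} (ha : a ∈ A) (hb : b ∈ A) : 1 + vecMulVec (Pi.single i a) (Pi.single j b) ∈ El n A :=
  Submonoid.subset_closure ⟨i, j, hij, a * b, A.mul_mem ha hb, by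
    rw [transvection]; congr 1; ext k l; simp [vecMulVec_apply, Matrix.single_apply, Pi.single_apply]
    by_cases h1 : i = k <;> by_cases h2 : j = l <;> simp [h1, h2, eq_comm]⟩

lemma row_mem {p : Fin n} {v : Fin n → ℝ} {a : ℝ} (ha : a ∈ A) (hv : ∀ i, v i ∈ A) (h0 : v p = 0) : v ∈ Sr A (Pi.single p a) := by
  rw [← Finset.univ_sum_single v]
  refine (Sr A _).sum_mem fun k _ => ?_
  by_cases hk : k = p
  · rw [hk, h0, Pi.single_zero]; exact (Sr A _).zero_mem
  · exact ⟨by simp [Pi.single_apply, hk], tr_mem (Ne.symm hk) ha (hv k)⟩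

lemma col_mem {p : Fin n} {u : Fin n → ℝ} {a : ℝ} (ha : a ∈ A) (hu : ∀ i, u i ∈ A) (h0 : u p = 0) : u ∈ Sl A (Pi.single p a) := by
  rw [← Finset.univ_sum_single u]
  refine (Sl A _).sum_mem fun k _ => ?_
  by_cases hk : k = p
  · rw [hk, h0, Pi.single_zero]; exact (Sl A _).zero_mem
  · exact ⟨by simp [Pi.single_apply, Ne.symm hk], tr_mem hk (hu k) ha⟩

lemma el3 {p : Fin n} {u v : Fin n → ℝ} (hu : ∀ i, u i ∈ A) (hv : ∀ i, v i ∈ A) (h0 : v p = 0) (h : v ⬝ᵥ u = 0) : 1 + vecMulVec u v ∈ El n A := by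
  have hr := row_mem (p := p) (hu p) hv h0
  have h1 : (u - Pi.single p (u p)) ∈ Sl A v := by
    have hu' : ∀ i, (u - Pi.single p (u p) : Fin n → ℝ) i ∈ A := fun i => by
      by_cases hi : i = p
      · subst hi; simp [A.zero_mem]
      · simp [hi, hu i]
    have e : v ⬝ᵥ (u - Pi.single p (u p)) = 0 := by rw [dotProduct_sub, h]; simp [h0]
    have hp : (u - Pi.single p (u p) : Fin n → ℝ) p = 0 := by simp
    refine ⟨e, ?_⟩
    generalize u - Pi.single p (u p) = w at *
    have c1 := (col_mem (p := p) A.one_mem hu' hp).2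
    have c2 := (row_mem (p := p) A.one_mem hv h0).2
    have c3 := (col_mem (p := p) (u := -w) A.one_mem (fun i => A.neg_mem (hu' i)) (by simp [hp])).2
    have c4 := (row_mem (p := p) (v := -v) A.one_mem (fun i => A.neg_mem (hv i)) (by simp [h0])).2
    convert (El n A).mul_mem ((El n A).mul_mem c1 c2) ((El n A).mul_mem c3 c4) using 1
    have x1 : vecMulVec w (Pi.single p (1:ℝ)) * vecMulVec (Pi.single p 1) v = vecMulVec w v := by
      rw [vecMulVec_mul_vecMulVec]; simp
    have x2 : vecMulVec (Pi.single p (1:ℝ)) v * vecMulVec w (Pi.single p (1:ℝ)) = 0 := by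
      rw [vecMulVec_mul_vecMulVec, e]; simp
    have x3 : vecMulVec w (Pi.single p (1:ℝ)) * vecMulVec w (Pi.single p (1:ℝ)) = 0 := by
      rw [vecMulVec_mul_vecMulVec]; simp [hp]
    have x4 : vecMulVec (Pi.single p (1:ℝ)) v * vecMulVec (Pi.single p (1:ℝ)) v = 0 := by
      rw [vecMulVec_mul_vecMulVec]; simp [h0]
    rw [neg_vecMulVec, vecMulVec_neg, ← x1]
    generalize vecMulVec w (Pi.single p (1:ℝ)) = x at *
    generalize vecMulVec (Pi.single p (1:ℝ)) v = y at *
    have : (1 + x) * (1 + y) * ((1 + -x) * (1 + -y)) = 1 + x * y - x * x - y * x - y * y + (x * x) * y + (y * x) * y - x * (y * x) - x * (y * y) + x * (y * x) * y := by noncomm_ring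
    rw [this, x2, x3, x4]; simp
  have := (Sl A v).add_mem h1 ⟨hr.1, hr.2⟩
  rw [sub_add_cancel] at this
  exact this.2

lemma suslin (hn : 3 ≤ n) {g : Matrix (Fin n) (Fin n) ℝ} (hg : ∀ i j, g i j ∈ A) (hd : g.det = 1) (i j : Fin n) (hij : i ≠ j) (a : ℝ) (ha : a ∈ A) :
    ∃ M ∈ El n A, g * transvection i j a = M * g := by
  have hadj : ∀ i j, g.adjugate i j ∈ A := by
    let g' : Matrix (Fin n) (Fin n) A := Matrix.of fun i j => ⟨g i j, hg i j⟩
    have : g = A.subtype.mapMatrix g' := by ext; rfl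
    intro i j
    rw [this, ← RingHom.map_adjugate]
    exact (g'.adjugate i j).2
  have e1 : g.adjugate * g = 1 := by rw [adjugate_mul, hd, one_smul]
  have e2 : ∀ k, g.adjugate k ⬝ᵥ (fun l => g l i) = if k = i then 1 else 0 := fun k => by
    have := congrFun (congrFun e1 k) i
    rw [mul_apply, one_apply] at this
    exact this
  set w := g.adjugate i
  set v := a • g.adjugate j
  set u : Fin n → ℝ := fun l => g l i
  have hv : ∀ k, v k ∈ A := fun k => A.mul_mem ha (hadj j k)
  have hvu : v ⬝ᵥ u = 0 := by rw [smul_dotProduct, e2]; simp [hij.symm]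
  have hwu : w ⬝ᵥ u = 1 := by rw [e2]; simp
  have hsum : v = ∑ k, ∑ l, (Pi.single k (v k * w l * u l) - Pi.single l (v k * w l * u k)) := by
    ext q
    simp only [Finset.sum_apply, Pi.sub_apply, Finset.sum_sub_distrib]
    have h1 : ∑ k, ∑ l, (Pi.single k (v k * w l * u l) : Fin n → ℝ) q = v q := by
      rw [Finset.sum_eq_single q (fun b _ hb => by simp [Pi.single_apply, Ne.symm hb]) (by simp)]
      simp only [Pi.single_eq_same, mul_assoc]
      rw [← Finset.mul_sum]
      exact (congrArg _ hwu).trans (mul_one _)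
    have h2 : ∑ k, ∑ l, (Pi.single l (v k * w l * u k) : Fin n → ℝ) q = 0 := by
      have : ∀ k, ∑ l, (Pi.single l (v k * w l * u k) : Fin n → ℝ) q = w q * (v k * u k) := fun k => by
        rw [Finset.sum_eq_single q (fun b _ hb => by simp [Pi.single_apply, Ne.symm hb]) (by simp)]
        simp; ring
      simp only [this]
      rw [← Finset.mul_sum]
      exact (congrArg _ hvu).trans (mul_zero _)
    rw [h1, h2, sub_zero]
  refine ⟨1 + vecMulVec u v, ?_, ?_⟩
  · have : v ∈ Sr A u := by
      rw [hsum]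
      refine (Sr A u).sum_mem fun k _ => (Sr A u).sum_mem fun l _ => ?_
      have m : ∀ q, v k * w l * u q ∈ A := fun q => A.mul_mem (A.mul_mem (hv k) (hadj i l)) (hg q i)
      have e : (Pi.single k (v k * w l * u l) - Pi.single l (v k * w l * u k)) ⬝ᵥ u = 0 := by
        rw [sub_dotProduct, single_dotProduct, single_dotProduct]; ring
      obtain ⟨p, hp⟩ := Finset.exists_mem_notMem_of_card_lt_card (s := ({k, l} : Finset (Fin n))) (t := Finset.univ)
        (by rw [Finset.card_univ, Fintype.card_fin]; exact (Finset.card_le_two).trans_lt (by omega))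
      simp only [Finset.mem_univ, true_and, Finset.mem_insert, Finset.mem_singleton, not_or] at hp
      refine ⟨e, el3 (p := p) (fun q => hg q i) (fun q => ?_) (by simp [Pi.single_apply, hp.1, hp.2]) e⟩
      have : ∀ (r : Fin n) (t : ℝ), t ∈ A → (Pi.single r t : Fin n → ℝ) q ∈ A := fun r t ht => by
        rw [Pi.single_apply]; split_ifs; exacts [ht, A.zero_mem]
      exact A.sub_mem (this _ _ (m l)) (this _ _ (m k))
    exact this.2
  · rw [transvection, mul_add, add_mul, mul_one, one_mul]
    congr 1
    have : v ᵥ* g = Pi.single j a := by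
      show (a • g.adjugate j) ᵥ* g = _
      rw [smul_vecMul]
      ext q
      have := congrFun (congrFun e1 j) q
      rw [mul_apply, one_apply] at this
      rw [Pi.smul_apply, show (g.adjugate j ᵥ* g) q = _ from this]
      simp [Pi.single_apply, eq_comm]
    rw [vecMulVec_mul, this]
    ext k l
    simp [vecMulVec_apply, mul_apply, Matrix.single_apply, Pi.single_apply, u]
    by_cases h : j = l <;> simp [h, eq_comm]
end Su
end OESuperrigidity

namespace OESuperrigidity
open Filter Topology

section Fin
variable {n : ℕ} {A : Subring ℝ} {G : Subgroup (Matrix.SpecialLinearGroup (Fin n) ℝ)}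

def lact (G : Subgroup (Matrix.SpecialLinearGroup (Fin n) ℝ)) (g : G) (x : Fin n → ℝ) : Fin n → ℝ :=
  ((g : Matrix.SpecialLinearGroup (Fin n) ℝ) : Matrix (Fin n) (Fin n) ℝ).mulVec x

lemma lact_mul (g h : G) (x : Fin n → ℝ) : lact G (g * h) x = lact G g (lact G h x) := by simp [lact, Matrix.mulVec_mulVec]
lemma lact_one (x : Fin n → ℝ) : lact G 1 x = x := by simp [lact]
lemma lact_mp (g : G) : MeasurePreserving (lact G g) volume volume := mp_det _ g.1.2
lemma lact_qmp (g : G) {p : (Fin n → ℝ) → Prop} (h : ∀ᵐ x, p x) : ∀ᵐ x, p (lact G g x) := (lact_mp g).quasiMeasurePreserving.ae h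
lemma mem_lact (g : G) (S : Set (Fin n → ℝ)) (x : Fin n → ℝ) : x ∈ lact G g '' S ↔ lact G g⁻¹ x ∈ S := by
  constructor
  · rintro ⟨y, hy, rfl⟩; rwa [← lact_mul, inv_mul_cancel, lact_one]
  · intro h; exact ⟨_, h, by rw [← lact_mul, mul_inv_cancel, lact_one]⟩
lemma inv_ae {g : G} {S : Set (Fin n → ℝ)} (h : volume (symmDiff (lact G g '' S) S) = 0) : ∀ᵐ x, (lact G g⁻¹ x ∈ S ↔ x ∈ S) := by
  filter_upwards [eventuallyEq_set.1 (measure_symmDiff_eq_zero_iff.1 h)] with x hx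
  rw [← mem_lact]; exact hx
lemma exists_tr (hE : En n A ≤ G) {i j : Fin n} (hij : i ≠ j) {a : ℝ} (ha : a ∈ A) : ∃ g : G, ((g : Matrix.SpecialLinearGroup (Fin n) ℝ) : Matrix (Fin n) (Fin n) ℝ) = Matrix.transvection i j a :=
  ⟨⟨⟨Matrix.transvection i j a, Matrix.det_transvection_of_ne i j hij a⟩, hE (Subgroup.subset_closure ⟨i, j, hij, a, ha, rfl⟩)⟩, rfl⟩

lemma ess_free : EssentiallyFree (volume : Measure (Fin n → ℝ)) (lact G) := by
  intro g hg
  let L : (Fin n → ℝ) →ₗ[ℝ] (Fin n → ℝ) := Matrix.toLin' ((g : Matrix.SpecialLinearGroup (Fin n) ℝ) : Matrix (Fin n) (Fin n) ℝ) - LinearMap.id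
  have e : {x | lact G g x = x} = (LinearMap.ker L : Set (Fin n → ℝ)) := by
    ext x; simp [L, lact, sub_eq_zero]
  rw [e]
  refine Measure.addHaar_submodule volume _ fun h => hg ?_
  rw [LinearMap.ker_eq_top, sub_eq_zero] at h
  have h2 : ((g : Matrix.SpecialLinearGroup (Fin n) ℝ) : Matrix (Fin n) (Fin n) ℝ) = 1 := by
    apply Matrix.toLin'.injective; rw [h, Matrix.toLin'_one]
  exact Subtype.ext (Subtype.ext h2)

lemma shear_cont (i j : Fin n) : Continuous (Function.uncurry fun (t : ℝ) (x : Fin n → ℝ) => x + Pi.single i (t * x j)) :=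
  continuous_snd.add ((cont_single i).comp (show Continuous fun p : ℝ × (Fin n → ℝ) => p.1 * p.2 j by fun_prop))

lemma shear_add {i j : Fin n} (hij : i ≠ j) (s t : ℝ) (x : Fin n → ℝ) : x + Pi.single i ((s + t) * x j) =
    (x + Pi.single i (t * x j)) + Pi.single i (s * (x + Pi.single i (t * x j) : Fin n → ℝ) j) := by
  have : (x + Pi.single i (t * x j) : Fin n → ℝ) j = x j := by simp [hij.symm]
  rw [this, add_assoc, ← Pi.single_add]; congr 2; ring

lemma erg_core (hn : 3 ≤ n) (hA : Dense (A : Set ℝ)) {S : Set (Fin n → ℝ)} (hS : MeasurableSet S) (h0 : volume S ≠ 0)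
    (h : ∀ i j : Fin n, i ≠ j → ∃ ε > 0, ∀ a ∈ A, |a| < ε → ∀ᵐ x : Fin n → ℝ, (x + Pi.single i (a * x j) ∈ S ↔ x ∈ S)) : ∀ᵐ x, x ∈ S := by
  refine all_of_indep hS (fun i => ?_) h0
  obtain ⟨j, hij⟩ : ∃ j, i ≠ j := by
    haveI : Nontrivial (Fin n) := Fin.nontrivial_iff_two_le.2 (by omega)
    obtain ⟨j, hj⟩ := exists_ne i; exact ⟨j, hj.symm⟩
  obtain ⟨ε, hε, h⟩ := h i j hij
  have hq : ∀ t (p : (Fin n → ℝ) → Prop), (∀ᵐ x, p x) → ∀ᵐ x : Fin n → ℝ, p (x + Pi.single i (t * x j)) := fun t p hp => (mp_shear i j hij t).quasiMeasurePreserving.ae hp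
  let H : AddSubgroup ℝ :=
    { carrier := {t | ∀ᵐ x : Fin n → ℝ, (x + Pi.single i (t * x j) ∈ S ↔ x ∈ S)}
      zero_mem' := by simp
      add_mem' := by
        intro s t hs ht
        show ∀ᵐ x : Fin n → ℝ, (x + Pi.single i ((s + t) * x j) ∈ S ↔ x ∈ S)
        filter_upwards [hq t _ hs, ht] with x h1 h2
        rw [shear_add hij, h1, h2]
      neg_mem' := by
        intro t ht
        show ∀ᵐ x : Fin n → ℝ, (x + Pi.single i (-t * x j) ∈ S ↔ x ∈ S)
        filter_upwards [hq (-t) _ ht] with x h1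
        rw [← h1, ← shear_add hij]; simp }
  have hAH : (A : Set ℝ) ⊆ H := by
    intro a ha
    obtain ⟨b, hb, hb0, hb1⟩ := hA.exists_between hε
    have hb' : b ∈ H := h b hb (by rw [abs_of_pos hb0]; exact hb1)
    have e : a = ⌊a / b⌋ • b + (a - ⌊a / b⌋ • b) := by abel
    rw [e]
    refine H.add_mem (H.zsmul_mem hb' _) (h _ (A.sub_mem ha (A.zsmul_mem hb _)) ?_)
    have e2 : a - ⌊a / b⌋ • b = Int.fract (a / b) * b := by
      rw [Int.fract]; field_simp; simp [mul_comm]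
    rw [e2, abs_of_nonneg (mul_nonneg (Int.fract_nonneg _) hb0.le)]
    nlinarith [Int.fract_lt_one (a / b)]
  have := trick_set (μ := (volume : Measure (Fin n → ℝ))) (fun t x => x + Pi.single i (t * x j)) (shear_cont i j) (fun t => mp_shear i j hij t) (by simp) (fun s t x => shear_add hij s t x)
    H (hA.mono hAH) hS fun b hb => show ∀ᵐ x : Fin n → ℝ, (x + Pi.single i (b * x j) ∈ S ↔ x ∈ S) from hb
  intro t
  filter_upwards [indep_of_shear hij (f := fun x => x ∈ S) (measurableSet_setOf.1 hS) (fun t => (this t).mono fun x hx => propext hx) t] with x hx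
  exact iff_of_eq hx

lemma ergo (hn : 3 ≤ n) (hA : Dense (A : Set ℝ)) (hE : En n A ≤ G) : ErgodicAction (volume : Measure (Fin n → ℝ)) (lact G) := by
  intro S hS h
  by_cases h0 : volume S = 0
  · exact Or.inl h0
  refine Or.inr (erg_core hn hA hS h0 fun i j hij => ⟨1, one_pos, fun a ha _ => ?_⟩)
  obtain ⟨g, hg⟩ := exists_tr hE hij ha
  have := inv_ae (h g⁻¹)
  rw [inv_inv] at this
  filter_upwards [this] with x hx
  rw [← hx, lact, hg, tr_mulVec]

lemma not_ind (hn : 3 ≤ n) (hA : Dense (A : Set ℝ)) (hE : En n A ≤ G) : ¬ IsInduced (volume : Measure (Fin n → ℝ)) (lact G) := by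
  rintro ⟨G0, hG0, X0, hX0, hpos, hinv, R, hR, hdis, -⟩
  have c1 : ∀ g : G, (¬ ∀ᵐ x, ¬ (x ∈ X0 ∧ lact G g⁻¹ x ∈ X0)) → g ∈ G0 := by
    intro g hg
    obtain ⟨r, ⟨hr, hr1⟩, -⟩ := hR 1
    obtain ⟨s, ⟨hs, hs1⟩, -⟩ := hR g
    rw [inv_one, one_mul] at hr1
    have hrs : r = s := by
      by_contra hne
      refine hg ?_
      filter_upwards [measure_eq_zero_iff_ae_notMem.1 (hdis hr hs hne), inv_ae (hinv r hr1), lact_qmp g⁻¹ (inv_ae (hinv _ hs1))] with x e1 e2 e3 e4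
      refine e1 ⟨(mem_lact _ _ _).2 (e2.2 e4.1), (mem_lact _ _ _).2 ?_⟩
      have := e3.2 e4.2
      rwa [← lact_mul, mul_inv_rev, inv_inv, mul_assoc, mul_inv_cancel, mul_one] at this
    rw [← hrs] at hs1
    have := G0.mul_mem hr1 (G0.inv_mem hs1)
    simpa using this
  have hall : ∀ᵐ x, x ∈ X0 := by
    refine erg_core hn hA hX0 hpos.ne' fun i j hij => ?_
    obtain ⟨B, hBm, hBX, hB0, hB1⟩ := Measure.exists_subset_measure_lt_top hX0 hpos
    have := cm (μ := (volume : Measure (Fin n → ℝ))) (fun t x => x + Pi.single i (t * x j)) (shear_cont i j) (fun t => mp_shear i j hij t) 0 (by simp)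
      (f := fun x => x ∈ X0) (measurableSet_setOf.1 hX0) hBm hB1
    obtain ⟨ε, hε, h⟩ := Metric.eventually_nhds_iff.1 (this.eventually_lt_const hB0)
    refine ⟨ε, hε, fun a ha hae => ?_⟩
    obtain ⟨g, hg⟩ := exists_tr hE hij ha
    have ea : ∀ x, lact G g x = x + Pi.single i (a * x j) := fun x => by rw [lact, hg, tr_mulVec]
    have hm : g⁻¹ ∈ G0 := by
      refine c1 _ fun hn => ?_
      have h1 := h (y := a) (by simpa using hae)
      refine h1.not_ge (measure_mono_ae ?_)
      filter_upwards [hn] with x hx hxB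
      refine ⟨hxB, fun e => hx ⟨hBX hxB, ?_⟩⟩
      rw [inv_inv, ea]
      exact (iff_of_eq e).2 (hBX hxB)
    have := inv_ae (hinv _ hm)
    rw [inv_inv] at this
    filter_upwards [this] with x hx
    rw [← ea]; exact hx
  refine hG0 (eq_top_iff.2 fun g _ => c1 g fun hf => ?_)
  obtain ⟨x, h1, h2, h3⟩ := (hf.and (hall.and (lact_qmp g⁻¹ hall))).exists
  exact h1 ⟨h2, h3⟩
end Fin
end OESuperrigidity

namespace OESuperrigidity
open Filter Topology

section Fin
variable {m : ℕ} {A : Subring ℝ} {G : Subgroup (Matrix.SpecialLinearGroup (Fin (m+1)) ℝ)}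

lemma superrig (hm : 2 ≤ m) [Countable A] {u : ℝ} {A0 : Subring ℝ} {c0 : ℕ → ℤ} {d0 : ℕ} (h0 : A0 ≤ A) (hu : UData u A0 c0 d0) (hE : En (m+1) A ≤ G)
    (hGA : ∀ g ∈ G, ∀ i j, (g : Matrix (Fin (m+1)) (Fin (m+1)) ℝ) i j ∈ A) : CocycleSuperrigid (volume : Measure (Fin (m+1) → ℝ)) (lact G) := by
  classical
  intro Λ _ _ Ω hΩ
  letI : MeasurableSpace Λ := ⊤
  haveI : DiscreteMeasurableSpace Λ := ⟨fun _ => trivial⟩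
  have hΩm : ∀ g, Measurable (Ω g) := fun g => measurable_to_countable' fun l => hΩ.1 g l
  have hA : Dense (A : Set ℝ) := hu.dense.mono h0
  haveI : Countable A0 := (Subring.inclusion_injective h0).countable
  have hinj : ∀ g h : G, ((g : Matrix.SpecialLinearGroup (Fin (m+1)) ℝ) : Matrix (Fin (m+1)) (Fin (m+1)) ℝ) = (h : Matrix.SpecialLinearGroup (Fin (m+1)) ℝ) → g = h :=
    fun g h e => Subtype.ext (Subtype.ext e)
  haveI : Countable G := by
    refine Function.Injective.countable (f := fun (g : G) i j => (⟨(g : Matrix.SpecialLinearGroup (Fin (m+1)) ℝ).1 i j, hGA g.1 g.2 i j⟩ : A)) fun g h e => hinj g h ?_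
    ext i j
    exact congrArg Subtype.val (congrFun (congrFun e i) j)
  let X0 : Set (Fin (m+1) → ℝ) := {x | ∀ g h p : G, Ω (g * h) (lact G p x) = Ω g (lact G h (lact G p x)) * Ω h (lact G p x)}
  have hlm : ∀ g : G, Measurable (lact G g) := fun g => (lact_mp g).measurable
  have hX0m : MeasurableSet X0 := by
    simp only [X0, Set.setOf_forall]
    exact MeasurableSet.iInter fun g => MeasurableSet.iInter fun h => MeasurableSet.iInter fun p =>
      measurableSet_eq_fun ((hΩm _).comp (hlm p)) ((((hΩm g).comp (hlm h)).mul (hΩm h)).comp (hlm p))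
  have hX0 : ∀ᵐ x, x ∈ X0 := by
    show ∀ᵐ x, ∀ g h p : G, _
    simp only [ae_all_iff]
    exact fun g h p => lact_qmp p (hΩ.2 g h)
  have hXi : ∀ (q : G) x, x ∈ X0 → lact G q x ∈ X0 := fun q x hx g h p => by
    rw [← lact_mul p q]; exact hx g h (p * q)
  have hXi' : ∀ (q : G) x, lact G q x ∈ X0 ↔ x ∈ X0 := fun q x => ⟨fun h => by
    have := hXi q⁻¹ _ h
    rwa [← lact_mul, inv_mul_cancel, lact_one] at this, hXi q x⟩
  let Ω' : G → (Fin (m+1) → ℝ) → Λ := fun g x => if x ∈ X0 then Ω g x else 1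
  have hΩ' : ∀ g h x, Ω' (g * h) x = Ω' g (lact G h x) * Ω' h x := by
    intro g h x
    by_cases hx : x ∈ X0
    · have := hx g h 1
      simp only [lact_one] at this
      simp [Ω', hx, hXi', this]
    · simp [Ω', hx, hXi']
  let Γ : Submonoid (Matrix (Fin (m+1)) (Fin (m+1)) ℝ) :=
    { carrier := {M | ∃ g : G, ((g : Matrix.SpecialLinearGroup (Fin (m+1)) ℝ) : Matrix (Fin (m+1)) (Fin (m+1)) ℝ) = M}
      one_mem' := ⟨1, by simp⟩
      mul_mem' := by rintro _ _ ⟨g, rfl⟩ ⟨h, rfl⟩; exact ⟨g * h, by simp⟩ }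
  let W : Matrix (Fin (m+1)) (Fin (m+1)) ℝ → (Fin (m+1) → ℝ) → Λ := fun M x =>
    if h : ∃ g : G, ((g : Matrix.SpecialLinearGroup (Fin (m+1)) ℝ) : Matrix (Fin (m+1)) (Fin (m+1)) ℝ) = M then Ω' h.choose x else 1
  have hW : ∀ (g : G) x, W ((g : Matrix.SpecialLinearGroup (Fin (m+1)) ℝ) : Matrix (Fin (m+1)) (Fin (m+1)) ℝ) x = Ω' g x := by
    intro g x
    have h : ∃ g' : G, ((g' : Matrix.SpecialLinearGroup (Fin (m+1)) ℝ) : Matrix (Fin (m+1)) (Fin (m+1)) ℝ) = (g : Matrix.SpecialLinearGroup (Fin (m+1)) ℝ) := ⟨g, rfl⟩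
    simp only [W, dif_pos h]
    rw [hinj _ _ h.choose_spec]
  have hC : Coc A Γ W := by
    refine ⟨fun M => ?_, ?_, ?_, fun i j hij a ha => exists_tr hE hij ha⟩
    · by_cases h : ∃ g : G, ((g : Matrix.SpecialLinearGroup (Fin (m+1)) ℝ) : Matrix (Fin (m+1)) (Fin (m+1)) ℝ) = M
      · simp only [W, dif_pos h]
        exact Measurable.ite hX0m (hΩm _) measurable_const
      · simp only [W, dif_neg h]; exact measurable_const
    · rintro _ ⟨g, rfl⟩ _ ⟨h, rfl⟩ x
      have := hW (g * h) x
      rw [hΩ', ← hW, ← hW] at this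
      simpa [lact] using this
    · rintro _ ⟨g, rfl⟩; exact g.1.2
  obtain ⟨φ, hφ, hg⟩ := all_good (by omega) hC hA fun k => exists_good hm hC h0 hu k
  have hV := hC.twi hφ
  have hc : ∀ g : G, ∃ δ : Λ, ∀ᵐ x, φ (lact G g x) * Ω' g x * (φ x)⁻¹ = δ := fun g => by
    obtain ⟨δ, h⟩ := G_const (by omega) hV hA (fun i j hij a ha => tr_const (by omega) hV hg i j hij a ha) (g := g.1.1) ⟨g, rfl⟩
      (fun i j hij a ha => suslin (by omega) (hGA g.1 g.2) g.1.2 i j hij a ha)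
    refine ⟨δ, ?_⟩
    filter_upwards [h] with x hx
    rw [← hW]; exact hx
  choose δ hδ using hc
  refine ⟨MonoidHom.mk' δ fun g h => ?_, φ, fun l => hφ (MeasurableSet.singleton l), fun g => ?_⟩
  · obtain ⟨x, e1, e2, e3⟩ := ((hδ (g * h)).and ((lact_qmp h (hδ g)).and (hδ h))).exists
    rw [← e1, ← e2, ← e3, hΩ', lact_mul]; group
  · filter_upwards [hδ g, hX0] with x e1 e2
    simp only [Ω', e2, if_true] at e1
    rw [MonoidHom.mk'_apply, ← e1]; group
end Fin

theorem linear_action_cocycle_superrigid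
    (A : Subring ℝ) (hAcount : Countable A)
    (hAalg : ∃ a : ℝ, a ∈ A ∧ IsAlgebraic ℚ a ∧ a ∉ Set.range (Int.cast : ℤ → ℝ))
    (n : ℕ) (hn : 3 ≤ n)
    (G : Subgroup (Matrix.SpecialLinearGroup (Fin n) ℝ))
    (hEnG : En n A ≤ G)
    (hGA : ∀ g ∈ G, ∀ i j : Fin n, (g : Matrix (Fin n) (Fin n) ℝ) i j ∈ A) :
    EssentiallyFree (volume : Measure (Fin n → ℝ))
        (fun (g : G) (x : Fin n → ℝ) =>
          ((g : Matrix.SpecialLinearGroup (Fin n) ℝ) : Matrix (Fin n) (Fin n) ℝ).mulVec x) ∧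
    ErgodicAction (volume : Measure (Fin n → ℝ))
        (fun (g : G) (x : Fin n → ℝ) =>
          ((g : Matrix.SpecialLinearGroup (Fin n) ℝ) : Matrix (Fin n) (Fin n) ℝ).mulVec x) ∧
    ¬ IsInduced (volume : Measure (Fin n → ℝ))
        (fun (g : G) (x : Fin n → ℝ) =>
          ((g : Matrix.SpecialLinearGroup (Fin n) ℝ) : Matrix (Fin n) (Fin n) ℝ).mulVec x) ∧
    CocycleSuperrigid (volume : Measure (Fin n → ℝ))
        (fun (g : G) (x : Fin n → ℝ) =>
          ((g : Matrix.SpecialLinearGroup (Fin n) ℝ) : Matrix (Fin n) (Fin n) ℝ).mulVec x) := by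
  obtain ⟨u, A0, c, d, h0, hu⟩ := exists_UData A hAalg
  have hA : Dense (A : Set ℝ) := hu.dense.mono h0
  obtain ⟨m, rfl⟩ : ∃ m, n = m + 1 := ⟨n - 1, by omega⟩
  exact ⟨ess_free, ergo hn hA hEnG, not_ind hn hA hEnG, superrig (by omega) h0 hu hEnG hGA⟩

end OESuperrigidity
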